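/- arXiv:2204.03780 — 3 statements merged into one kernel-verified Lean document; each statement's English description precedes it below -/
import Mathlib

section
/- Assume the transversality hypothesis and auxiliary hypothesis 2. Let f = (f₁,f₂,f₃) be an ordered triple of Lebesgue measurable functions, each defined on an open subset of ℝ², satisfying Σ_{j=1}^3 f_j(Φ_j(x,s))·∇φ_j(x) = 0 almost everywhere in some open subset Ω of {(x,s) ∈ B×ℝ : s ≠ 0}. Then for each j ∈ {1,2,3}, the function (x,s) ↦ f_j(Φ_j(x,s)) agrees almost everywhere on Ω with a real analytic function. -/
open MeasureTheory Real Set Filter Metric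
open scoped FourierTransform ENNReal NNReal Topology ComplexConjugate

noncomputable section

abbrev Vec2 : Type := ℝ × ℝ

/-- The quadrilinear form `T(f) = ∫ ∏ⱼ fⱼ(φⱼ(x)) η(x) dx`. -/
def Tform (φ : Fin 4 → Vec2 → ℝ) (η : Vec2 → ℝ) (f : Fin 4 → ℝ → ℂ) : ℂ :=
  ∫ x : Vec2, (∏ j : Fin 4, f j (φ j x)) * (η x : ℂ)
/-- `D = ∂/∂x₂`. -/
def Dder (φ : Vec2 → ℝ) (x : Vec2) : ℝ := fderiv ℝ φ x ((0, 1) : Vec2)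

/-- `Φⱼ(x,s) = (φⱼ(x), s·Dφⱼ(x))`. -/
def Φmap (φ : Vec2 → ℝ) (p : Vec2 × ℝ) : Vec2 := (φ p.1, p.2 * Dder φ p.1)

/-- An injective continuous linear map between spaces of equal finite dimension is an equiv. -/
lemma clm_equiv_aux {E F : Type*} [NormedAddCommGroup E] [NormedSpace ℝ E] [FiniteDimensional ℝ E]
    [NormedAddCommGroup F] [NormedSpace ℝ F] [FiniteDimensional ℝ F]
    (L : E →L[ℝ] F) (hinj : ∀ v, L v = 0 → v = 0)
    (hdim : Module.finrank ℝ E = Module.finrank ℝ F) :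
    ∃ e : E ≃L[ℝ] F, (e : E →L[ℝ] F) = L := by
  have hi : Function.Injective (L : E →ₗ[ℝ] F) := by
    rw [injective_iff_map_eq_zero]; exact hinj
  refine ⟨(LinearEquiv.ofInjectiveOfFinrankEq (L : E →ₗ[ℝ] F) hi hdim).toContinuousLinearEquiv, ?_⟩
  ext v
  rfl

lemma analytic_inverse_aux {E F : Type*} [NormedAddCommGroup E] [NormedSpace ℝ E]
    [FiniteDimensional ℝ E]
    [NormedAddCommGroup F] [NormedSpace ℝ F] [FiniteDimensional ℝ F]
    (f : E → F) (a : E) (L : E →L[ℝ] F) (hf : AnalyticAt ℝ f a) (hL : HasFDerivAt f L a)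
    (hinj : ∀ v, L v = 0 → v = 0)
    (hdim : Module.finrank ℝ E = Module.finrank ℝ F) :
    ∃ g : F → E, AnalyticAt ℝ g (f a) ∧ g (f a) = a ∧ (∀ᶠ y in 𝓝 (f a), f (g y) = y) ∧
      (∀ᶠ x in 𝓝 a, g (f x) = x) := by
  have : CompleteSpace E := FiniteDimensional.complete ℝ E
  have : CompleteSpace F := FiniteDimensional.complete ℝ F
  obtain ⟨e, rfl⟩ := clm_equiv_aux L hinj hdim
  have hc : ContDiffAt ℝ ⊤ f a := hf.contDiffAt
  have hs := hc.hasStrictFDerivAt' hL (by simp)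
  refine ⟨hc.localInverse hL (by simp), ?_, hc.localInverse_apply_image hL (by simp), ?_, ?_⟩
  · exact (hc.to_localInverse hL (by simp)).analyticAt
  · exact hs.eventually_right_inverse
  · exact hs.eventually_left_inverse

lemma null_preimage_aux {E : Type*} [NormedAddCommGroup E] [NormedSpace ℝ E]
    [FiniteDimensional ℝ E] [MeasurableSpace E] [BorelSpace E] (μ : Measure E) [μ.IsAddHaarMeasure]
    (f : E → E) (a : E) (L : E →L[ℝ] E) (hf : AnalyticAt ℝ f a) (hL : HasFDerivAt f L a)
    (hinj : ∀ v, L v = 0 → v = 0) :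
    ∃ U ∈ 𝓝 a, ∀ N : Set E, μ N = 0 → μ (U ∩ f ⁻¹' N) = 0 := by
  obtain ⟨g, hg, -, -, hgf⟩ := analytic_inverse_aux f a L hf hL hinj rfl
  have hV := hg.eventually_analyticAt
  refine ⟨_, hgf.and (hf.continuousAt.eventually hV), fun N hN => ?_⟩
  have hd : DifferentiableOn ℝ g (N ∩ {y | AnalyticAt ℝ g y}) :=
    fun y hy => hy.2.differentiableAt.differentiableWithinAt
  refine measure_mono_null ?_ (addHaar_image_eq_zero_of_differentiableOn_of_addHaar_eq_zero μ hd
    (measure_mono_null inter_subset_left hN))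
  rintro x ⟨⟨h1, h2⟩, h3⟩
  exact ⟨f x, ⟨h3, h2⟩, h1⟩

lemma null_preimage_aux2 {E : Type*} [NormedAddCommGroup E] [NormedSpace ℝ E]
    [FiniteDimensional ℝ E] [MeasurableSpace E] [BorelSpace E] (μ : Measure E) [μ.IsAddHaarMeasure]
    (r : E × E → E) (z : E × E) (L : E × E →L[ℝ] E) (hr : AnalyticAt ℝ r z)
    (hL : HasFDerivAt r L z) (hinj : ∀ d, L (d, d) = 0 → d = 0) (N : Set E) (hN : μ N = 0) :
    ∃ U ∈ 𝓝 z, (μ.prod μ) (U ∩ r ⁻¹' N) = 0 := by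
  have : SecondCountableTopology E := by
    have := FiniteDimensional.proper ℝ E
    infer_instance
  obtain ⟨U, hU, h⟩ := null_preimage_aux (μ.prod μ) (fun w : E × E => (r w, w.2 - w.1)) z
    (L.prod (ContinuousLinearMap.snd ℝ E E - ContinuousLinearMap.fst ℝ E E))
    (hr.prod (analyticAt_snd.sub analyticAt_fst))
    (hL.prodMk (hasFDerivAt_snd.sub hasFDerivAt_fst)) (by
      rintro ⟨d, d'⟩ hd
      simp only [ContinuousLinearMap.prod_apply, Prod.mk_eq_zero] at hd
      obtain ⟨h1, h2⟩ := hd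
      have h3 : d' = d := by simpa [sub_eq_zero] using h2
      subst h3
      have := hinj _ h1
      simp [this])
  refine ⟨U, hU, ?_⟩
  have := h (N ×ˢ univ) (by rw [Measure.prod_prod, hN, zero_mul])
  convert this using 2
  ext w
  simp

lemma local_main_aux {E : Type*} [NormedAddCommGroup E] [NormedSpace ℝ E]
    [FiniteDimensional ℝ E] [MeasurableSpace E] [BorelSpace E] (μ : Measure E) [μ.IsAddHaarMeasure]
    (hdim : Module.finrank ℝ E = 3)
    (Φ1 Φ2 Φ3 : E → ℝ × ℝ) (p0 : E) (A1 A2 A3 : E →L[ℝ] ℝ × ℝ)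
    (h1 : AnalyticAt ℝ Φ1 p0) (h2 : AnalyticAt ℝ Φ2 p0) (h3 : AnalyticAt ℝ Φ3 p0)
    (hA1 : HasFDerivAt Φ1 A1 p0) (hA2 : HasFDerivAt Φ2 A2 p0) (hA3 : HasFDerivAt Φ3 A3 p0)
    (H : ∀ u1 u2 u3, A1 u1 = 0 → A2 u2 = 0 → A3 u3 = 0 → u1 + u2 + u3 = 0 →
      u1 = 0 ∧ u2 = 0 ∧ u3 = 0)
    (c1 c2 : E → ℝ) (hc1 : AnalyticAt ℝ c1 p0) (hc2 : AnalyticAt ℝ c2 p0)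
    (F1 F2 F3 : ℝ × ℝ → ℝ) (Ω : Set E) (hΩ : Ω ∈ 𝓝 p0)
    (hN1 : ∀ᵐ q ∂μ, q ∈ Ω → F2 (Φ2 q) = F3 (Φ3 q) * c1 q)
    (hN2 : ∀ᵐ q ∂μ, q ∈ Ω → F1 (Φ1 q) = F2 (Φ2 q) * c2 q) :
    ∃ g : E → ℝ, ∃ U : Set E, IsOpen U ∧ p0 ∈ U ∧ AnalyticOnNhd ℝ g U ∧
      ∀ᵐ q ∂μ, q ∈ U → F1 (Φ1 q) = g q := by
  have : SecondCountableTopology E := by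
    have := FiniteDimensional.proper ℝ E
    infer_instance
  let P := ℝ × ℝ
  let X := E × E × E × E
  let πp : X →L[ℝ] E := ContinuousLinearMap.fst ℝ _ _
  let πq : X →L[ℝ] E := (ContinuousLinearMap.fst ℝ _ _).comp (ContinuousLinearMap.snd ℝ _ _)
  let πa : X →L[ℝ] E := (ContinuousLinearMap.fst ℝ _ _).comp
    ((ContinuousLinearMap.snd ℝ _ _).comp (ContinuousLinearMap.snd ℝ _ _))
  let πb : X →L[ℝ] E := (ContinuousLinearMap.snd ℝ _ _).comp
    ((ContinuousLinearMap.snd ℝ _ _).comp (ContinuousLinearMap.snd ℝ _ _))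
  let T : X → E × E × P × P × P := fun x =>
    (πp x, πq x, Φ3 (πa x) - Φ3 (πp x), Φ2 (πb x) - Φ2 (πa x), Φ1 (πb x) - Φ1 (πq x))
  let L : X →L[ℝ] E × E × P × P × P :=
    πp.prod (πq.prod ((A3.comp πa - A3.comp πp).prod
      ((A2.comp πb - A2.comp πa).prod (A1.comp πb - A1.comp πq))))
  let x0 : X := (p0, p0, p0, p0)
  have comp_an : ∀ (Φ : E → P) (ρ : X →L[ℝ] E), AnalyticAt ℝ Φ (ρ x0) →
      AnalyticAt ℝ (fun x => Φ (ρ x)) x0 := fun Φ ρ h => h.comp (ρ.analyticAt x0)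
  have comp_d : ∀ (Φ : E → P) (A : E →L[ℝ] P) (ρ : X →L[ℝ] E), HasFDerivAt Φ A (ρ x0) →
      HasFDerivAt (fun x => Φ (ρ x)) (A.comp ρ) x0 :=
    fun Φ A ρ h => h.comp x0 ρ.hasFDerivAt
  have hT : AnalyticAt ℝ T x0 :=
    (πp.analyticAt x0).prod ((πq.analyticAt x0).prod
      (((comp_an Φ3 πa h3).sub (comp_an Φ3 πp h3)).prod
      (((comp_an Φ2 πb h2).sub (comp_an Φ2 πa h2)).prod
       ((comp_an Φ1 πb h1).sub (comp_an Φ1 πq h1)))))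
  have hTL : HasFDerivAt T L x0 :=
    (πp.hasFDerivAt).prodMk ((πq.hasFDerivAt).prodMk
      (((comp_d Φ3 A3 πa hA3).sub (comp_d Φ3 A3 πp hA3)).prodMk
      (((comp_d Φ2 A2 πb hA2).sub (comp_d Φ2 A2 πa hA2)).prodMk
       ((comp_d Φ1 A1 πb hA1).sub (comp_d Φ1 A1 πq hA1)))))
  obtain ⟨g, hg, hgx, hTg, -⟩ := analytic_inverse_aux T x0 L hT hTL (by
      rintro ⟨vp, vq, va, vb⟩ hv
      simp only [L, ContinuousLinearMap.prod_apply, Prod.mk_eq_zero] at hv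
      obtain ⟨e1, e2, e3, e4, e5⟩ := hv
      change vp = 0 at e1
      change vq = 0 at e2
      change A3 va - A3 vp = 0 at e3
      change A2 vb - A2 va = 0 at e4
      change A1 vb - A1 vq = 0 at e5
      subst e1 e2
      simp only [map_zero, sub_zero] at e3 e5
      obtain ⟨k1, k2, k3⟩ := H (-vb) (vb - va) va (by simp [e5]) (by simpa using e4) e3 (by abel)
      have k1' : vb = 0 := neg_eq_zero.1 k1
      rw [k1', k3]
      rfl) (by
      simp only [X, P, Module.finrank_prod, hdim, Module.finrank_self])
  have hTx : T x0 = (p0, p0, 0, 0, 0) := by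
    change (p0, p0, Φ3 p0 - Φ3 p0, Φ2 p0 - Φ2 p0, Φ1 p0 - Φ1 p0) = _
    simp only [sub_self]
  rw [hTx] at hg hgx hTg
  let ι : E × E → E × E × P × P × P := fun z => (z.1, z.2, 0, 0, 0)
  have hι : ∀ z, AnalyticAt ℝ ι z := fun z =>
    analyticAt_fst.prod (analyticAt_snd.prod analyticAt_const)
  let z0 : E × E := (p0, p0)
  have hgι : AnalyticAt ℝ (fun z => g (ι z)) z0 := AnalyticAt.comp (g := g) (f := ι) hg (hι z0)
  let q1 : E × E → E := fun z => πa (g (ι z))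
  let q2 : E × E → E := fun z => πb (g (ι z))
  have hq1 : AnalyticAt ℝ q1 z0 := (πa.analyticAt _).comp hgι
  have hq2 : AnalyticAt ℝ q2 z0 := (πb.analyticAt _).comp hgι
  have hq1z : q1 z0 = p0 := by
    change πa (g (p0, p0, 0, 0, 0)) = p0
    rw [hgx]; rfl
  have hq2z : q2 z0 = p0 := by
    change πb (g (p0, p0, 0, 0, 0)) = p0
    rw [hgx]; rfl
  have hev : ∀ᶠ z in 𝓝 z0, Φ3 (q1 z) = Φ3 z.1 ∧ Φ2 (q2 z) = Φ2 (q1 z) ∧ Φ1 (q2 z) = Φ1 z.2 := by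
    have := (hι z0).continuousAt.eventually hTg
    filter_upwards [this] with z hz
    simp only [T, ι, Prod.mk.injEq] at hz
    obtain ⟨e1, e2, e3, e4, e5⟩ := hz
    rw [e1] at e3
    rw [e2] at e5
    exact ⟨sub_eq_zero.1 e3, sub_eq_zero.1 e4, sub_eq_zero.1 e5⟩
  have d1 := hq1.differentiableAt.hasFDerivAt
  have d2 := hq2.differentiableAt.hasFDerivAt
  set L1 := fderiv ℝ q1 z0
  set L2 := fderiv ℝ q2 z0
  have D3 : A3.comp L1 = A3.comp (ContinuousLinearMap.fst ℝ E E) := by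
    have a : HasFDerivAt (fun z => Φ3 (q1 z)) (A3.comp L1) z0 :=
      HasFDerivAt.comp z0 (by rw [hq1z]; exact hA3) d1
    have b : HasFDerivAt (fun z : E × E => Φ3 z.1) (A3.comp (ContinuousLinearMap.fst ℝ E E)) z0 :=
      HasFDerivAt.comp z0 (g := Φ3) hA3 hasFDerivAt_fst
    exact a.unique (b.congr_of_eventuallyEq (hev.mono fun z hz => hz.1))
  have D2 : A2.comp L2 = A2.comp L1 := by
    have a : HasFDerivAt (fun z => Φ2 (q2 z)) (A2.comp L2) z0 :=
      HasFDerivAt.comp z0 (by rw [hq2z]; exact hA2) d2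
    have b : HasFDerivAt (fun z => Φ2 (q1 z)) (A2.comp L1) z0 :=
      HasFDerivAt.comp z0 (by rw [hq1z]; exact hA2) d1
    exact a.unique (b.congr_of_eventuallyEq (hev.mono fun z hz => hz.2.1))
  have D1 : A1.comp L2 = A1.comp (ContinuousLinearMap.snd ℝ E E) := by
    have a : HasFDerivAt (fun z => Φ1 (q2 z)) (A1.comp L2) z0 :=
      HasFDerivAt.comp z0 (by rw [hq2z]; exact hA1) d2
    have b : HasFDerivAt (fun z : E × E => Φ1 z.2) (A1.comp (ContinuousLinearMap.snd ℝ E E)) z0 :=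
      HasFDerivAt.comp z0 (g := Φ1) hA1 hasFDerivAt_snd
    exact a.unique (b.congr_of_eventuallyEq (hev.mono fun z hz => hz.2.2))
  have D3' : ∀ d, A3 (L1 (d, d)) = A3 d := fun d => by
    simpa using congrArg (fun M : E × E →L[ℝ] ℝ × ℝ => M (d, d)) D3
  have D2' : ∀ d, A2 (L2 (d, d)) = A2 (L1 (d, d)) := fun d => by
    simpa using congrArg (fun M : E × E →L[ℝ] ℝ × ℝ => M (d, d)) D2
  have D1' : ∀ d, A1 (L2 (d, d)) = A1 d := fun d => by
    simpa using congrArg (fun M : E × E →L[ℝ] ℝ × ℝ => M (d, d)) D1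
  obtain ⟨U1, hU1, hn1⟩ := null_preimage_aux2 μ q1 z0 L1 hq1 d1 (by
    intro d hd
    have e3 := D3' d
    have e2 := D2' d
    have e1 := D1' d
    rw [hd, map_zero] at e3 e2
    obtain ⟨-, -, k⟩ := H (d - L2 (d, d)) (L2 (d, d)) (-d) (by rw [map_sub, e1, sub_self]) e2
      (by rw [map_neg, ← e3, neg_zero]) (by abel)
    simpa using k) _ hN1
  obtain ⟨U2, hU2, hn2⟩ := null_preimage_aux2 μ q2 z0 L2 hq2 d2 (by
    intro d hd
    have e3 := D3' d
    have e2 := D2' d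
    have e1 := D1' d
    rw [hd, map_zero] at e1 e2
    obtain ⟨k, -, -⟩ := H (-d) (L1 (d, d)) (d - L1 (d, d)) (by rw [map_neg, ← e1, neg_zero])
      e2.symm (by rw [map_sub, e3, sub_self]) (by abel)
    simpa using k) _ hN2
  let n : E × E → ℝ := fun z => c1 (q1 z) * c2 (q2 z)
  have hn : AnalyticAt ℝ n z0 :=
    (AnalyticAt.comp (g := c1) (by rw [hq1z]; exact hc1) hq1).mul
      (AnalyticAt.comp (g := c2) (by rw [hq2z]; exact hc2) hq2)
  have hΩ1 : ∀ᶠ z in 𝓝 z0, q1 z ∈ Ω := hq1.continuousAt.eventually (by rw [hq1z]; exact hΩ)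
  have hΩ2 : ∀ᶠ z in 𝓝 z0, q2 z ∈ Ω := hq2.continuousAt.eventually (by rw [hq2z]; exact hΩ)
  have hall : ∀ᶠ z in 𝓝 z0, (Φ3 (q1 z) = Φ3 z.1 ∧ Φ2 (q2 z) = Φ2 (q1 z) ∧ Φ1 (q2 z) = Φ1 z.2) ∧
      AnalyticAt ℝ n z ∧ q1 z ∈ Ω ∧ q2 z ∈ Ω ∧ z ∈ U1 ∧ z ∈ U2 := by
    filter_upwards [hev, hn.eventually_analyticAt, hΩ1, hΩ2, hU1, hU2] with z a b c d e f
    exact ⟨a, b, c, d, e, f⟩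
  obtain ⟨S, hS, S', hS', hSS⟩ := mem_nhds_prod_iff.1 hall
  obtain ⟨U, hUS, hUo, hU0⟩ := _root_.mem_nhds_iff.1 hS
  obtain ⟨U', hUS', hUo', hU0'⟩ := _root_.mem_nhds_iff.1 hS'
  have hae : ∀ᵐ z ∂(μ.prod μ), z.1 ∈ U → z.2 ∈ U' → F1 (Φ1 z.2) = F3 (Φ3 z.1) * n z := by
    have m1 := measure_eq_zero_iff_ae_notMem.1 hn1
    have m2 := measure_eq_zero_iff_ae_notMem.1 hn2
    filter_upwards [m1, m2] with z k1 k2 hz hz'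
    obtain ⟨⟨e3, e2, e1⟩, -, o1, o2, u1, u2⟩ := hSS (Set.mk_mem_prod (hUS hz) (hUS' hz'))
    have k1 : F2 (Φ2 (q1 z)) = F3 (Φ3 (q1 z)) * c1 (q1 z) := by
      by_contra hcon
      exact k1 ⟨u1, fun h => hcon (h o1)⟩
    have k2 : F1 (Φ1 (q2 z)) = F2 (Φ2 (q2 z)) * c2 (q2 z) := by
      by_contra hcon
      exact k2 ⟨u2, fun h => hcon (h o2)⟩
    rw [← e1, k2, e2, k1, e3, mul_assoc]
  have hae2 := Measure.ae_ae_of_ae_prod hae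
  obtain ⟨p, hpU, hp⟩ : ∃ p ∈ U, ∀ᵐ q ∂μ, p ∈ U → q ∈ U' → F1 (Φ1 q) = F3 (Φ3 p) * n (p, q) := by
    by_contra hcon
    have : μ U = 0 := measure_mono_null (fun p hp h => hcon ⟨p, hp, h⟩) hae2
    exact (hUo.measure_pos μ ⟨p0, hU0⟩).ne' this
  refine ⟨fun q => F3 (Φ3 p) * n (p, q), U', hUo', hU0', ?_, hp.mono fun q h => h hpU⟩
  intro q hq
  have := (hSS (Set.mk_mem_prod (hUS hpU) (hUS' hq))).2.1
  exact analyticAt_const.mul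
    (AnalyticAt.comp (g := n) (f := fun q => (p, q)) this (analyticAt_const.prod analyticAt_id))

lemma glue_aux {E : Type*} [NormedAddCommGroup E] [NormedSpace ℝ E]
    [FiniteDimensional ℝ E] [MeasurableSpace E] [BorelSpace E] (μ : Measure E) [μ.IsAddHaarMeasure]
    (Ω : Set E) (hΩ : IsOpen Ω) (y : E → ℝ)
    (h : ∀ p ∈ Ω, ∃ g : E → ℝ, ∃ U : Set E, IsOpen U ∧ p ∈ U ∧ AnalyticOnNhd ℝ g U ∧
      ∀ᵐ q ∂μ, q ∈ U → y q = g q) :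
    ∃ g : E → ℝ, AnalyticOnNhd ℝ g Ω ∧ ∀ᵐ q ∂(μ.restrict Ω), y q = g q := by
  classical
  have : SecondCountableTopology E := by
    have := FiniteDimensional.proper ℝ E
    infer_instance
  choose! g U hUo hpU hg hy using h
  have key : ∀ p ∈ Ω, ∀ q ∈ Ω, q ∈ U p → g q q = g p q := by
    intro p hp q hq hqU
    have hO : IsOpen (U p ∩ U q) := (hUo p hp).inter (hUo q hq)
    have hae : g q =ᵐ[μ.restrict (U p ∩ U q)] g p := by
      rw [Filter.EventuallyEq, ae_restrict_iff' hO.measurableSet]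
      filter_upwards [hy p hp, hy q hq] with x h1 h2 hx
      rw [← h1 hx.1, ← h2 hx.2]
    exact Measure.eqOn_open_of_ae_eq hae hO
      ((hg q hq).continuousOn.mono inter_subset_right)
      ((hg p hp).continuousOn.mono inter_subset_left) ⟨hqU, hpU q hq⟩
  refine ⟨fun q => g q q, ?_, ?_⟩
  · intro p hp
    refine (hg p hp p (hpU p hp)).congr ?_
    filter_upwards [hΩ.mem_nhds hp, (hUo p hp).mem_nhds (hpU p hp)] with q h1 h2
    exact (key p hp q h1 h2).symm
  · rw [ae_restrict_iff' hΩ.measurableSet]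
    refine measure_null_of_locally_null _ fun x hx => ?_
    have hx : x ∈ Ω := by
      by_contra hcon
      exact hx fun h => absurd h hcon
    refine ⟨_, inter_mem_nhdsWithin _ ((hUo x hx).mem_nhds (hpU x hx)), ?_⟩
    refine measure_mono_null ?_ (hy x hx)
    rintro q ⟨h1, h2⟩ h3
    exact h1 fun hq => (h3 h2).trans (key x hx q hq h2).symm

lemma Φmap_fderiv_aux (φ : Vec2 → ℝ) (x : Vec2) (s : ℝ) (h : AnalyticAt ℝ φ x) :
    AnalyticAt ℝ (Φmap φ) (x, s) ∧ ∀ v σ, fderiv ℝ (Φmap φ) (x, s) (v, σ) =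
      (fderiv ℝ φ x v, s * fderiv ℝ (Dder φ) x v + σ * Dder φ x) := by
  have hD : AnalyticAt ℝ (Dder φ) x :=
    ((ContinuousLinearMap.apply ℝ ℝ ((0, 1) : Vec2)).analyticAt _).comp h.fderiv
  have hf : AnalyticAt ℝ (fun p : Vec2 × ℝ => p.1) (x, s) := analyticAt_fst
  have a1 : AnalyticAt ℝ (fun p : Vec2 × ℝ => φ p.1) (x, s) :=
    AnalyticAt.comp (g := φ) (f := fun p : Vec2 × ℝ => p.1) h hf
  have a2 : AnalyticAt ℝ (fun p : Vec2 × ℝ => Dder φ p.1) (x, s) :=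
    AnalyticAt.comp (g := Dder φ) (f := fun p : Vec2 × ℝ => p.1) hD hf
  refine ⟨a1.prod (analyticAt_snd.mul a2), fun v σ => ?_⟩
  have hfd : HasFDerivAt (fun p : Vec2 × ℝ => p.1) (ContinuousLinearMap.fst ℝ Vec2 ℝ) (x, s) :=
    hasFDerivAt_fst
  have b1 : HasFDerivAt (fun p : Vec2 × ℝ => φ p.1) _ (x, s) :=
    HasFDerivAt.comp (x, s) (g := φ) h.differentiableAt.hasFDerivAt hfd
  have b2 : HasFDerivAt (fun p : Vec2 × ℝ => Dder φ p.1) _ (x, s) :=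
    HasFDerivAt.comp (x, s) (g := Dder φ) hD.differentiableAt.hasFDerivAt hfd
  have b : HasFDerivAt (Φmap φ) _ (x, s) := b1.prodMk (hasFDerivAt_snd.mul b2)
  rw [b.fderiv]
  simp [mul_comm]

lemma clm_vec2_aux (L : Vec2 →L[ℝ] ℝ) (v : Vec2) : L v = v.1 * L (1, 0) + v.2 * L (0, 1) := by
  have : v = v.1 • ((1, 0) : Vec2) + v.2 • ((0, 1) : Vec2) := by ext <;> simp
  conv_lhs => rw [this]
  simp only [map_add, map_smul, smul_eq_mul]

lemma det_ne_zero_aux (α β : Vec2 →L[ℝ] ℝ) (h : LinearIndependent ℝ ![α, β]) :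
    α (1, 0) * β (0, 1) - α (0, 1) * β (1, 0) ≠ 0 := by
  intro hdet
  rw [LinearIndependent.pair_iff] at h
  have e2 := h (β (0, 1)) (-α (0, 1)) (by
    refine ContinuousLinearMap.ext fun v => ?_
    simp only [add_apply, smul_apply, smul_eq_mul,
      zero_apply]
    rw [clm_vec2_aux α v, clm_vec2_aux β v]
    linear_combination v.1 * hdet)
  have e1 := h (β (1, 0)) (-α (1, 0)) (by
    refine ContinuousLinearMap.ext fun v => ?_
    simp only [add_apply, smul_apply, smul_eq_mul,
      zero_apply]
    rw [clm_vec2_aux α v, clm_vec2_aux β v]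
    linear_combination (- v.2) * hdet)
  have e3 := h 1 0 (by
    refine ContinuousLinearMap.ext fun v => ?_
    simp only [add_apply, smul_apply, smul_eq_mul,
      zero_apply]
    rw [clm_vec2_aux α v, neg_eq_zero.1 e1.2, neg_eq_zero.1 e2.2]
    ring)
  exact one_ne_zero e3.1

lemma kernel_aux (φ : Vec2 → ℝ) (x : Vec2) (s : ℝ) (h : AnalyticAt ℝ φ x) (hD : Dder φ x ≠ 0)
    (u W : Vec2 × ℝ) (hu : fderiv ℝ (Φmap φ) (x, s) u = 0) (hW : fderiv ℝ (Φmap φ) (x, s) W = 0)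
    (hW0 : W ≠ 0) : ∃ c : ℝ, u = c • W := by
  obtain ⟨v, σ⟩ := u
  obtain ⟨w, ω⟩ := W
  obtain ⟨v1, v2⟩ := v
  obtain ⟨w1, w2⟩ := w
  have F := (Φmap_fderiv_aux φ x s h).2
  rw [F, Prod.mk_eq_zero, clm_vec2_aux (fderiv ℝ φ x), clm_vec2_aux (fderiv ℝ (Dder φ) x)] at hu hW
  change _ * _ + _ * Dder φ x = 0 ∧ _ at hu
  change _ * _ + _ * Dder φ x = 0 ∧ _ at hW
  set α := fderiv ℝ φ x (1, 0)
  set β := Dder φ x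
  set γ := fderiv ℝ (Dder φ) x (1, 0)
  set δ := fderiv ℝ (Dder φ) x (0, 1)
  simp only at hu hW
  have hw1 : w1 ≠ 0 := by
    rintro rfl
    have h2 : w2 = 0 := by
      have := hW.1
      simpa [hD] using this
    subst h2
    have := hW.2
    have h3 : ω = 0 := by simpa [hD] using this
    subst h3
    exact hW0 rfl
  have e2 : v2 * w1 = v1 * w2 := by
    apply mul_right_cancel₀ hD
    linear_combination w1 * hu.1 - v1 * hW.1
  have e3 : σ * w1 = v1 * ω := by
    apply mul_right_cancel₀ hD
    linear_combination w1 * hu.2 - v1 * hW.2 - s * δ * e2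
  refine ⟨v1 / w1, ?_⟩
  simp only [Prod.smul_mk, smul_eq_mul, Prod.mk.injEq]
  refine ⟨⟨?_, ?_⟩, ?_⟩
  · field_simp
  · field_simp; linarith
  · field_simp; linarith

/-- measurable solutions of the functional equation agree a.e.
with real analytic functions, away from `{s = 0}`. -/
theorem stmt10
    -- `B` is a nonempty open ball of finite radius, `Bt` a connected open neighborhood of its closure
    (c₀ : Vec2) (r₀ : ℝ) (hr₀ : 0 < r₀)
    (B Bt : Set Vec2) (hB : B = Metric.ball c₀ r₀)
    (hBt_open : IsOpen Bt) (hBt_conn : IsConnected Bt) (hBBt : closure B ⊆ Bt)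
    -- the φⱼ are real analytic submersions on `Bt`
    (φ : Fin 4 → Vec2 → ℝ)
    (hφ_an : ∀ j, AnalyticOnNhd ℝ (φ j) Bt)
    (hφ_sub : ∀ j, ∀ x ∈ Bt, fderiv ℝ (φ j) x ≠ 0)
    -- transversality hypothesis
    (htrans : ∀ x ∈ B, ∀ j k : Fin 4, j ≠ k →
      LinearIndependent ℝ ![fderiv ℝ (φ j) x, fderiv ℝ (φ k) x])
    -- Vⱼ : nowhere vanishing real analytic vector fields with Vⱼ φⱼ ≡ 0
    (V : Fin 4 → Vec2 → Vec2)
    (hV_an : ∀ j, AnalyticOnNhd ℝ (V j) Bt)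
    (hV_ne : ∀ j, ∀ x ∈ Bt, V j x ≠ 0)
    (hV_ker : ∀ j, ∀ x ∈ Bt, fderiv ℝ (φ j) x (V j x) = 0)
    -- auxiliary hypothesis 2
    (W : Fin 4 → Fin 4 → (Vec2 × ℝ) → (Vec2 × ℝ))
    (hW_an : ∀ j k, AnalyticOnNhd ℝ (W j k) (Bt ×ˢ (univ : Set ℝ)))
    (hW_ne : ∀ j k, ∀ p ∈ Bt ×ˢ (univ : Set ℝ), W j k p ≠ 0)
    (hW_ker : ∀ j k, ∀ p ∈ Bt ×ˢ (univ : Set ℝ),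
      fderiv ℝ (fun q : Vec2 × ℝ => ((φ j q.1, q.2 * fderiv ℝ (φ j) q.1 (V k q.1)) : Vec2))
        p (W j k p) = 0)
    (haux2 : ∀ k : Fin 4, ∀ p : Vec2 × ℝ, p.1 ∈ Bt → p.2 ≠ 0 →
      LinearIndependent ℝ (fun j : {j : Fin 4 // j ≠ k} => W j.1 k p))
    -- coordinates are chosen so that φ₄(x₁,x₂) = x₁ on B
    (hφ4 : ∀ x ∈ B, φ 3 x = x.1)
    (Ω : Set (Vec2 × ℝ)) (hΩ_open : IsOpen Ω)
    (hΩ_sub : Ω ⊆ {p : Vec2 × ℝ | p.1 ∈ B ∧ p.2 ≠ 0})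
    (f : Fin 3 → Vec2 → ℝ) (hf_meas : ∀ j, Measurable (f j))
    (hsol : ∀ᵐ p ∂(volume.restrict Ω),
      ∑ j : Fin 3, f j (Φmap (φ j.castSucc) p) • fderiv ℝ (φ j.castSucc) p.1 = 0) :
    ∀ j : Fin 3, ∃ g : Vec2 × ℝ → ℝ, AnalyticOnNhd ℝ g Ω ∧
      ∀ᵐ p ∂(volume.restrict Ω), f j (Φmap (φ j.castSucc) p) = g p := by
  classical
  have hBo : IsOpen B := by rw [hB]; exact Metric.isOpen_ball
  have hBsub : B ⊆ Bt := subset_closure.trans hBBt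
  -- on `B` the differential of `φ 3` is the first projection
  have hd3 : ∀ x ∈ B, fderiv ℝ (φ 3) x = ContinuousLinearMap.fst ℝ ℝ ℝ := by
    intro x hx
    have : φ 3 =ᶠ[𝓝 x] fun y => y.1 := by
      filter_upwards [hBo.mem_nhds hx] with y hy using hφ4 y hy
    rw [this.fderiv_eq]
    exact hasFDerivAt_fst.fderiv
  have hDne : ∀ x ∈ B, ∀ j : Fin 3, Dder (φ j.castSucc) x ≠ 0 := by
    intro x hx j
    have h := det_ne_zero_aux _ _ (htrans x hx j.castSucc 3 (Fin.castSucc_lt_last j).ne)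
    rw [hd3 x hx] at h
    simpa [Dder] using h
  have hV1 : ∀ x ∈ B, V 3 x = (V 3 x).2 • ((0, 1) : Vec2) := by
    intro x hx
    have h := hV_ker 3 x (hBsub hx)
    rw [hd3 x hx] at h
    have hfst : (V 3 x).1 = 0 := h
    ext <;> simp [hfst]
  -- linear independence of the kernels
  have Hgen : ∀ p ∈ Ω, ∀ τ : Fin 3 → Fin 3, Function.Injective τ → ∀ u : Fin 3 → Vec2 × ℝ,
      (∀ t, fderiv ℝ (Φmap (φ (τ t).castSucc)) p (u t) = 0) → ∑ t, u t = 0 → ∀ t, u t = 0 := by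
    rintro ⟨x, s⟩ hp τ hτ u hu hsum
    obtain ⟨hx, hs⟩ := hΩ_sub hp
    simp only at hx hs
    set w : Vec2 → ℝ := fun y => (V 3 y).2 with hw
    have hwx : w x ≠ 0 := by
      intro h0
      apply hV_ne 3 x (hBsub hx)
      rw [hV1 x hx]
      change w x • _ = 0
      rw [h0, zero_smul]
    have hwan : AnalyticAt ℝ w x := analyticAt_snd.comp (hV_an 3 x (hBsub hx))
    set s' := s / w x with hs'
    have hs'0 : s' ≠ 0 := div_ne_zero hs hwx
    let m : Vec2 × ℝ → Vec2 × ℝ := fun q => (q.1, q.2 * w q.1)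
    have hmx : m (x, s') = (x, s) := by
      simp only [m, hs']
      rw [div_mul_cancel₀ _ hwx]
    obtain ⟨M, hM, hMinj⟩ : ∃ M : Vec2 × ℝ →L[ℝ] Vec2 × ℝ, HasFDerivAt m M (x, s') ∧
        ∀ v, M v = 0 → v = 0 := by
      have hfd : HasFDerivAt (fun p : Vec2 × ℝ => p.1) (ContinuousLinearMap.fst ℝ Vec2 ℝ) (x, s') :=
        hasFDerivAt_fst
      have b2 : HasFDerivAt (fun p : Vec2 × ℝ => w p.1) _ (x, s') :=
        HasFDerivAt.comp (x, s') (g := w) hwan.differentiableAt.hasFDerivAt hfd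
      refine ⟨_, hfd.prodMk (hasFDerivAt_snd.mul b2), ?_⟩
      rintro ⟨v, σ⟩ hv
      rw [ContinuousLinearMap.prod_apply, Prod.mk_eq_zero] at hv
      obtain ⟨h1, h2⟩ := hv
      change v = 0 at h1
      subst h1
      have : σ = 0 := by simpa [hwx] using h2
      rw [this]; rfl
    have hMW : ∀ j : Fin 3, fderiv ℝ (Φmap (φ j.castSucc)) (x, s) (M (W j.castSucc 3 (x, s'))) = 0 := by
      intro j
      have hk := hW_ker j.castSucc 3 (x, s') ⟨hBsub hx, mem_univ _⟩
      have heq : (fun q : Vec2 × ℝ => ((φ j.castSucc q.1,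
          q.2 * fderiv ℝ (φ j.castSucc) q.1 (V 3 q.1)) : Vec2)) =ᶠ[𝓝 (x, s')]
          fun q => Φmap (φ j.castSucc) (m q) := by
        have : ∀ᶠ q : Vec2 × ℝ in 𝓝 (x, s'), q.1 ∈ B :=
          continuous_fst.continuousAt.eventually (hBo.mem_nhds hx)
        filter_upwards [this] with q hq
        rw [hV1 q.1 hq, map_smul]
        simp only [Φmap, m, hw, Dder, smul_eq_mul, mul_assoc]
      have hc : HasFDerivAt (fun q => Φmap (φ j.castSucc) (m q))
          ((fderiv ℝ (Φmap (φ j.castSucc)) (x, s)).comp M) (x, s') := by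
        have hΦd : HasFDerivAt (Φmap (φ j.castSucc))
            (fderiv ℝ (Φmap (φ j.castSucc)) (x, s)) (m (x, s')) := by
          rw [hmx]
          exact (Φmap_fderiv_aux _ x s (hφ_an _ x (hBsub hx))).1.differentiableAt.hasFDerivAt
        exact HasFDerivAt.comp (x, s') hΦd hM
      rw [heq.fderiv_eq, hc.fderiv] at hk
      exact hk
    have hker : ∀ t, ∃ c : ℝ, u t = c • M (W (τ t).castSucc 3 (x, s')) := fun t =>
      kernel_aux _ x s (hφ_an _ x (hBsub hx)) (hDne x hx _) _ _ (hu t) (hMW _)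
        (fun h => hW_ne _ 3 (x, s') ⟨hBsub hx, mem_univ _⟩ (hMinj _ h))
    choose c hc using hker
    have hli : LinearIndependent ℝ (fun t : Fin 3 => W (τ t).castSucc 3 (x, s')) :=
      (haux2 3 (x, s') (hBsub hx) hs'0).comp
        (fun t : Fin 3 => (⟨(τ t).castSucc, (Fin.castSucc_lt_last _).ne⟩ : {j : Fin 4 // j ≠ 3}))
        (fun a b hab => hτ (Fin.castSucc_injective _ (congrArg Subtype.val hab)))
    have hz : ∑ t, c t • W (τ t).castSucc 3 (x, s') = 0 := by
      apply hMinj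
      rw [map_sum, ← hsum]
      exact Finset.sum_congr rfl fun t _ => by rw [map_smul, hc t]
    intro t
    rw [hc t, Fintype.linearIndependent_iff.1 hli c hz t, zero_smul]
  -- the cross products
  let a : Fin 3 → Vec2 × ℝ → ℝ := fun i q =>
    fderiv ℝ (φ (i + 1).castSucc) q.1 (1, 0) * fderiv ℝ (φ (i + 2).castSucc) q.1 (0, 1) -
    fderiv ℝ (φ (i + 1).castSucc) q.1 (0, 1) * fderiv ℝ (φ (i + 2).castSucc) q.1 (1, 0)
  have ha_ne : ∀ i, ∀ q ∈ Ω, a i q ≠ 0 := by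
    intro i q hq
    apply det_ne_zero_aux
    apply htrans _ (hΩ_sub hq).1
    intro h
    have := Fin.castSucc_injective _ h
    revert this
    fin_cases i <;> decide
  have ha_an : ∀ i, ∀ q ∈ Ω, AnalyticAt ℝ (a i) q := by
    intro i q hq
    have hqB := hBsub (hΩ_sub hq).1
    have key : ∀ (j : Fin 4) (e : Vec2),
        AnalyticAt ℝ (fun q : Vec2 × ℝ => fderiv ℝ (φ j) q.1 e) q := by
      intro j e
      have h1 : AnalyticAt ℝ (fun y => fderiv ℝ (φ j) y e) q.1 :=
        ((ContinuousLinearMap.apply ℝ ℝ e).analyticAt _).comp (hφ_an j _ hqB).fderiv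
      exact AnalyticAt.comp (g := fun y => fderiv ℝ (φ j) y e) (f := fun p : Vec2 × ℝ => p.1)
        h1 analyticAt_fst
    exact ((key _ _).mul (key _ _)).sub ((key _ _).mul (key _ _))
  have hrel : ∀ i k : Fin 3, ∀ᵐ q ∂(volume : Measure (Vec2 × ℝ)), q ∈ Ω →
      f i (Φmap (φ i.castSucc) q) = f k (Φmap (φ k.castSucc) q) * (a i q / a k q) := by
    intro i k
    rw [ae_restrict_iff' hΩ_open.measurableSet] at hsol
    filter_upwards [hsol] with q h hq
    have h := h hq
    have hne := ha_ne k q hq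
    rw [mul_div_assoc', eq_div_iff hne]
    have h1 := congrArg (fun L : Vec2 →L[ℝ] ℝ => L (1, 0)) h
    have h2 := congrArg (fun L : Vec2 →L[ℝ] ℝ => L (0, 1)) h
    simp only [Fin.sum_univ_three, add_apply, smul_apply,
      smul_eq_mul, zero_apply] at h1 h2
    have cross : ∀ l : Fin 3,
        f (l + 1) (Φmap (φ (l + 1).castSucc) q) * a (l + 2) q =
        f (l + 2) (Φmap (φ (l + 2).castSucc) q) * a (l + 1) q := by
      intro l
      have e1 := h1
      have e2 := h2
      fin_cases l
      · change f 1 (Φmap (φ (1 : Fin 3).castSucc) q) * a 2 q =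
          f 2 (Φmap (φ (2 : Fin 3).castSucc) q) * a 1 q
        change _ * (fderiv ℝ (φ (0 : Fin 3).castSucc) q.1 (1, 0) *
            fderiv ℝ (φ (1 : Fin 3).castSucc) q.1 (0, 1) -
          fderiv ℝ (φ (0 : Fin 3).castSucc) q.1 (0, 1) *
            fderiv ℝ (φ (1 : Fin 3).castSucc) q.1 (1, 0)) =
          _ * (fderiv ℝ (φ (2 : Fin 3).castSucc) q.1 (1, 0) *
            fderiv ℝ (φ (0 : Fin 3).castSucc) q.1 (0, 1) -
          fderiv ℝ (φ (2 : Fin 3).castSucc) q.1 (0, 1) *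
            fderiv ℝ (φ (0 : Fin 3).castSucc) q.1 (1, 0))
        linear_combination fderiv ℝ (φ (0 : Fin 3).castSucc) q.1 (1, 0) * e2 -
          fderiv ℝ (φ (0 : Fin 3).castSucc) q.1 (0, 1) * e1
      · change f 2 (Φmap (φ (2 : Fin 3).castSucc) q) * a 0 q =
          f 0 (Φmap (φ (0 : Fin 3).castSucc) q) * a 2 q
        change _ * (fderiv ℝ (φ (1 : Fin 3).castSucc) q.1 (1, 0) *
            fderiv ℝ (φ (2 : Fin 3).castSucc) q.1 (0, 1) -
          fderiv ℝ (φ (1 : Fin 3).castSucc) q.1 (0, 1) *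
            fderiv ℝ (φ (2 : Fin 3).castSucc) q.1 (1, 0)) =
          _ * (fderiv ℝ (φ (0 : Fin 3).castSucc) q.1 (1, 0) *
            fderiv ℝ (φ (1 : Fin 3).castSucc) q.1 (0, 1) -
          fderiv ℝ (φ (0 : Fin 3).castSucc) q.1 (0, 1) *
            fderiv ℝ (φ (1 : Fin 3).castSucc) q.1 (1, 0))
        linear_combination fderiv ℝ (φ (1 : Fin 3).castSucc) q.1 (1, 0) * e2 -
          fderiv ℝ (φ (1 : Fin 3).castSucc) q.1 (0, 1) * e1
      · change f 0 (Φmap (φ (0 : Fin 3).castSucc) q) * a 1 q =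
          f 1 (Φmap (φ (1 : Fin 3).castSucc) q) * a 0 q
        change _ * (fderiv ℝ (φ (2 : Fin 3).castSucc) q.1 (1, 0) *
            fderiv ℝ (φ (0 : Fin 3).castSucc) q.1 (0, 1) -
          fderiv ℝ (φ (2 : Fin 3).castSucc) q.1 (0, 1) *
            fderiv ℝ (φ (0 : Fin 3).castSucc) q.1 (1, 0)) =
          _ * (fderiv ℝ (φ (1 : Fin 3).castSucc) q.1 (1, 0) *
            fderiv ℝ (φ (2 : Fin 3).castSucc) q.1 (0, 1) -
          fderiv ℝ (φ (1 : Fin 3).castSucc) q.1 (0, 1) *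
            fderiv ℝ (φ (2 : Fin 3).castSucc) q.1 (1, 0))
        linear_combination fderiv ℝ (φ (2 : Fin 3).castSucc) q.1 (1, 0) * e2 -
          fderiv ℝ (φ (2 : Fin 3).castSucc) q.1 (0, 1) * e1
    have c0 := cross 0
    have c1 := cross 1
    have c2 := cross 2
    fin_cases i <;> fin_cases k
    · rfl
    · exact c2
    · exact c1.symm
    · exact c2.symm
    · rfl
    · exact c0
    · exact c1
    · exact c0.symm
    · rfl
  have : Measure.IsAddHaarMeasure (volume : Measure (Vec2 × ℝ)) :=
    inferInstanceAs (Measure.IsAddHaarMeasure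
      ((volume : Measure Vec2).prod (volume : Measure ℝ)))
  intro j
  refine glue_aux volume Ω hΩ_open (fun q => f j (Φmap (φ j.castSucc) q)) fun p hp => ?_
  have hpB := hBsub (hΩ_sub hp).1
  have hΦ : ∀ i : Fin 3, AnalyticAt ℝ (Φmap (φ i.castSucc)) p := fun i =>
    (Φmap_fderiv_aux (φ i.castSucc) p.1 p.2 (hφ_an _ _ hpB)).1
  refine local_main_aux volume (by simp) (Φmap (φ j.castSucc)) (Φmap (φ (j + 1).castSucc))
    (Φmap (φ (j + 2).castSucc)) p _ _ _ (hΦ _) (hΦ _) (hΦ _)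
    (hΦ _).differentiableAt.hasFDerivAt (hΦ _).differentiableAt.hasFDerivAt
    (hΦ _).differentiableAt.hasFDerivAt ?_
    (fun q => a (j + 1) q / a (j + 2) q) (fun q => a j q / a (j + 1) q)
    ((ha_an _ p hp).div (ha_an _ p hp) (ha_ne _ p hp))
    ((ha_an _ p hp).div (ha_an _ p hp) (ha_ne _ p hp))
    (f j) (f (j + 1)) (f (j + 2)) Ω (hΩ_open.mem_nhds hp) (hrel _ _) (hrel _ _)
  intro u1 u2 u3 k1 k2 k3 hs
  have := Hgen p hp ![j, j + 1, j + 2] (by fin_cases j <;> decide) ![u1, u2, u3] (by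
    intro t
    fin_cases t
    · exact k1
    · exact k2
    · exact k3) (by rw [Fin.sum_univ_three]; exact hs)
  exact ⟨this 0, this 1, this 2⟩
end
end

section
/- Assume the transversality hypothesis and auxiliary hypothesis 2. Let Ω be a connected open subset of {(x,s) ∈ B×ℝ : s ≠ 0}. If f = (f₁,f₂,f₃) and g = (g₁,g₂,g₃) are triples of Lebesgue measurable functions, each satisfying Σ_{j=1}^3 f_j(Φ_j(x,s))·∇φ_j(x) = 0 (respectively with g in place of f) almost everywhere on Ω, and if the triple (g_j∘Φ_j)_{j=1,2,3} does not vanish almost everywhere on Ω, then there exists a constant c ∈ ℝ such that f_j(Φ_j(x,s)) = c·g_j(Φ_j(x,s)) for almost every (x,s) ∈ Ω, for each j ∈ {1,2,3}. -/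
open MeasureTheory Real Set Filter Metric
open scoped FourierTransform ENNReal NNReal Topology ComplexConjugate

noncomputable section

/-- germs at `x` up to null sets -/
def Lfil {X : Type*} [TopologicalSpace X] [MeasureSpace X] (x : X) : Filter X :=
  𝓝 x ⊓ ae (volume : Measure X)

lemma exists_local_inverse {X : Type*} [NormedAddCommGroup X] [NormedSpace ℝ X]
    [FiniteDimensional ℝ X] {G : X → X} {G' : X →L[ℝ] X} {x₀ : X}
    (hG : ContDiffAt ℝ 1 G x₀) (hG' : HasFDerivAt G G' x₀) (hinj : Function.Injective G') :
    ∃ (K : X → X) (e : X ≃L[ℝ] X), (e : X →L[ℝ] X) = G' ∧ ContDiffAt ℝ 1 K (G x₀) ∧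
      HasFDerivAt K (e.symm : X →L[ℝ] X) (G x₀) ∧ K (G x₀) = x₀ ∧
      (∀ᶠ x in 𝓝 x₀, K (G x) = x) ∧ (∀ᶠ y in 𝓝 (G x₀), G (K y) = y) := by
  let e : X ≃L[ℝ] X :=
    (LinearEquiv.ofInjectiveEndo (G' : X →ₗ[ℝ] X) hinj).toContinuousLinearEquiv
  have he : (e : X →L[ℝ] X) = G' := by ext x; rfl
  have hG2 : HasFDerivAt G (e : X →L[ℝ] X) x₀ := by rw [he]; exact hG'
  have hs : HasStrictFDerivAt G (e : X →L[ℝ] X) x₀ := hG.hasStrictFDerivAt' hG2 one_ne_zero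
  exact ⟨hs.localInverse G e x₀, e, he, hG.to_localInverse hG2 one_ne_zero,
    hs.to_localInverse.hasFDerivAt, hs.localInverse_apply_image, hs.eventually_left_inverse,
    hs.eventually_right_inverse⟩

lemma tendsto_Lfil {X : Type*} [NormedAddCommGroup X] [NormedSpace ℝ X]
    [FiniteDimensional ℝ X] [MeasureSpace X] [BorelSpace X]
    [(volume : Measure X).IsAddHaarMeasure] {G : X → X} {G' : X →L[ℝ] X} {x₀ y₀ : X}
    (hG : ContDiffAt ℝ 1 G x₀) (hG' : HasFDerivAt G G' x₀) (hinj : Function.Injective G')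
    (hy : G x₀ = y₀) :
    Tendsto G (Lfil x₀) (Lfil y₀) := by
  subst hy
  obtain ⟨K, e, he, hK, -, hKx, hl, hr⟩ := exists_local_inverse hG hG' hinj
  refine tendsto_inf.2 ⟨hG.continuousAt.tendsto.mono_left inf_le_left, ?_⟩
  have hKd : ∀ᶠ y in 𝓝 (G x₀), DifferentiableAt ℝ K y := by
    have := hK.eventually (by simp)
    exact this.mono fun y hy => hy.differentiableAt one_ne_zero
  have hGd := hG.continuousAt.eventually hKd
  intro s hs
  have hs0 : volume sᶜ = 0 := hs
  have hnull : volume (K '' (sᶜ ∩ {y | DifferentiableAt ℝ K y})) = 0 :=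
    addHaar_image_eq_zero_of_differentiableOn_of_addHaar_eq_zero _
      (fun y hy => hy.2.differentiableWithinAt) (measure_mono_null inter_subset_left hs0)
  have h1 : ∀ᶠ x in Lfil x₀, x ∉ K '' (sᶜ ∩ {y | DifferentiableAt ℝ K y}) :=
    Filter.Eventually.filter_mono inf_le_right (measure_eq_zero_iff_ae_notMem.1 hnull)
  have h2 : ∀ᶠ x in Lfil x₀, K (G x) = x := Filter.Eventually.filter_mono inf_le_left hl
  have h3 : ∀ᶠ x in Lfil x₀, DifferentiableAt ℝ K (G x) :=
    Filter.Eventually.filter_mono inf_le_left hGd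
  show ∀ᶠ x in Lfil x₀, G x ∈ s
  filter_upwards [h1, h2, h3] with x hx1 hx2 hx3
  by_contra hx
  exact hx1 ⟨G x, ⟨hx, hx3⟩, hx2⟩

instance haarE : (volume : Measure (Vec2 × ℝ)).IsAddHaarMeasure :=
  Measure.prod.instIsAddHaarMeasure (volume : Measure Vec2) (volume : Measure ℝ)

instance haarEE : (volume : Measure ((Vec2 × ℝ) × (Vec2 × ℝ))).IsAddHaarMeasure :=
  Measure.prod.instIsAddHaarMeasure (volume : Measure (Vec2 × ℝ)) (volume : Measure (Vec2 × ℝ))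

lemma tendsto_fst_Lfil (p q : Vec2 × ℝ) :
    Tendsto Prod.fst (Lfil (p, q)) (Lfil p) := by
  refine tendsto_inf.2 ⟨continuous_fst.continuousAt.tendsto.mono_left inf_le_left, ?_⟩
  exact (Measure.quasiMeasurePreserving_fst (μ := (volume : Measure (Vec2 × ℝ)))
    (ν := (volume : Measure (Vec2 × ℝ)))).tendsto_ae.mono_left inf_le_right

lemma step_aux {Φ : Vec2 × ℝ → Vec2} {Φ' : Vec2 × ℝ →L[ℝ] Vec2} {p₀ : Vec2 × ℝ}
    (hΦ : ContDiffAt ℝ 1 Φ p₀) (hΦ' : HasFDerivAt Φ Φ' p₀) (hsurj : Function.Surjective Φ')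
    {w : Vec2 × ℝ} (hw : Φ' w = 0) {ℓ : Vec2 × ℝ →L[ℝ] ℝ} (hℓ : ℓ w = 1) :
    ∃ ψ : (Vec2 × ℝ) × (Vec2 × ℝ) → Vec2 × ℝ, ContDiffAt ℝ 1 ψ (p₀, 0) ∧
      HasFDerivAt ψ (ContinuousLinearMap.fst ℝ _ _ +
        (ℓ.smulRight w).comp (ContinuousLinearMap.snd ℝ _ _)) (p₀, 0) ∧
      ψ (p₀, 0) = p₀ ∧ ∀ᶠ z in 𝓝 (p₀, (0 : Vec2 × ℝ)), Φ (ψ z) = Φ z.1 := by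
  let A : Vec2 × ℝ → Vec2 × ℝ := fun p => (Φ p, ℓ p)
  let A' : Vec2 × ℝ →L[ℝ] Vec2 × ℝ := Φ'.prod ℓ
  have hA : ContDiffAt ℝ 1 A p₀ := hΦ.prodMk ℓ.contDiff.contDiffAt
  have hA' : HasFDerivAt A A' p₀ := hΦ'.prodMk ℓ.hasFDerivAt
  have hAs : Function.Surjective A' := by
    rintro ⟨a, b⟩
    obtain ⟨u, hu⟩ := hsurj a
    refine ⟨u + (b - ℓ u) • w, ?_⟩
    simp [A', hu, hw, hℓ]
  have hAi : Function.Injective A' :=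
    (LinearMap.injective_iff_surjective (f := (A' : Vec2 × ℝ →ₗ[ℝ] Vec2 × ℝ))).2 hAs
  obtain ⟨K, e, he, hK, hK', hKx, hl, hr⟩ := exists_local_inverse hA hA' hAi
  let j : ℝ →L[ℝ] Vec2 × ℝ := ContinuousLinearMap.inr ℝ Vec2 ℝ
  let M : (Vec2 × ℝ) × (Vec2 × ℝ) → Vec2 × ℝ := fun z => A z.1 + j (ℓ z.2)
  have hM0 : M (p₀, 0) = A p₀ := by simp [M]
  have hM : ContDiffAt ℝ 1 M (p₀, 0) := by
    refine ContDiffAt.add ?_ ?_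
    · exact ContDiffAt.comp (p₀, (0 : Vec2 × ℝ)) (g := A) (f := Prod.fst) hA contDiffAt_fst
    · exact ((j.comp ℓ).contDiff.comp contDiff_snd).contDiffAt
  have hM' : HasFDerivAt M (A'.comp (ContinuousLinearMap.fst ℝ _ _) +
      (j.comp ℓ).comp (ContinuousLinearMap.snd ℝ _ _)) (p₀, 0) := by
    refine HasFDerivAt.add ?_ ?_
    · exact HasFDerivAt.comp (p₀, (0 : Vec2 × ℝ)) (g := A) (f := Prod.fst) hA' hasFDerivAt_fst
    · exact ((j.comp ℓ).comp (ContinuousLinearMap.snd ℝ (Vec2 × ℝ) (Vec2 × ℝ))).hasFDerivAt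
  refine ⟨fun z => K (M z), ?_, ?_, ?_, ?_⟩
  · exact ContDiffAt.comp (p₀, (0 : Vec2 × ℝ)) (g := K) (f := M) (by rw [hM0]; exact hK) hM
  · have h := HasFDerivAt.comp (p₀, (0 : Vec2 × ℝ)) (g := K) (f := M)
      (by rw [hM0]; exact hK') hM'
    refine h.congr_fderiv ?_
    refine ContinuousLinearMap.ext fun z => ?_
    apply e.injective
    have hee : ∀ y, e y = A' y := fun y => by rw [← he]; rfl
    simp only [ContinuousLinearMap.comp_apply, ContinuousLinearEquiv.coe_coe,
      ContinuousLinearEquiv.apply_symm_apply]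
    rw [hee]
    simp [A', j, hw, hℓ]
  · show K (M (p₀, 0)) = p₀
    rw [hM0, hKx]
  · have ht : Tendsto M (𝓝 (p₀, 0)) (𝓝 (A p₀)) := by
      rw [← hM0]; exact hM.continuousAt
    filter_upwards [ht.eventually hr] with z hz
    have := congrArg Prod.fst hz
    simpa [A, M, j] using this

lemma Lfil_neBot (p₀ : Vec2 × ℝ) : (Lfil p₀).NeBot := by
  refine inf_neBot_iff.2 fun {s} hs {t} ht => ?_
  by_contra hcon
  rw [Set.not_nonempty_iff_eq_empty, ← disjoint_iff_inter_eq_empty] at hcon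
  have h0 : volume s = 0 := measure_mono_null hcon.subset_compl_right ht
  exact (Measure.measure_pos_of_mem_nhds volume hs).ne' h0

/-- the shear map derivative -/
def shear (T : Vec2 × ℝ →L[ℝ] Vec2 × ℝ) :
    (Vec2 × ℝ) × (Vec2 × ℝ) →L[ℝ] (Vec2 × ℝ) × (Vec2 × ℝ) :=
  (ContinuousLinearMap.fst ℝ _ _ + T.comp (ContinuousLinearMap.snd ℝ _ _)).prod
    (ContinuousLinearMap.snd ℝ _ _)

lemma step_lemma {Φ : Vec2 × ℝ → Vec2} {Φ' : Vec2 × ℝ →L[ℝ] Vec2} {p₀ : Vec2 × ℝ}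
    (hΦ : ContDiffAt ℝ 1 Φ p₀) (hΦ' : HasFDerivAt Φ Φ' p₀) (hsurj : Function.Surjective Φ')
    {w : Vec2 × ℝ} (hw : Φ' w = 0) {ℓ : Vec2 × ℝ →L[ℝ] ℝ} (hℓ : ℓ w = 1)
    {H : Vec2 × ℝ → ℝ} {h : Vec2 → ℝ} (hH : ∀ᶠ p in Lfil p₀, H p = h (Φ p)) :
    ∃ Ψ : (Vec2 × ℝ) × (Vec2 × ℝ) → (Vec2 × ℝ) × (Vec2 × ℝ), ContDiffAt ℝ 1 Ψ (p₀, 0) ∧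
      HasFDerivAt Ψ (shear (ℓ.smulRight w)) (p₀, 0) ∧
      Ψ (p₀, 0) = (p₀, 0) ∧ Tendsto Ψ (Lfil (p₀, 0)) (Lfil (p₀, 0)) ∧
      ∀ᶠ z in Lfil (p₀, (0 : Vec2 × ℝ)), H (Ψ z).1 = H z.1 := by
  obtain ⟨ψ, h1, h2, h3, h4⟩ := step_aux hΦ hΦ' hsurj hw hℓ
  have d1 : ContDiffAt ℝ 1 (fun z => (ψ z, z.2)) (p₀, (0 : Vec2 × ℝ)) :=
    h1.prodMk contDiffAt_snd
  have d2 : HasFDerivAt (fun z => (ψ z, z.2)) (shear (ℓ.smulRight w)) (p₀, (0 : Vec2 × ℝ)) :=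
    h2.prodMk hasFDerivAt_snd
  have inj : Function.Injective (shear (ℓ.smulRight w)) := by
    rw [injective_iff_map_eq_zero]
    rintro ⟨a, b⟩ hab
    simp only [shear, ContinuousLinearMap.prod_apply, Prod.mk_eq_zero] at hab
    obtain ⟨hab1, hab2⟩ := hab
    have hb : b = 0 := hab2
    subst hb
    simpa using hab1
  have ht := tendsto_Lfil d1 d2 inj (y₀ := (p₀, 0)) (by simp [h3])
  refine ⟨_, d1, d2, by simp [h3], ht, ?_⟩
  have a1 := (tendsto_fst_Lfil p₀ 0).eventually hH
  have a2 := ((tendsto_fst_Lfil p₀ 0).comp ht).eventually hH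
  have a3 : ∀ᶠ z in Lfil (p₀, (0 : Vec2 × ℝ)), Φ (ψ z) = Φ z.1 :=
    Filter.Eventually.filter_mono inf_le_left h4
  filter_upwards [a1, a2, a3] with z b1 b2 b3
  have b2' : H (ψ z) = h (Φ (ψ z)) := b2
  show H (ψ z) = H z.1
  rw [b2', b3, b1]

lemma local_const {Φ : Fin 3 → Vec2 × ℝ → Vec2} {Φ' : Fin 3 → Vec2 × ℝ →L[ℝ] Vec2}
    {p₀ : Vec2 × ℝ}
    (hΦ : ∀ j, ContDiffAt ℝ 1 (Φ j) p₀) (hΦ' : ∀ j, HasFDerivAt (Φ j) (Φ' j) p₀)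
    (hsurj : ∀ j, Function.Surjective (Φ' j))
    {w : Fin 3 → Vec2 × ℝ} (hw : ∀ j, Φ' j (w j) = 0) (hli : LinearIndependent ℝ w)
    {H : Vec2 × ℝ → ℝ} {h : Fin 3 → Vec2 → ℝ}
    (hH : ∀ j, ∀ᶠ p in Lfil p₀, H p = h j (Φ j p)) :
    ∃ c : ℝ, ∀ᶠ p in Lfil p₀, H p = c := by
  let b := basisOfLinearIndependentOfCardEqFinrank hli (by simp)
  have hb : ∀ j, b j = w j := fun j => by simp [b]
  let ℓ : Fin 3 → (Vec2 × ℝ →L[ℝ] ℝ) := fun j => (b.coord j).toContinuousLinearMap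
  have hℓ : ∀ j, ℓ j (w j) = 1 := fun j => by simp [ℓ, ← hb]
  have hsum : ∀ v, v = ℓ 0 v • w 0 + ℓ 1 v • w 1 + ℓ 2 v • w 2 := fun v => by
    have := b.sum_repr v
    rw [Fin.sum_univ_three] at this
    simp only [hb] at this
    exact this.symm
  choose Ψ c1 c2 c3 c4 c5 using
    fun j => step_lemma (hΦ j) (hΦ' j) (hsurj j) (hw j) (hℓ j) (hH j)
  have e10 : ContDiffAt ℝ 1 (Ψ 1 ∘ Ψ 0) (p₀, (0 : Vec2 × ℝ)) :=
    ContDiffAt.comp _ (by rw [c3 0]; exact c1 1) (c1 0)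
  have e210 : ContDiffAt ℝ 1 (Ψ 2 ∘ Ψ 1 ∘ Ψ 0) (p₀, (0 : Vec2 × ℝ)) :=
    ContDiffAt.comp _ (by rw [Function.comp_apply, c3 0, c3 1]; exact c1 2) e10
  have f10 : HasFDerivAt (Ψ 1 ∘ Ψ 0) _ (p₀, (0 : Vec2 × ℝ)) :=
    HasFDerivAt.comp _ (by rw [c3 0]; exact c2 1) (c2 0)
  have f210 : HasFDerivAt (Ψ 2 ∘ Ψ 1 ∘ Ψ 0) _ (p₀, (0 : Vec2 × ℝ)) :=
    HasFDerivAt.comp _ (by rw [Function.comp_apply, c3 0, c3 1]; exact c2 2) f10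
  let G : (Vec2 × ℝ) × (Vec2 × ℝ) → (Vec2 × ℝ) × (Vec2 × ℝ) :=
    fun z => (z.1, (Ψ 2 (Ψ 1 (Ψ 0 z))).1)
  have hG : ContDiffAt ℝ 1 G (p₀, 0) := contDiffAt_fst.prodMk e210.fst
  obtain ⟨G', hG', hGa⟩ : ∃ G', HasFDerivAt G G' (p₀, 0) ∧ ∀ x y, G' (x, y) =
      (x, x + (ℓ 0 y • w 0 + ℓ 1 y • w 1 + ℓ 2 y • w 2)) := by
    refine ⟨_, hasFDerivAt_fst.prodMk f210.fst, fun x y => ?_⟩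
    simp [shear, add_assoc]
  have hG0 : G (p₀, 0) = (p₀, p₀) := by simp [G, c3]
  have hGi : Function.Injective G' := by
    rw [injective_iff_map_eq_zero]
    rintro ⟨x, y⟩ hz
    rw [hGa, ← hsum, Prod.mk_eq_zero] at hz
    obtain ⟨rfl, hz2⟩ := hz
    rw [zero_add] at hz2
    rw [hz2]; rfl
  obtain ⟨K, e, he, hK, hK', hKx, hl, hr⟩ := exists_local_inverse hG hG' hGi
  rw [hG0] at hK hK' hKx hr
  have tK : Tendsto K (Lfil (p₀, p₀)) (Lfil (p₀, 0)) :=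
    tendsto_Lfil hK hK' e.symm.injective hKx
  have key : ∀ᶠ z in Lfil (p₀, (0 : Vec2 × ℝ)), H (G z).2 = H z.1 := by
    filter_upwards [c5 0, (c4 0).eventually (c5 1),
      ((c4 1).comp (c4 0)).eventually (c5 2)] with z h0 h1 h2
    simp only [Function.comp] at h2
    show H (Ψ 2 (Ψ 1 (Ψ 0 z))).1 = H z.1
    rw [h2, h1, h0]
  have key2 : ∀ᶠ y in Lfil (p₀, p₀), H y.2 = H y.1 := by
    filter_upwards [tK.eventually key, Filter.Eventually.filter_mono inf_le_left hr] with y h1 h2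
    rw [h2] at h1
    have h3 : (G (K y)).1 = y.1 := by rw [h2]
    have h3 : (K y).1 = y.1 := h3
    rw [h1, h3]
  rw [Lfil, eventually_inf, ] at key2
  obtain ⟨U, hU, S, hS, hUS⟩ := key2
  rw [mem_nhds_prod_iff] at hU
  obtain ⟨U1, hU1, U2, hU2, hUU⟩ := hU
  have hS' : ∀ᵐ x ∂(volume : Measure (Vec2 × ℝ)), ∀ᵐ y ∂(volume : Measure (Vec2 × ℝ)),
      (x, y) ∈ S := Measure.ae_ae_of_ae_prod hS
  have hne : (𝓝 p₀ ⊓ ae (volume : Measure (Vec2 × ℝ))).NeBot := Lfil_neBot p₀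
  have hex : ∀ᶠ x in 𝓝 p₀ ⊓ ae (volume : Measure (Vec2 × ℝ)), x ∈ U1 ∧
      ∀ᵐ y ∂(volume : Measure (Vec2 × ℝ)), (x, y) ∈ S :=
    (Filter.Eventually.filter_mono inf_le_left hU1).and
      (Filter.Eventually.filter_mono inf_le_right hS')
  obtain ⟨x, hx1, hx2⟩ := hex.exists
  refine ⟨H x, ?_⟩
  filter_upwards [Filter.Eventually.filter_mono (inf_le_left : Lfil p₀ ≤ _) hU2,
    Filter.Eventually.filter_mono (inf_le_right : Lfil p₀ ≤ _) hx2] with y hy1 hy2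
  have hxy : (x, y) ∈ U1 ×ˢ U2 := ⟨hx1, hy1⟩
  exact hUS _ ⟨hUU hxy, hy2⟩

lemma Lfil_eventually_iff {p₀ : Vec2 × ℝ} {P : Vec2 × ℝ → Prop} :
    (∀ᶠ p in Lfil p₀, P p) ↔ ∃ U, IsOpen U ∧ p₀ ∈ U ∧ ∀ᵐ p, p ∈ U → P p := by
  rw [Lfil, eventually_inf]
  constructor
  · rintro ⟨s, hs, t, ht, h⟩
    obtain ⟨U, hUs, hU, hp⟩ := _root_.mem_nhds_iff.1 hs
    refine ⟨U, hU, hp, ?_⟩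
    filter_upwards [ht] with p hpt hpU using h p ⟨hUs hpU, hpt⟩
  · rintro ⟨U, hU, hp, h⟩
    exact ⟨U, hU.mem_nhds hp, _, h, fun x hx => hx.2 hx.1⟩

lemma ae_of_locally {Ω : Set (Vec2 × ℝ)} (hΩ : IsOpen Ω) {P : Vec2 × ℝ → Prop}
    (h : ∀ p ∈ Ω, ∀ᶠ q in Lfil p, P q) : ∀ᵐ p ∂(volume.restrict Ω), P p := by
  rw [ae_restrict_iff' hΩ.measurableSet, ae_iff]
  refine measure_null_of_locally_null _ fun x hx => ?_
  have hx : x ∈ Ω := by simp at hx; exact hx.1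
  obtain ⟨U, hU, hxU, hP⟩ := Lfil_eventually_iff.1 (h x hx)
  refine ⟨U ∩ {a | ¬ (a ∈ Ω → P a)}, Filter.inter_mem (mem_nhdsWithin_of_mem_nhds (hU.mem_nhds hxU)) self_mem_nhdsWithin, ?_⟩
  refine measure_mono_null ?_ (ae_iff.1 hP)
  rintro a ⟨ha, hb⟩ hc
  exact hb fun _ => hc ha

lemma locally_of_ae {Ω : Set (Vec2 × ℝ)} (hΩ : IsOpen Ω) {P : Vec2 × ℝ → Prop}
    (h : ∀ᵐ p ∂(volume.restrict Ω), P p) {p : Vec2 × ℝ} (hp : p ∈ Ω) :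
    ∀ᶠ q in Lfil p, P q := by
  rw [ae_restrict_iff' hΩ.measurableSet] at h
  exact Lfil_eventually_iff.2 ⟨Ω, hΩ, hp, h⟩

lemma global_const {Ω : Set (Vec2 × ℝ)} (hΩ : IsOpen Ω) (hc : IsConnected Ω)
    {H : Vec2 × ℝ → ℝ} (h : ∀ p ∈ Ω, ∃ c : ℝ, ∀ᶠ q in Lfil p, H q = c) :
    ∃ c : ℝ, ∀ᵐ p ∂(volume.restrict Ω), H p = c := by
  obtain ⟨p₀, hp₀⟩ := hc.nonempty
  obtain ⟨c, hc₀⟩ := h p₀ hp₀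
  refine ⟨c, ae_of_locally hΩ ?_⟩
  have hopen : ∀ P : Vec2 × ℝ → Prop, IsOpen {p | ∀ᶠ q in Lfil p, P q} := by
    intro P
    rw [isOpen_iff_mem_nhds]
    intro p hp
    obtain ⟨U, hU, hpU, hP⟩ := Lfil_eventually_iff.1 hp
    filter_upwards [hU.mem_nhds hpU] with q hq
    exact Lfil_eventually_iff.2 ⟨U, hU, hq, hP⟩
  have hsub : Ω ⊆ {p | ∀ᶠ q in Lfil p, H q = c} := by
    refine hc.isPreconnected.subset_left_of_subset_union (hopen _)
      (hopen (fun q => H q ≠ c)) ?_ ?_ ⟨p₀, hp₀, hc₀⟩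
    · rw [Set.disjoint_left]
      intro p h1 h2
      have := Lfil_neBot p
      have h1 : ∀ᶠ q in Lfil p, H q = c := h1
      have h2 : ∀ᶠ q in Lfil p, H q ≠ c := h2
      obtain ⟨q, hq1, hq2⟩ := (h1.and h2).exists
      exact hq2 hq1
    · intro p hp
      obtain ⟨c', hc'⟩ := h p hp
      by_cases hcc : c' = c
      · left; rw [← hcc]; exact hc'
      · right
        exact hc'.mono fun q hq => by rw [hq]; exact hcc
  exact fun p hp => hsub hp

lemma Φmap_hasFDerivAt {φ : Vec2 → ℝ} {p : Vec2 × ℝ} (hφ : AnalyticAt ℝ φ p.1)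
    (hD : Dder φ p.1 ≠ 0) :
    ContDiffAt ℝ 1 (Φmap φ) p ∧ ∃ Φ' : Vec2 × ℝ →L[ℝ] Vec2, HasFDerivAt (Φmap φ) Φ' p ∧ Function.Surjective Φ' := by
  have hDa : AnalyticAt ℝ (Dder φ) p.1 := by
    have h1 : AnalyticAt ℝ (fderiv ℝ φ) p.1 := hφ.fderiv
    exact AnalyticAt.comp (g := fun L : Vec2 →L[ℝ] ℝ => L ((0, 1) : Vec2))
      ((ContinuousLinearMap.apply ℝ ℝ ((0, 1) : Vec2)).analyticAt _) h1
  have c1 : ContDiffAt ℝ 1 (fun q : Vec2 × ℝ => φ q.1) p :=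
    ContDiffAt.comp p (g := φ) (f := Prod.fst) hφ.contDiffAt contDiffAt_fst
  have c2 : ContDiffAt ℝ 1 (fun q : Vec2 × ℝ => Dder φ q.1) p :=
    ContDiffAt.comp p (g := Dder φ) (f := Prod.fst) hDa.contDiffAt contDiffAt_fst
  refine ⟨c1.prodMk (contDiffAt_snd.mul c2), ?_⟩
  have d1 : HasFDerivAt (fun q : Vec2 × ℝ => φ q.1)
      ((fderiv ℝ φ p.1).comp (ContinuousLinearMap.fst ℝ Vec2 ℝ)) p :=
    HasFDerivAt.comp p (g := φ) (f := Prod.fst) hφ.differentiableAt.hasFDerivAt hasFDerivAt_fst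
  have d2 : HasFDerivAt (fun q : Vec2 × ℝ => Dder φ q.1)
      ((fderiv ℝ (Dder φ) p.1).comp (ContinuousLinearMap.fst ℝ Vec2 ℝ)) p :=
    HasFDerivAt.comp p (g := Dder φ) (f := Prod.fst) hDa.differentiableAt.hasFDerivAt
      hasFDerivAt_fst
  have d3 : HasFDerivAt (fun q : Vec2 × ℝ => q.2) (ContinuousLinearMap.snd ℝ Vec2 ℝ) p :=
    hasFDerivAt_snd
  refine ⟨_, d1.prodMk (d3.mul d2), ?_⟩
  rintro ⟨a, b⟩
  let u : Vec2 := (a / Dder φ p.1) • ((0, 1) : Vec2)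
  have hu : fderiv ℝ φ p.1 u = a := by
    have : fderiv ℝ φ p.1 ((0, 1) : Vec2) ≠ 0 := hD
    simp only [u, map_smul, smul_eq_mul, Dder]
    field_simp
  refine ⟨(u, (b - p.2 * fderiv ℝ (Dder φ) p.1 u) / Dder φ p.1), ?_⟩
  refine Prod.ext ?_ ?_
  · simpa using hu
  · simp
    field_simp
    ring

lemma pair_indep {E : Type*} [AddCommGroup E] [Module ℝ E] {u v : E}
    (h : LinearIndependent ℝ ![u, v]) {a b : ℝ} (hab : a • u + b • v = 0) : a = 0 ∧ b = 0 :=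
  LinearIndependent.pair_iff.1 h a b hab

/-- measurable solutions of the functional equation on a connected open set
away from `{s = 0}` are unique up to a constant scalar factor. -/
theorem stmt11
    -- `B` is a nonempty open ball of finite radius, `Bt` a connected open neighborhood of its closure
    (c₀ : Vec2) (r₀ : ℝ) (hr₀ : 0 < r₀)
    (B Bt : Set Vec2) (hB : B = Metric.ball c₀ r₀)
    (hBt_open : IsOpen Bt) (hBt_conn : IsConnected Bt) (hBBt : closure B ⊆ Bt)
    -- the φⱼ are real analytic submersions on `Bt`
    (φ : Fin 4 → Vec2 → ℝ)
    (hφ_an : ∀ j, AnalyticOnNhd ℝ (φ j) Bt)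
    (hφ_sub : ∀ j, ∀ x ∈ Bt, fderiv ℝ (φ j) x ≠ 0)
    -- transversality hypothesis
    (htrans : ∀ x ∈ B, ∀ j k : Fin 4, j ≠ k →
      LinearIndependent ℝ ![fderiv ℝ (φ j) x, fderiv ℝ (φ k) x])
    -- Vⱼ : nowhere vanishing real analytic vector fields with Vⱼ φⱼ ≡ 0
    (V : Fin 4 → Vec2 → Vec2)
    (hV_an : ∀ j, AnalyticOnNhd ℝ (V j) Bt)
    (hV_ne : ∀ j, ∀ x ∈ Bt, V j x ≠ 0)
    (hV_ker : ∀ j, ∀ x ∈ Bt, fderiv ℝ (φ j) x (V j x) = 0)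
    -- auxiliary hypothesis 2
    (W : Fin 4 → Fin 4 → (Vec2 × ℝ) → (Vec2 × ℝ))
    (hW_an : ∀ j k, AnalyticOnNhd ℝ (W j k) (Bt ×ˢ (univ : Set ℝ)))
    (hW_ne : ∀ j k, ∀ p ∈ Bt ×ˢ (univ : Set ℝ), W j k p ≠ 0)
    (hW_ker : ∀ j k, ∀ p ∈ Bt ×ˢ (univ : Set ℝ),
      fderiv ℝ (fun q : Vec2 × ℝ => ((φ j q.1, q.2 * fderiv ℝ (φ j) q.1 (V k q.1)) : Vec2))
        p (W j k p) = 0)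
    (haux2 : ∀ k : Fin 4, ∀ p : Vec2 × ℝ, p.1 ∈ Bt → p.2 ≠ 0 →
      LinearIndependent ℝ (fun j : {j : Fin 4 // j ≠ k} => W j.1 k p))
    -- coordinates are chosen so that φ₄(x₁,x₂) = x₁ on B
    (hφ4 : ∀ x ∈ B, φ 3 x = x.1)
    (Ω : Set (Vec2 × ℝ)) (hΩ_open : IsOpen Ω) (hΩ_conn : IsConnected Ω)
    (hΩ_sub : Ω ⊆ {p : Vec2 × ℝ | p.1 ∈ B ∧ p.2 ≠ 0})
    (f g : Fin 3 → Vec2 → ℝ)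
    (hf_meas : ∀ j, Measurable (f j)) (hg_meas : ∀ j, Measurable (g j))
    (hf_sol : ∀ᵐ p ∂(volume.restrict Ω),
      ∑ j : Fin 3, f j (Φmap (φ j.castSucc) p) • fderiv ℝ (φ j.castSucc) p.1 = 0)
    (hg_sol : ∀ᵐ p ∂(volume.restrict Ω),
      ∑ j : Fin 3, g j (Φmap (φ j.castSucc) p) • fderiv ℝ (φ j.castSucc) p.1 = 0)
    (hg_ne : ¬ (∀ᵐ p ∂(volume.restrict Ω), ∀ j : Fin 3, g j (Φmap (φ j.castSucc) p) = 0)) :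
    ∃ c : ℝ, ∀ j : Fin 3, ∀ᵐ p ∂(volume.restrict Ω),
      f j (Φmap (φ j.castSucc) p) = c * g j (Φmap (φ j.castSucc) p) := by
  have hBopen : IsOpen B := by rw [hB]; exact isOpen_ball
  have hBsub : B ⊆ Bt := subset_closure.trans hBBt
  have hne : ∀ i j : Fin 3, i ≠ j → i.castSucc ≠ j.castSucc := fun i j hij h =>
    hij (Fin.castSucc_injective _ h)
  have hne3 : ∀ j : Fin 3, j.castSucc ≠ (3 : Fin 4) := by decide
  -- the derivative of `φ 3` on `B`
  have hd3 : ∀ x ∈ B, fderiv ℝ (φ 3) x = ContinuousLinearMap.fst ℝ ℝ ℝ := by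
    intro x hx
    have : φ 3 =ᶠ[𝓝 x] Prod.fst := by
      filter_upwards [hBopen.mem_nhds hx] with y hy using hφ4 y hy
    rw [this.fderiv_eq, fderiv_fst]
  have hV3 : ∀ x ∈ B, V 3 x = (V 3 x).2 • ((0, 1) : Vec2) := by
    intro x hx
    have h := hV_ker 3 x (hBsub hx)
    rw [hd3 x hx] at h
    have h : (V 3 x).1 = 0 := h
    refine Prod.ext ?_ ?_
    · simp [h]
    · simp
  have hv : ∀ x ∈ B, (V 3 x).2 ≠ 0 := by
    intro x hx h
    refine hV_ne 3 x (hBsub hx) ?_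
    rw [hV3 x hx, h, zero_smul]
  have hD : ∀ x ∈ B, ∀ j : Fin 3, Dder (φ j.castSucc) x ≠ 0 := by
    intro x hx j h
    have hli := htrans x hx _ _ (hne3 j)
    have h' : fderiv ℝ (φ j.castSucc) x ((0, 1) : Vec2) = 0 := h
    have := pair_indep hli (a := 1) (b := - fderiv ℝ (φ j.castSucc) x ((1, 0) : Vec2)) (by
      rw [hd3 x hx]
      refine ContinuousLinearMap.ext fun u => ?_
      have hu : u = u.1 • ((1, 0) : Vec2) + u.2 • ((0, 1) : Vec2) := by
        refine Prod.ext ?_ ?_ <;> simp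
      have hfu : fderiv ℝ (φ j.castSucc) x u
          = u.1 * fderiv ℝ (φ j.castSucc) x ((1, 0) : Vec2) := by
        conv_lhs => rw [hu]
        rw [map_add, map_smul, map_smul, h']
        simp
      simp [hfu]
      ring)
    exact one_ne_zero this.1
  -- main invariance principle
  have main : ∀ (H : Vec2 × ℝ → ℝ) (h : Fin 3 → Vec2 → ℝ),
      (∀ j : Fin 3, ∀ᵐ p ∂(volume.restrict Ω), H p = h j (Φmap (φ j.castSucc) p)) →
      ∃ c : ℝ, ∀ᵐ p ∂(volume.restrict Ω), H p = c := by
    intro H h hH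
    refine global_const hΩ_open hΩ_conn ?_
    intro p hp
    obtain ⟨hpB, hps⟩ := hΩ_sub hp
    have hgeo := fun j : Fin 3 =>
      Φmap_hasFDerivAt (hφ_an j.castSucc p.1 (hBsub hpB)) (hD p.1 hpB j)
    choose g1 Φ' g2 g3 using hgeo
    let v : Vec2 → ℝ := fun x => (V 3 x).2
    have hvd : HasFDerivAt v (fderiv ℝ v p.1) p.1 := by
      have : DifferentiableAt ℝ (V 3) p.1 := (hV_an 3 p.1 (hBsub hpB)).differentiableAt
      exact this.snd.hasFDerivAt
    have hvp : v p.1 ≠ 0 := hv p.1 hpB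
    let q : Vec2 × ℝ := (p.1, p.2 / v p.1)
    let S : Vec2 × ℝ → Vec2 × ℝ := fun z => (z.1, z.2 * v z.1)
    have hSq : S q = p := by
      refine Prod.ext rfl ?_
      show p.2 / v p.1 * v p.1 = p.2
      field_simp
    obtain ⟨S', hS', hSa⟩ : ∃ S' : Vec2 × ℝ →L[ℝ] Vec2 × ℝ, HasFDerivAt S S' q ∧
        ∀ z, S' z = (z.1, q.2 * fderiv ℝ v p.1 z.1 + v p.1 * z.2) := by
      have d1 : HasFDerivAt (fun z : Vec2 × ℝ => v z.1)
          ((fderiv ℝ v p.1).comp (ContinuousLinearMap.fst ℝ Vec2 ℝ)) q :=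
        HasFDerivAt.comp q (g := v) (f := Prod.fst) hvd hasFDerivAt_fst
      have d3 : HasFDerivAt (fun z : Vec2 × ℝ => z.2) (ContinuousLinearMap.snd ℝ Vec2 ℝ) q :=
        hasFDerivAt_snd
      have d0 : HasFDerivAt (fun z : Vec2 × ℝ => z.1) (ContinuousLinearMap.fst ℝ Vec2 ℝ) q :=
        hasFDerivAt_fst
      refine ⟨_, d0.prodMk (d3.mul d1), fun z => ?_⟩
      refine Prod.ext ?_ ?_
      · simp
      · simp [q]
    have hSinj : Function.Injective S' := by
      rw [injective_iff_map_eq_zero]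
      rintro ⟨x, t⟩ hz
      rw [hSa, Prod.mk_eq_zero] at hz
      obtain ⟨hx, ht⟩ := hz
      have hx : x = 0 := hx
      subst hx
      have : t = 0 := by simpa [hvp] using ht
      rw [this]; rfl
    have hqB : q ∈ Bt ×ˢ (univ : Set ℝ) := ⟨hBsub hpB, mem_univ _⟩
    have hq2 : q.2 ≠ 0 := div_ne_zero hps hvp
    let w : Fin 3 → Vec2 × ℝ := fun j => S' (W j.castSucc 3 q)
    have hli : LinearIndependent ℝ w := by
      have h0 := haux2 3 q (hBsub hpB) hq2
      have h1 := h0.comp (fun j : Fin 3 => (⟨j.castSucc, hne3 j⟩ : {j : Fin 4 // j ≠ 3}))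
        (fun a b hab => Fin.castSucc_injective _ (congrArg Subtype.val hab))
      exact h1.map' (S' : Vec2 × ℝ →ₗ[ℝ] Vec2 × ℝ) (LinearMap.ker_eq_bot.2 hSinj)
    have hw : ∀ j, Φ' j (w j) = 0 := by
      intro j
      have hc : HasFDerivAt (Φmap (φ j.castSucc) ∘ S) ((Φ' j).comp S') q :=
        HasFDerivAt.comp q (by rw [hSq]; exact g2 j) hS'
      have heq : (fun z : Vec2 × ℝ => ((φ j.castSucc z.1,
          z.2 * fderiv ℝ (φ j.castSucc) z.1 (V 3 z.1)) : Vec2))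
          =ᶠ[𝓝 q] Φmap (φ j.castSucc) ∘ S := by
        have : ∀ᶠ z : Vec2 × ℝ in 𝓝 q, z.1 ∈ B :=
          continuous_fst.continuousAt.eventually (hBopen.mem_nhds hpB)
        filter_upwards [this] with z hz
        refine Prod.ext rfl ?_
        show z.2 * fderiv ℝ (φ j.castSucc) z.1 (V 3 z.1)
          = z.2 * (V 3 z.1).2 * fderiv ℝ (φ j.castSucc) z.1 ((0, 1) : Vec2)
        conv_lhs => rw [hV3 z.1 hz]
        rw [map_smul, smul_eq_mul, mul_assoc]
      have hk := hW_ker j.castSucc 3 q hqB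
      rw [heq.fderiv_eq, hc.fderiv] at hk
      exact hk
    exact local_const g1 g2 g3 hw hli fun j => locally_of_ae hΩ_open (hH j) hp
  -- linear algebra
  have alg : ∀ x ∈ B, ∀ a : Fin 3 → ℝ, ∑ j : Fin 3, a j • fderiv ℝ (φ j.castSucc) x = 0 →
      ∀ i, a i = 0 → ∀ j, a j = 0 := by
    intro x hx a ha i hi j
    rw [Fin.sum_univ_three] at ha
    have k01 := fun s t => pair_indep (a := s) (b := t)
      (htrans x hx _ _ (hne 0 1 (by decide)))
    have k02 := fun s t => pair_indep (a := s) (b := t)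
      (htrans x hx _ _ (hne 0 2 (by decide)))
    have k12 := fun s t => pair_indep (a := s) (b := t)
      (htrans x hx _ _ (hne 1 2 (by decide)))
    fin_cases i
    · have hi : a 0 = 0 := hi
      rw [hi, zero_smul, zero_add] at ha
      have := k12 _ _ ha
      fin_cases j
      exacts [hi, this.1, this.2]
    · have hi : a 1 = 0 := hi
      rw [hi, zero_smul, add_zero] at ha
      have := k02 _ _ ha
      fin_cases j
      exacts [this.1, hi, this.2]
    · have hi : a 2 = 0 := hi
      rw [hi, zero_smul, add_zero] at ha
      have := k01 _ _ ha
      fin_cases j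
      exacts [this.1, this.2, hi]
  have hmem : ∀ᵐ p ∂(volume.restrict Ω), p ∈ Ω := ae_restrict_mem hΩ_open.measurableSet
  classical
  let F : Fin 3 → Vec2 × ℝ → ℝ := fun j p => f j (Φmap (φ j.castSucc) p)
  let G : Fin 3 → Vec2 × ℝ → ℝ := fun j p => g j (Φmap (φ j.castSucc) p)
  have zeroG : ∀ᵐ p ∂(volume.restrict Ω), ∀ i, G i p = 0 → ∀ j, G j p = 0 := by
    filter_upwards [hmem, hg_sol] with p hp hg i hi j
    exact alg p.1 (hΩ_sub hp).1 (fun j => G j p) hg i hi j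
  have cross : ∀ᵐ p ∂(volume.restrict Ω), ∀ j, F j p * G 0 p = G j p * F 0 p := by
    filter_upwards [hmem, hf_sol, hg_sol] with p hp hf hg j
    have := alg p.1 (hΩ_sub hp).1 (fun j => G 0 p * F j p - F 0 p * G j p) (by
      have e : ∀ j : Fin 3, (G 0 p * F j p - F 0 p * G j p) • fderiv ℝ (φ j.castSucc) p.1
          = G 0 p • (F j p • fderiv ℝ (φ j.castSucc) p.1)
            - F 0 p • (G j p • fderiv ℝ (φ j.castSucc) p.1) := by
        intro j
        refine ContinuousLinearMap.ext fun u => ?_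
        simp
        ring
      have hf : ∑ j : Fin 3, F j p • fderiv ℝ (φ j.castSucc) p.1 = 0 := hf
      have hg : ∑ j : Fin 3, G j p • fderiv ℝ (φ j.castSucc) p.1 = 0 := hg
      simp only [e]
      rw [Finset.sum_sub_distrib, ← Finset.smul_sum, ← Finset.smul_sum, hf, hg]
      simp) 0 (by ring) j
    have this : G 0 p * F j p - F 0 p * G j p = 0 := this
    linarith
  -- step 1: `G` is nonzero almost everywhere
  obtain ⟨c1, hc1⟩ := main (fun p => if G 0 p = 0 then 0 else 1)
    (fun j y => if g j y = 0 then 0 else 1) (by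
      intro j
      filter_upwards [zeroG] with p hp
      have : (G 0 p = 0) ↔ (G j p = 0) := ⟨fun h => hp 0 h j, fun h => hp j h 0⟩
      show (if G 0 p = 0 then (0 : ℝ) else 1) = if G j p = 0 then 0 else 1
      simp only [this])
  have hGne : ∀ᵐ p ∂(volume.restrict Ω), G 0 p ≠ 0 := by
    by_cases hc : c1 = 0
    · exfalso
      apply hg_ne
      filter_upwards [hc1, zeroG] with p h1 h2
      refine h2 0 ?_
      by_contra h3
      simp [h3, hc] at h1
    · filter_upwards [hc1] with p h1 h2
      rw [if_pos h2] at h1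
      exact hc h1.symm
  -- step 2: the quotient is constant
  obtain ⟨c, hc⟩ := main (fun p => F 0 p / G 0 p) (fun j y => f j y / g j y) (by
    intro j
    filter_upwards [zeroG, cross, hGne] with p h1 h2 h3
    have h4 : G j p ≠ 0 := fun h => h3 (h1 j h 0)
    show F 0 p / G 0 p = F j p / G j p
    rw [div_eq_div_iff h3 h4]
    linarith [h2 j])
  refine ⟨c, fun j => ?_⟩
  filter_upwards [cross, hGne, hc] with p h2 h3 h4
  show F j p = c * G j p
  rw [← h4]
  field_simp
  linarith [h2 j]
end
end

section
/- Assume the transversality hypothesis and auxiliary hypothesis 2, and suppose that the functional equation admits, on some connected open subset of B×ℝ⁺, a Lebesgue measurable solution that does not vanish almost everywhere. Then there exists a unique exponent σ ∈ ℝ with the following property: for every connected open S ⊂ B×ℝ⁺ and every Lebesgue measurable solution f = (f₁,f₂,f₃) of the functional equation on S that does not vanish almost everywhere on S, there exist real analytic functions F₁,F₂,F₃ such that, for each j ∈ {1,2,3}, f_j(y,t) = |t|^σ F_j(y) for almost every (y,t) in the image Φ_j(S). -/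
open MeasureTheory Real Set Filter Metric
open scoped FourierTransform ENNReal NNReal Topology ComplexConjugate

noncomputable section

/-- Filter of neighbourhoods of `a` up to null sets. -/
def nae {E : Type*} [TopologicalSpace E] [MeasureSpace E] (a : E) : Filter E :=
  𝓝 a ⊓ ae (volume : Measure E)

section naeSec

lemma eventually_nae {E : Type*} [TopologicalSpace E] [MeasureSpace E] {a : E} {P : E → Prop} :
    (∀ᶠ x in nae a, P x) ↔ ∃ U, IsOpen U ∧ a ∈ U ∧ ∀ᵐ x, x ∈ U → P x := by
  unfold nae
  rw [Filter.eventually_inf]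
  constructor
  · rintro ⟨s, hs, t, ht, h⟩
    obtain ⟨U, hUs, hU, ha⟩ := _root_.mem_nhds_iff.1 hs
    refine ⟨U, hU, ha, ?_⟩
    filter_upwards [ht] with x hx hxU
    exact h x ⟨hUs hxU, hx⟩
  · rintro ⟨U, hU, ha, h⟩
    exact ⟨U, hU.mem_nhds ha, _, h, fun x hx => hx.2 hx.1⟩

lemma nae_le_nhds {E : Type*} [TopologicalSpace E] [MeasureSpace E] (a : E) : nae a ≤ 𝓝 a :=
  inf_le_left

lemma eventually_nae_nae {E : Type*} [TopologicalSpace E] [MeasureSpace E] {a : E} {P : E → Prop}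
    (h : ∀ᶠ x in nae a, P x) : ∀ᶠ y in 𝓝 a, ∀ᶠ x in nae y, P x := by
  obtain ⟨U, hU, ha, h⟩ := eventually_nae.1 h
  filter_upwards [hU.mem_nhds ha] with y hy
  exact eventually_nae.2 ⟨U, hU, hy, h⟩

instance nae_neBot {E : Type*} [TopologicalSpace E] [MeasureSpace E]
    [(volume : Measure E).IsOpenPosMeasure] (a : E) : (nae a).NeBot := by
  rw [← Filter.frequently_true_iff_neBot, Filter.Frequently]
  intro h
  obtain ⟨U, hU, ha, h⟩ := eventually_nae.1 h
  have : volume U = 0 := by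
    rw [measure_eq_zero_iff_ae_notMem]
    filter_upwards [h] with x hx hxU
    exact hx hxU trivial
  exact (hU.measure_pos volume ⟨a, ha⟩).ne' this

lemma nae_eq_of_cont {E : Type*} [TopologicalSpace E] [MeasureSpace E] [OpensMeasurableSpace E]
    [(volume : Measure E).IsOpenPosMeasure] {a : E} {f g : E → ℝ}
    (h : ∀ᶠ x in nae a, f x = g x) (hf : ∀ᶠ x in 𝓝 a, ContinuousAt f x)
    (hg : ∀ᶠ x in 𝓝 a, ContinuousAt g x) : ∀ᶠ x in 𝓝 a, f x = g x := by
  obtain ⟨U, hU, ha, h⟩ := eventually_nae.1 h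
  obtain ⟨V, hVs, hV, haV⟩ := _root_.mem_nhds_iff.1 (hf.and hg)
  have hUV := hU.inter hV
  have := Measure.eqOn_open_of_ae_eq (μ := (volume : Measure E)) (U := U ∩ V) (f := f) (g := g)
    ((ae_restrict_iff' hUV.measurableSet).2 (by filter_upwards [h] with x hx hx2; exact hx hx2.1)) hUV
    (fun x hx => (hVs hx.2).1.continuousWithinAt) (fun x hx => (hVs hx.2).2.continuousWithinAt)
  filter_upwards [hUV.mem_nhds ⟨ha, haV⟩] with x hx using this hx

lemma tendsto_fst_nae {E F : Type*} [TopologicalSpace E] [MeasureSpace E] [TopologicalSpace F]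
    [MeasureSpace F] [SFinite (volume : Measure E)] [SFinite (volume : Measure F)] (p : E × F) :
    Tendsto Prod.fst (nae p) (nae p.1) := by
  intro s hs
  obtain ⟨U, hU, ha, h⟩ := eventually_nae.1 (show ∀ᶠ x in nae p.1, x ∈ s from hs)
  refine eventually_nae.2 ⟨Prod.fst ⁻¹' U, hU.preimage continuous_fst, ha, ?_⟩
  exact (Measure.quasiMeasurePreserving_fst (μ := (volume : Measure E))
    (ν := (volume : Measure F))).ae h

lemma nae_fubini {E F : Type*} [TopologicalSpace E] [MeasureSpace E] [TopologicalSpace F]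
    [MeasureSpace F] [SFinite (volume : Measure E)] [SFinite (volume : Measure F)]
    {a : E} {b : F} {P : E × F → Prop}
    (h : ∀ᶠ z in nae (a, b), P z) : ∃ V, IsOpen V ∧ b ∈ V ∧ 
      ∀ᶠ x in nae a, ∀ᵐ y, y ∈ V → P (x, y) := by
  obtain ⟨U, hU, ha, h⟩ := eventually_nae.1 h
  obtain ⟨A, B, hA, hB, haA, hbB, hAB⟩ := isOpen_prod_iff.1 hU a b ha
  refine ⟨B, hB, hbB, eventually_nae.2 ⟨A, hA, haA, ?_⟩⟩
  have := Measure.ae_ae_of_ae_prod (μ := (volume : Measure E)) (ν := (volume : Measure F)) h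
  filter_upwards [this] with x hx hxA
  filter_upwards [hx] with y hy hyB
  exact hy (hAB ⟨hxA, hyB⟩)

lemma ift {E : Type*} [NormedAddCommGroup E] [NormedSpace ℝ E] [FiniteDimensional ℝ E]
    {f : E → E} {a : E} (hf : AnalyticAt ℝ f a) (hinj : ∀ v, fderiv ℝ f a v = 0 → v = 0) :
    ∃ g : E → E, AnalyticAt ℝ g (f a) ∧ g (f a) = a ∧ (∀ᶠ y in 𝓝 (f a), f (g y) = y) ∧
      (∀ᶠ x in 𝓝 a, g (f x) = x) ∧ ∀ v, fderiv ℝ g (f a) v = 0 → v = 0 := by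
  have : CompleteSpace E := FiniteDimensional.complete ℝ E
  have hinj' : Function.Injective (fderiv ℝ f a : E →ₗ[ℝ] E) :=
    (injective_iff_map_eq_zero _).2 hinj
  let e : E ≃L[ℝ] E := (LinearEquiv.ofInjectiveEndo _ hinj').toContinuousLinearEquiv
  have hcd : ContDiffAt ℝ ⊤ f a := hf.contDiffAt
  have he : HasFDerivAt f (e : E →L[ℝ] E) a := by
    convert hf.differentiableAt.hasFDerivAt using 1
    ext v; rfl
  have hs : HasStrictFDerivAt f (e : E →L[ℝ] E) a := hcd.hasStrictFDerivAt' he (by simp)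
  have hgan : AnalyticAt ℝ (hcd.localInverse he (by simp)) (f a) :=
    (hcd.to_localInverse he (by simp)).analyticAt
  refine ⟨hcd.localInverse he (by simp), hgan, ?_, ?_, ?_, ?_⟩
  · exact hcd.localInverse_apply_image he (by simp)
  · exact hs.eventually_right_inverse
  · exact hs.eventually_left_inverse
  · intro v hv
    have h1 : HasFDerivAt (f ∘ hcd.localInverse he (by simp))
        ((e : E →L[ℝ] E).comp (fderiv ℝ (hcd.localInverse he (by simp)) (f a))) (f a) := by
      apply HasFDerivAt.comp
      · rw [hcd.localInverse_apply_image he (by simp)]; exact he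
      · exact hgan.differentiableAt.hasFDerivAt
    have h2 : HasFDerivAt (f ∘ hcd.localInverse he (by simp)) (ContinuousLinearMap.id ℝ E) (f a) := by
      refine (hasFDerivAt_id (f a)).congr_of_eventuallyEq ?_
      exact hs.eventually_right_inverse
    have h3 := congrArg (fun T => T v) (h1.unique h2)
    simp only [ContinuousLinearMap.comp_apply, hv, map_zero] at h3
    exact h3.symm

lemma tendsto_nae_of_diffeo {E : Type*} [NormedAddCommGroup E] [NormedSpace ℝ E]
    [FiniteDimensional ℝ E] [MeasureSpace E] [BorelSpace E] [(volume : Measure E).IsAddHaarMeasure]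
    {f : E → E} {a : E} (hf : AnalyticAt ℝ f a) (hinj : ∀ v, fderiv ℝ f a v = 0 → v = 0) :
    Tendsto f (nae a) (nae (f a)) := by
  have : CompleteSpace E := FiniteDimensional.complete ℝ E
  obtain ⟨g, hg, hga, hfg, hgf, -⟩ := ift hf hinj
  intro s hs
  obtain ⟨U, hU, ha, h⟩ := eventually_nae.1 (show ∀ᶠ x in nae (f a), x ∈ s from hs)
  obtain ⟨V, hVs, hV, haV⟩ := _root_.mem_nhds_iff.1 hg.eventually_analyticAt
  have h1 : f ⁻¹' (U ∩ V) ∈ 𝓝 a := hf.continuousAt.preimage_mem_nhds ((hU.inter hV).mem_nhds ⟨ha, haV⟩)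
  obtain ⟨N, hNs, hN, haN⟩ := _root_.mem_nhds_iff.1 (Filter.inter_mem h1 hgf)
  refine eventually_nae.2 ⟨N, hN, haN, ?_⟩
  have hnull : volume ({x | ¬ (x ∈ U → x ∈ s)} ∩ V) = 0 :=
    measure_mono_null inter_subset_left h
  have := addHaar_image_eq_zero_of_differentiableOn_of_addHaar_eq_zero (volume : Measure E) 
    (f := g) (fun x hx => (hVs hx.2).differentiableAt.differentiableWithinAt) hnull
  refine measure_mono_null ?_ this
  intro x hx
  simp only [mem_compl_iff, mem_ofPred_eq, Classical.not_imp] at hx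
  have hxN := hNs hx.1
  exact ⟨f x, ⟨by simpa using ⟨hxN.1.1, hx.2⟩, hxN.1.2⟩, hxN.2⟩

instance haarV2 : (volume : Measure Vec2).IsAddHaarMeasure :=
  inferInstanceAs ((volume : Measure ℝ).prod (volume : Measure ℝ)).IsAddHaarMeasure
instance haarV3 : (volume : Measure (Vec2 × ℝ)).IsAddHaarMeasure :=
  inferInstanceAs ((volume : Measure Vec2).prod (volume : Measure ℝ)).IsAddHaarMeasure
instance haarV6 : (volume : Measure ((Vec2 × ℝ) × (Vec2 × ℝ))).IsAddHaarMeasure :=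
  Measure.prod.instIsAddHaarMeasure (volume : Measure (Vec2 × ℝ)) (volume : Measure (Vec2 × ℝ))

end naeSec


abbrev E3 : Type := Vec2 × ℝ

section reg

lemma tendsto_swap_nae {E F : Type*} [TopologicalSpace E] [MeasureSpace E] [TopologicalSpace F]
    [MeasureSpace F] [SFinite (volume : Measure E)] [SFinite (volume : Measure F)] (a : E) (b : F) :
    Tendsto Prod.swap (nae (b, a)) (nae (a, b)) := by
  intro s hs
  obtain ⟨U, hU, ha, h⟩ := eventually_nae.1 (show ∀ᶠ x in nae (a, b), x ∈ s from hs)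
  refine eventually_nae.2 ⟨Prod.swap ⁻¹' U, hU.preimage continuous_swap, ha, ?_⟩
  exact (Measure.measurePreserving_swap (μ := (volume : Measure F))
    (ν := (volume : Measure E))).quasiMeasurePreserving.ae h

/-- Sliding along the fibres of `Φ = (Ψ ·).1`. -/
lemma exists_slide {Ψ : E3 → E3} {p₀ w : E3} (hΨ : AnalyticAt ℝ Ψ p₀)
    (hinj : ∀ v, fderiv ℝ Ψ p₀ v = 0 → v = 0) (hw : fderiv ℝ Ψ p₀ w = (0, 1)) :
    ∃ M : E3 × ℝ → E3, AnalyticAt ℝ M (p₀, 0) ∧ M (p₀, 0) = p₀ ∧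
      (∀ v t, fderiv ℝ M (p₀, 0) (v, t) = v + t • w) ∧
      ∀ᶠ z in 𝓝 ((p₀, 0) : E3 × ℝ), (Ψ (M z)).1 = (Ψ z.1).1 := by
  obtain ⟨g, hg, hga, hfg, hgf, -⟩ := ift hΨ hinj
  let A : E3 × ℝ → E3 := fun z => Ψ z.1 + ((0 : Vec2), z.2)
  have hA0 : A (p₀, 0) = Ψ p₀ := by simp [A]
  have hA : AnalyticAt ℝ A (p₀, 0) := by
    apply AnalyticAt.add
    · exact AnalyticAt.fun_comp (f := Prod.fst) (g := Ψ) (x := (p₀, (0:ℝ))) hΨ analyticAt_fst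
    · exact analyticAt_const.prod analyticAt_snd
  have hM : AnalyticAt ℝ (fun z => g (A z)) (p₀, 0) := AnalyticAt.fun_comp (by rwa [hA0]) hA
  have hM0 : g (A (p₀, 0)) = p₀ := by rw [hA0, hga]
  have hev : ∀ᶠ z in 𝓝 ((p₀, 0) : E3 × ℝ), Ψ (g (A z)) = A z := by
    have := hA.continuousAt.tendsto
    rw [hA0] at this
    exact this.eventually hfg
  refine ⟨fun z => g (A z), hM, hM0, ?_, ?_⟩
  · intro v t
    have h1 : HasFDerivAt (fun z => Ψ (g (A z))) ((fderiv ℝ Ψ p₀).comp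
        (fderiv ℝ (fun z => g (A z)) (p₀, 0))) (p₀, 0) := by
      apply HasFDerivAt.comp (g := Ψ) (f := fun z => g (A z))
      · rw [hM0]; exact hΨ.differentiableAt.hasFDerivAt
      · exact hM.differentiableAt.hasFDerivAt
    have h2 : HasFDerivAt A ((fderiv ℝ Ψ p₀).comp (ContinuousLinearMap.fst ℝ E3 ℝ) +
        (ContinuousLinearMap.inr ℝ Vec2 ℝ).comp (ContinuousLinearMap.snd ℝ E3 ℝ)) (p₀, 0) := by
      apply HasFDerivAt.add
      · exact HasFDerivAt.comp (g := Ψ) (f := Prod.fst) ((p₀, 0) : E3 × ℝ)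
          hΨ.differentiableAt.hasFDerivAt hasFDerivAt_fst
      · exact ((ContinuousLinearMap.inr ℝ Vec2 ℝ).comp (ContinuousLinearMap.snd ℝ E3 ℝ)).hasFDerivAt
    have h3 := congrArg (fun T => T (v, t)) (h1.unique (h2.congr_of_eventuallyEq hev))
    simp only [ContinuousLinearMap.comp_apply, _root_.add_apply,
      ContinuousLinearMap.coe_fst', ContinuousLinearMap.coe_snd', ContinuousLinearMap.inr_apply] at h3
    rw [← sub_eq_zero]
    apply hinj
    rw [map_sub, h3, map_add, map_smul, hw]
    simp
  · filter_upwards [hev] with z hz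
    rw [hz]; simp [A]

lemma slide_step {N : E3 × E3 → E3} {M : E3 × ℝ → E3} {p₀ w : E3} (A : E3 → E3)
    (l : E3 →L[ℝ] ℝ) (hN : AnalyticAt ℝ N (p₀, 0)) (hN0 : N (p₀, 0) = p₀)
    (hN' : ∀ v t, fderiv ℝ N (p₀, 0) (v, t) = v + A t)
    (hM : AnalyticAt ℝ M (p₀, 0)) (hM0 : M (p₀, 0) = p₀)
    (hM' : ∀ v t, fderiv ℝ M (p₀, 0) (v, t) = v + t • w) :
    AnalyticAt ℝ (fun z : E3 × E3 => M (N z, l z.2)) (p₀, 0) ∧ M (N (p₀, 0), l 0) = p₀ ∧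
    ∀ v t, fderiv ℝ (fun z : E3 × E3 => M (N z, l z.2)) (p₀, 0) (v, t) = v + (A t + l t • w) := by
  have h0 : (N (p₀, 0), l (p₀, (0 : E3)).2) = (p₀, (0 : ℝ)) := by simp [hN0]
  have hl : AnalyticAt ℝ (fun z : E3 × E3 => l z.2) (p₀, 0) :=
    (l.comp (ContinuousLinearMap.snd ℝ E3 E3)).analyticAt _
  refine ⟨AnalyticAt.fun_comp (by rwa [h0]) (hN.prod hl), by simp [hN0, hM0], ?_⟩
  intro v t
  have h1 : HasFDerivAt (fun z : E3 × E3 => M (N z, l z.2)) ((fderiv ℝ M (p₀, 0)).comp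
      ((fderiv ℝ N (p₀, 0)).prod (l.comp (ContinuousLinearMap.snd ℝ E3 E3)))) (p₀, 0) := by
    apply HasFDerivAt.comp (g := M) (f := fun z : E3 × E3 => (N z, l z.2))
    · rw [h0]; exact hM.differentiableAt.hasFDerivAt
    · exact hN.differentiableAt.hasFDerivAt.prodMk
        (l.comp (ContinuousLinearMap.snd ℝ E3 E3)).hasFDerivAt
  rw [h1.fderiv]
  simp only [ContinuousLinearMap.comp_apply, ContinuousLinearMap.prod_apply, hN', hM',
    ContinuousLinearMap.coe_snd']
  abel

lemma slide_tendsto {N : E3 × E3 → E3} {p₀ : E3} (A : E3 → E3)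
    (hN : AnalyticAt ℝ N (p₀, 0)) (hN0 : N (p₀, 0) = p₀)
    (hN' : ∀ v t, fderiv ℝ N (p₀, 0) (v, t) = v + A t) (hA : A 0 = 0) :
    Tendsto N (nae (p₀, 0)) (nae p₀) := by
  have h := tendsto_nae_of_diffeo (f := fun z : E3 × E3 => (N z, z.2)) (a := (p₀, 0))
    (hN.prod analyticAt_snd) ?_
  · have h2 := (tendsto_fst_nae (N (p₀, (0:E3)), (0 : E3))).comp h
    rwa [hN0] at h2
  · rintro ⟨v, t⟩ hv
    have h1 : HasFDerivAt (fun z : E3 × E3 => (N z, z.2)) ((fderiv ℝ N (p₀, 0)).prod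
      (ContinuousLinearMap.snd ℝ E3 E3)) (p₀, 0) := 
      hN.differentiableAt.hasFDerivAt.prodMk hasFDerivAt_snd
    rw [h1.fderiv, ContinuousLinearMap.prod_apply, hN', Prod.mk_eq_zero] at hv
    obtain ⟨h2, h3⟩ := hv
    simp only [ContinuousLinearMap.coe_snd'] at h3
    subst h3
    rw [hA, add_zero] at h2
    rw [h2]; rfl

theorem regularity {Ψ : Fin 3 → E3 → E3} {a : Fin 3 → E3 → ℝ} {p₀ : E3} {w : Fin 3 → E3}
    (hΨ : ∀ j, AnalyticAt ℝ (Ψ j) p₀) (hinj : ∀ j v, fderiv ℝ (Ψ j) p₀ v = 0 → v = 0)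
    (hw : ∀ j, fderiv ℝ (Ψ j) p₀ (w j) = (0, 1))
    (hind : ∀ c : E3, c.1.1 • w 0 + c.1.2 • w 1 + c.2 • w 2 = 0 → c = 0)
    (ha : ∀ j, AnalyticAt ℝ (a j) p₀) (ha0 : ∀ j, a j p₀ ≠ 0)
    {g : E3 → ℝ} {f : Fin 3 → Vec2 → ℝ}
    (h : ∀ᶠ p in nae p₀, ∀ j, f j (Ψ j p).1 = g p * a j p) :
    ∃ G : E3 → ℝ, AnalyticAt ℝ G p₀ ∧ ∀ᶠ p in nae p₀, g p = G p := by
  choose M hM hM0 hM' hMΨ using fun j => exists_slide (hΨ j) (hinj j) (hw j)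
  let l2 : E3 →L[ℝ] ℝ := ContinuousLinearMap.snd ℝ Vec2 ℝ
  let l0 : E3 →L[ℝ] ℝ := (ContinuousLinearMap.fst ℝ ℝ ℝ).comp (ContinuousLinearMap.fst ℝ Vec2 ℝ)
  let l1 : E3 →L[ℝ] ℝ := (ContinuousLinearMap.snd ℝ ℝ ℝ).comp (ContinuousLinearMap.fst ℝ Vec2 ℝ)
  have hfst' : ∀ v t, fderiv ℝ (Prod.fst : E3 × E3 → E3) (p₀, 0) (v, t) = v + (fun _ => 0) t := by
    intro v t; simp [fderiv_fst]
  obtain ⟨b1, b2, b3⟩ := slide_step (N := Prod.fst) (fun _ => 0) l2 analyticAt_fst rfl hfst'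
    (hM 2) (hM0 2) (hM' 2)
  set N2 : E3 × E3 → E3 := fun z => M 2 (z.1, l2 z.2) with hN2
  obtain ⟨c1, c2, c3⟩ := slide_step (N := N2) _ l1 b1 b2 b3 (hM 1) (hM0 1) (hM' 1)
  set N1 : E3 × E3 → E3 := fun z => M 1 (N2 z, l1 z.2) with hN1
  obtain ⟨d1, d2, d3⟩ := slide_step (N := N1) _ l0 c1 c2 c3 (hM 0) (hM0 0) (hM' 0)
  set N0 : E3 × E3 → E3 := fun z => M 0 (N1 z, l0 z.2) with hN0
  have b2' : N2 (p₀, 0) = p₀ := b2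
  have c2' : N1 (p₀, 0) = p₀ := c2
  have d2' : N0 (p₀, 0) = p₀ := d2
  have t3 : Tendsto Prod.fst (nae ((p₀, 0) : E3 × E3)) (nae p₀) := tendsto_fst_nae (p₀, (0 : E3))
  have t2 := slide_tendsto _ b1 b2' b3 (by simp)
  have t1 := slide_tendsto _ c1 c2' c3 (by simp)
  have t0 := slide_tendsto _ d1 d2' d3 (by simp)
  -- the kernel
  let K : E3 × E3 → ℝ := fun z => a 2 z.1 / a 2 (N2 z) * (a 1 (N2 z) / a 1 (N1 z)) *
    (a 0 (N1 z) / a 0 (N0 z))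
  have an : ∀ j (N : E3 × E3 → E3), AnalyticAt ℝ N (p₀, 0) → N (p₀, 0) = p₀ →
      AnalyticAt ℝ (fun z => a j (N z)) (p₀, 0) := fun j N h1 h2 =>
    AnalyticAt.fun_comp (by rw [h2]; exact ha j) h1
  have hK : AnalyticAt ℝ K (p₀, 0) := by
    refine ((AnalyticAt.div (an 2 _ analyticAt_fst rfl) (an 2 _ b1 b2') ?_).mul
      (AnalyticAt.div (an 1 _ b1 b2') (an 1 _ c1 c2') ?_)).mul
      (AnalyticAt.div (an 0 _ c1 c2') (an 0 _ d1 d2') ?_)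
    · rw [b2']; exact ha0 2
    · rw [c2']; exact ha0 1
    · rw [d2']; exact ha0 0
  have anz : ∀ j (N : E3 × E3 → E3), AnalyticAt ℝ N (p₀, 0) → N (p₀, 0) = p₀ →
      ∀ᶠ z in nae ((p₀, 0) : E3 × E3), a j (N z) ≠ 0 := fun j N h1 h2 =>
    nae_le_nhds _ ((an j N h1 h2).continuousAt.eventually_ne (by rw [h2]; exact ha0 j))
  have slide : ∀ j (N : E3 × E3 → E3) (l : E3 →L[ℝ] ℝ), AnalyticAt ℝ N (p₀, 0) → N (p₀, 0) = p₀ →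
      ∀ᶠ z in nae ((p₀, 0) : E3 × E3), (Ψ j (M j (N z, l z.2))).1 = (Ψ j (N z)).1 := by
    intro j N l h1 h2
    apply nae_le_nhds
    have : Tendsto (fun z : E3 × E3 => (N z, l z.2)) (𝓝 (p₀, 0)) (𝓝 (p₀, 0)) := by
      have h3 : ContinuousAt (fun z : E3 × E3 => (N z, l z.2)) (p₀, 0) :=
        h1.continuousAt.prodMk (l.continuous.comp continuous_snd).continuousAt
      have h4 := h3.tendsto
      simpa [h2] using h4
    exact this.eventually (hMΨ j)
  have key : ∀ᶠ z in nae ((p₀, 0) : E3 × E3), g (N0 z) = g z.1 * K z := by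
    filter_upwards [t3.eventually h, t2.eventually h, t1.eventually h, t0.eventually h,
      slide 2 Prod.fst l2 analyticAt_fst rfl, slide 1 N2 l1 b1 b2', slide 0 N1 l0 c1 c2',
      anz 2 _ b1 b2', anz 1 _ c1 c2', anz 0 _ d1 d2'] with z h3 h2 h1 h0 s2 s1 s0 n2 n1 n0
    have e2 : g (N2 z) * a 2 (N2 z) = g z.1 * a 2 z.1 := by
      rw [← h3, ← h2]; exact congrArg _ s2
    have e1 : g (N1 z) * a 1 (N1 z) = g (N2 z) * a 1 (N2 z) := by
      rw [← h1, ← h2]; exact congrArg _ s1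
    have e0 : g (N0 z) * a 0 (N0 z) = g (N1 z) * a 0 (N1 z) := by
      rw [← h0, ← h1]; exact congrArg _ s0
    rw [← eq_div_iff n2] at e2
    rw [← eq_div_iff n1] at e1
    rw [← eq_div_iff n0] at e0
    rw [e0, e1, e2]
    simp only [K]; ring
  -- inverse of (p,t) ↦ (p,q)
  let Ξ : E3 × E3 → E3 × E3 := fun z => (z.1, N0 z)
  have hΞ : AnalyticAt ℝ Ξ (p₀, 0) := analyticAt_fst.prod d1
  have hΞ0 : Ξ (p₀, 0) = (p₀, p₀) := by simp only [Ξ]; rw [d2']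
  obtain ⟨R, hR, hR0, hΞR, -, hRinj⟩ := ift hΞ (by
    rintro ⟨v, t⟩ hv
    have h1 : HasFDerivAt Ξ ((ContinuousLinearMap.fst ℝ E3 E3).prod (fderiv ℝ N0 (p₀, 0)))
      (p₀, 0) := hasFDerivAt_fst.prodMk d1.differentiableAt.hasFDerivAt
    rw [h1.fderiv, ContinuousLinearMap.prod_apply, d3, Prod.mk_eq_zero] at hv
    obtain ⟨h2, h3⟩ := hv
    simp only [ContinuousLinearMap.coe_fst'] at h2
    subst h2
    have : t = 0 := by
      apply hind
      rw [← h3]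
      simp only [l0, l1, l2, ContinuousLinearMap.comp_apply, ContinuousLinearMap.coe_fst',
        ContinuousLinearMap.coe_snd']
      abel
    rw [this]; rfl)
  have tR := tendsto_nae_of_diffeo hR hRinj
  rw [hΞ0] at hR hR0 hΞR tR
  rw [hR0] at tR
  have key2 : ∀ᶠ y in nae ((p₀, p₀) : E3 × E3), g y.2 = g y.1 * K (R y) := by
    filter_upwards [tR.eventually key, nae_le_nhds _ hΞR] with y h1 h2
    have h3 : (R y).1 = y.1 := (congrArg Prod.fst h2 : (Ξ (R y)).1 = y.1)
    have h4 : N0 (R y) = y.2 := (congrArg Prod.snd h2 : (Ξ (R y)).2 = y.2)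
    rw [h3, h4] at h1
    exact h1
  obtain ⟨V, hV, hpV, hfub⟩ := nae_fubini key2
  have hKR : AnalyticAt ℝ (fun y => K (R y)) (p₀, p₀) := AnalyticAt.fun_comp (by rwa [hR0]) hR
  have hev : ∀ᶠ p in nae p₀, AnalyticAt ℝ (fun y => K (R y)) (p, p₀) := by
    apply nae_le_nhds
    have : Tendsto (fun p : E3 => (p, p₀)) (𝓝 p₀) (𝓝 (p₀, p₀)) :=
      (continuous_id.prodMk continuous_const).tendsto p₀
    exact this.eventually hKR.eventually_analyticAt
  obtain ⟨p, hp1, hp2⟩ := (hfub.and hev).exists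
  refine ⟨fun q => g p * K (R (p, q)), ?_, eventually_nae.2 ⟨V, hV, hpV, hp1⟩⟩
  apply analyticAt_const.mul
  exact AnalyticAt.fun_comp (f := fun q : E3 => (p, q)) (g := fun y => K (R y)) hp2
    (analyticAt_const.prod analyticAt_id)

lemma tendsto_Psi {Ψ : E3 → E3} {p₀ : E3} (hΨ : AnalyticAt ℝ Ψ p₀)
    (hinj : ∀ v, fderiv ℝ Ψ p₀ v = 0 → v = 0) :
    Tendsto (fun p => (Ψ p).1) (nae p₀) (nae (Ψ p₀).1) :=
  (tendsto_fst_nae (Ψ p₀)).comp (tendsto_nae_of_diffeo hΨ hinj)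

lemma transfer_Psi {Ψ : E3 → E3} {p₀ : E3} (hΨ : AnalyticAt ℝ Ψ p₀)
    (hinj : ∀ v, fderiv ℝ Ψ p₀ v = 0 → v = 0) {P : Vec2 → Prop}
    (h : ∀ᶠ p in nae p₀, P (Ψ p).1) : ∀ᶠ q in nae (Ψ p₀).1, P q := by
  obtain ⟨g, hg, hg0, hΨg, -, hginj⟩ := ift hΨ hinj
  have t := tendsto_nae_of_diffeo hg hginj
  rw [hg0] at t
  have h1 : ∀ᶠ y in nae (Ψ p₀), P y.1 := by
    filter_upwards [t.eventually h, nae_le_nhds _ hΨg] with y h1 h2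
    rwa [h2] at h1
  have h2 := (tendsto_swap_nae (Ψ p₀).1 (Ψ p₀).2).eventually h1
  obtain ⟨V, hV, hpV, hfub⟩ := nae_fubini h2
  obtain ⟨u, hu⟩ := hfub.exists
  exact eventually_nae.2 ⟨V, hV, hpV, hu⟩

lemma descend {Ψ : E3 → E3} {p₀ : E3} (hΨ : AnalyticAt ℝ Ψ p₀)
    (hinj : ∀ v, fderiv ℝ Ψ p₀ v = 0 → v = 0) {b : E3 → ℝ} (hb : AnalyticAt ℝ b p₀)
    {f : Vec2 → ℝ} (h : ∀ᶠ p in nae p₀, f (Ψ p).1 = b p) :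
    ∃ f' : Vec2 → ℝ, AnalyticAt ℝ f' (Ψ p₀).1 ∧ (∀ᶠ q in nae (Ψ p₀).1, f q = f' q) ∧
      ∀ᶠ p in 𝓝 p₀, f' (Ψ p).1 = b p := by
  obtain ⟨g, hg, hg0, hΨg, -, hginj⟩ := ift hΨ hinj
  have t := tendsto_nae_of_diffeo hg hginj
  rw [hg0] at t
  have h1 : ∀ᶠ y in nae (Ψ p₀), f y.1 = b (g y) := by
    filter_upwards [t.eventually h, nae_le_nhds _ hΨg] with y h1 h2
    rwa [h2] at h1
  have h2 := (tendsto_swap_nae (Ψ p₀).1 (Ψ p₀).2).eventually h1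
  obtain ⟨V, hV, hpV, hfub⟩ := nae_fubini h2
  have hbg : AnalyticAt ℝ (fun y => b (g y)) (Ψ p₀) := AnalyticAt.fun_comp (by rwa [hg0]) hg
  have hev : ∀ᶠ u in nae (Ψ p₀).2, AnalyticAt ℝ (fun y => b (g y)) ((Ψ p₀).1, u) := by
    apply nae_le_nhds
    have : Tendsto (fun u : ℝ => ((Ψ p₀).1, u)) (𝓝 (Ψ p₀).2) (𝓝 (Ψ p₀)) :=
      (continuous_const.prodMk continuous_id).tendsto (Ψ p₀).2
    exact this.eventually hbg.eventually_analyticAt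
  obtain ⟨u, hu, hu2⟩ := (hfub.and hev).exists
  have han : AnalyticAt ℝ (fun q : Vec2 => b (g (q, u))) (Ψ p₀).1 :=
    AnalyticAt.fun_comp (f := fun q : Vec2 => (q, u)) (g := fun y => b (g y)) hu2
      (analyticAt_id.prod analyticAt_const)
  have hae : ∀ᶠ q in nae (Ψ p₀).1, f q = b (g (q, u)) := eventually_nae.2 ⟨V, hV, hpV, hu⟩
  refine ⟨fun q => b (g (q, u)), han, hae, ?_⟩
  apply nae_eq_of_cont
  · filter_upwards [(tendsto_Psi hΨ hinj).eventually hae, h] with p h1 h2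
    rw [← h1, h2]
  · have : AnalyticAt ℝ (fun p => b (g ((Ψ p).1, u))) p₀ :=
      AnalyticAt.fun_comp (f := fun p => (Ψ p).1) (g := fun q : Vec2 => b (g (q, u))) han
        (AnalyticAt.fun_comp (f := Ψ) (g := Prod.fst) analyticAt_fst hΨ)
    exact this.eventually_analyticAt.mono fun x hx => hx.continuousAt
  · exact hb.eventually_analyticAt.mono fun x hx => hx.continuousAt

end reg


section globalF

lemma glue_interval {U V : Set ℝ} (hU : IsOpen U) (hV : IsOpen V) (hUc : OrdConnected U)
    (hVc : OrdConnected V) {f g : ℝ → ℝ} (hf : AnalyticOnNhd ℝ f U) (hg : AnalyticOnNhd ℝ g V)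
    {y : ℝ} (hyU : y ∈ U) (hyV : y ∈ V) (hfg : f =ᶠ[𝓝 y] g) : EqOn f g (U ∩ V) := by
  have hc : IsPreconnected (U ∩ V) := (hUc.inter hVc).isPreconnected
  exact (hf.mono inter_subset_left).eqOn_of_preconnected_of_eventuallyEq
    (hg.mono inter_subset_right) hc ⟨hyU, hyV⟩ hfg

lemma exists_global {X : Type*} [TopologicalSpace X] {S : Set X} (hSo : IsOpen S)
    (hS : IsPreconnected S) {φ h : X → ℝ}
    (hφ : ∀ x ∈ S, Filter.map φ (𝓝 x) = 𝓝 (φ x))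
    (hloc : ∀ x ∈ S, ∃ H : ℝ → ℝ, AnalyticAt ℝ H (φ x) ∧ ∀ᶠ x' in 𝓝 x, h x' = H (φ x')) :
    ∃ F : ℝ → ℝ, AnalyticOnNhd ℝ F (φ '' S) ∧ ∀ x ∈ S, h x = F (φ x) := by
  rcases S.eq_empty_or_nonempty with rfl | ⟨x₀, hx₀⟩
  · exact ⟨0, by simp [AnalyticOnNhd], by simp⟩
  obtain ⟨H₀, hH₀, hH₀h⟩ := hloc x₀ hx₀
  -- local interval versions
  have hinterv : ∀ x ∈ S, ∃ (I : Set ℝ) (H : ℝ → ℝ), IsOpen I ∧ OrdConnected I ∧ φ x ∈ I ∧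
      AnalyticOnNhd ℝ H I ∧ ∀ᶠ x' in 𝓝 x, h x' = H (φ x') := by
    intro x hx
    obtain ⟨H, hH, hh⟩ := hloc x hx
    obtain ⟨ε, hε, hb⟩ := Metric.mem_nhds_iff.1 hH.eventually_analyticAt
    exact ⟨ball (φ x) ε, H, isOpen_ball, by rw [Real.ball_eq_Ioo]; exact ordConnected_Ioo,
      mem_ball_self hε, fun y hy => hb hy, hh⟩
  -- local equality from φ being open
  have hopen : ∀ x ∈ S, ∀ f g : ℝ → ℝ, (∀ᶠ x' in 𝓝 x, h x' = f (φ x')) →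
      (∀ᶠ x' in 𝓝 x, h x' = g (φ x')) → f =ᶠ[𝓝 (φ x)] g := by
    intro x hx f g hf hg
    rw [← hφ x hx]
    show ∀ᶠ y in Filter.map φ (𝓝 x), f y = g y
    rw [Filter.eventually_map]
    filter_upwards [hf, hg] with z h1 h2
    rw [← h1, ← h2]
  let Q : X → Prop := fun x => ∃ (J : Set ℝ) (F : ℝ → ℝ), IsOpen J ∧ OrdConnected J ∧
    φ x₀ ∈ J ∧ φ x ∈ J ∧ AnalyticOnNhd ℝ F J ∧ F =ᶠ[𝓝 (φ x₀)] H₀ ∧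
    ∀ᶠ x' in 𝓝 x, h x' = F (φ x')
  have hQ0 : Q x₀ := by
    obtain ⟨I, H, hI, hIc, hxI, hH, hh⟩ := hinterv x₀ hx₀
    exact ⟨I, H, hI, hIc, hxI, hxI, hH, hopen x₀ hx₀ _ _ hh hH₀h, hh⟩
  have hcont : ∀ x ∈ S, ContinuousAt φ x := fun x hx => (hφ x hx).le
  have hQopen : ∀ x ∈ S, Q x → ∀ᶠ x' in 𝓝 x, Q x' := by
    rintro x hx ⟨J, F, hJ, hJc, h0, h1, hF, hF0, hh⟩
    filter_upwards [hh.eventually_nhds, (hcont x hx).preimage_mem_nhds (hJ.mem_nhds h1)]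
      with x' h2 h3
    exact ⟨J, F, hJ, hJc, h0, h3, hF, hF0, h2⟩
  -- key step: near every point of S, Q at one nearby point gives Q at x
  have hstep : ∀ x ∈ S, ∃ N ∈ 𝓝 x, ∀ z ∈ N, z ∈ S → Q z → Q x := by
    intro x hx
    obtain ⟨I, H, hI, hIc, hxI, hH, hh⟩ := hinterv x hx
    refine ⟨_, Filter.inter_mem hh.eventually_nhds
      ((hcont x hx).preimage_mem_nhds (hI.mem_nhds hxI)), ?_⟩
    rintro z ⟨hz1, hz2⟩ hzS ⟨J, F, hJ, hJc, h0, h1, hF, hF0, hhF⟩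
    have hloc : F =ᶠ[𝓝 (φ z)] H := hopen z hzS _ _ hhF hz1
    have heq := glue_interval hJ hI hJc hIc hF hH h1 hz2 hloc
    classical
    let F' : ℝ → ℝ := fun y => if y ∈ J then F y else H y
    have hF'J : EqOn F' F J := fun y hy => by simp [F', hy]
    have hF'I : EqOn F' H I := fun y hy => by
      by_cases hyJ : y ∈ J
      · simp only [F', hyJ, if_true]; exact heq ⟨hyJ, hy⟩
      · simp [F', hyJ]
    refine ⟨J ∪ I, F', hJ.union hI, ?_, Or.inl h0, Or.inr hxI, ?_, ?_, ?_⟩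
    · exact (IsPreconnected.union (φ z) h1 hz2 hJc.isPreconnected hIc.isPreconnected).ordConnected
    · rintro y (hy | hy)
      · exact (hF y hy).congr (Filter.eventuallyEq_of_mem (hJ.mem_nhds hy) hF'J.symm)
      · exact (hH y hy).congr (Filter.eventuallyEq_of_mem (hI.mem_nhds hy) hF'I.symm)
    · exact (Filter.eventuallyEq_of_mem (hJ.mem_nhds h0) hF'J).trans hF0
    · filter_upwards [hh, (hcont x hx).preimage_mem_nhds (hI.mem_nhds hxI)] with x' h2 h3
      rw [h2, hF'I h3]
  have hall : ∀ x ∈ S, Q x := by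
    have hsub : S ⊆ {x | Q x} := by
      have hu : IsOpen {x | x ∈ S ∧ Q x} := by
        rw [isOpen_iff_mem_nhds]
        rintro x ⟨hx, hxQ⟩
        filter_upwards [hSo.mem_nhds hx, hQopen x hx hxQ] with y h1 h2 using ⟨h1, h2⟩
      have hv : IsOpen {x | x ∈ S ∧ ¬ Q x} := by
        rw [isOpen_iff_mem_nhds]
        rintro x ⟨hx, hxQ⟩
        obtain ⟨N, hN, h⟩ := hstep x hx
        filter_upwards [hSo.mem_nhds hx, hN] with y h1 h2
        exact ⟨h1, fun hq => hxQ (h y h2 h1 hq)⟩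
      have := hS.subset_left_of_subset_union hu hv
        (by rw [Set.disjoint_left]; rintro x ⟨_, h1⟩ ⟨_, h2⟩; exact h2 h1)
        (fun x hx => by by_cases hq : Q x; exacts [Or.inl ⟨hx, hq⟩, Or.inr ⟨hx, hq⟩])
        ⟨x₀, hx₀, hx₀, hQ0⟩
      exact fun x hx => (this hx).2
    exact hsub
  choose! J F hJ hJc h0 h1 hF hF0 hh using hall
  have hagree : ∀ x ∈ S, ∀ x' ∈ S, EqOn (F x) (F x') (J x ∩ J x') := fun x hx x' hx' =>
    glue_interval (hJ x hx) (hJ x' hx') (hJc x hx) (hJc x' hx') (hF x hx) (hF x' hx') (h0 x hx)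
      (h0 x' hx') ((hF0 x hx).trans (hF0 x' hx').symm)
  classical
  let G : ℝ → ℝ := fun y => if hy : ∃ x ∈ S, φ x = y then F hy.choose y else 0
  have hG : ∀ x ∈ S, ∀ x' ∈ S, φ x' ∈ J x → G (φ x') = F x (φ x') := by
    intro x hx x' hx' hJx
    have hy : ∃ z ∈ S, φ z = φ x' := ⟨x', hx', rfl⟩
    simp only [G, dif_pos hy]
    obtain ⟨hc1, hc2⟩ := hy.choose_spec
    have hm := h1 _ hc1
    generalize hy.choose = z at hc1 hc2 hm ⊢
    rw [hc2] at hm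
    exact hagree _ hc1 x hx ⟨hm, hJx⟩
  refine ⟨G, ?_, ?_⟩
  · rintro _ ⟨x, hx, rfl⟩
    refine (hF x hx (φ x) (h1 x hx)).congr ?_
    show ∀ᶠ y in 𝓝 (φ x), F x y = G y
    rw [← hφ x hx, Filter.eventually_map]
    filter_upwards [hSo.mem_nhds hx, (hcont x hx).preimage_mem_nhds ((hJ x hx).mem_nhds (h1 x hx))]
      with z h2 h3
    exact (hG x hx z h2 h3).symm
  · intro x hx
    rw [hG x hx x hx (h1 x hx)]
    exact (hh x hx).self_of_nhds

end globalF


section concrete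

def Pder (φ : Vec2 → ℝ) (x : Vec2) : ℝ := fderiv ℝ φ x ((1, 0) : Vec2)
def vv (φ : Vec2 → ℝ) (x : Vec2) : Vec2 := (1, -Pder φ x / Dder φ x)
def bb (φ : Vec2 → ℝ) (x : Vec2) : ℝ := fderiv ℝ (Dder φ) x (vv φ x) / Dder φ x
def Ww (φ : Vec2 → ℝ) (p : E3) : E3 := (vv φ p.1, -p.2 * bb φ p.1)
def PsiM (φ : Vec2 → ℝ) (p : E3) : E3 := (Φmap φ p, p.1.1)
def Amat (ψ : Fin 3 → Vec2 → ℝ) (x : Vec2) : Matrix (Fin 3) (Fin 3) ℝ :=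
  Matrix.of fun j => ![1, (vv (ψ j) x).2, - bb (ψ j) x]

lemma fderiv_decomp (L : Vec2 →L[ℝ] ℝ) (u : Vec2) : L u = u.1 * L (1, 0) + u.2 * L (0, 1) := by
  have : u = u.1 • ((1, 0) : Vec2) + u.2 • ((0, 1) : Vec2) := by ext <;> simp
  calc L u = L (u.1 • ((1, 0) : Vec2) + u.2 • ((0, 1) : Vec2)) := congrArg L this
    _ = _ := by rw [map_add, map_smul, map_smul, smul_eq_mul, smul_eq_mul]

lemma analyticAt_Dder {φ : Vec2 → ℝ} {x : Vec2} (h : AnalyticAt ℝ φ x) :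
    AnalyticAt ℝ (Dder φ) x := by
  exact ((ContinuousLinearMap.apply ℝ ℝ ((0, 1) : Vec2)).analyticAt _).fun_comp h.fderiv

lemma analyticAt_Pder {φ : Vec2 → ℝ} {x : Vec2} (h : AnalyticAt ℝ φ x) :
    AnalyticAt ℝ (Pder φ) x := by
  exact ((ContinuousLinearMap.apply ℝ ℝ ((1, 0) : Vec2)).analyticAt _).fun_comp h.fderiv

lemma analyticAt_vv {φ : Vec2 → ℝ} {x : Vec2} (h : AnalyticAt ℝ φ x) (hQ : Dder φ x ≠ 0) :
    AnalyticAt ℝ (vv φ) x :=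
  analyticAt_const.prod ((analyticAt_Pder h).neg.div (analyticAt_Dder h) hQ)

lemma analyticAt_fderiv_vv {φ g : Vec2 → ℝ} {x : Vec2} (h : AnalyticAt ℝ φ x) (hQ : Dder φ x ≠ 0)
    (hg : AnalyticAt ℝ g x) : AnalyticAt ℝ (fun x => fderiv ℝ g x (vv φ x)) x := by
  have h1 : (fun x => fderiv ℝ g x (vv φ x)) =
      fun x => (vv φ x).1 * Pder g x + (vv φ x).2 * Dder g x := by
    ext y; exact fderiv_decomp _ _
  rw [h1]
  have h2 := analyticAt_vv h hQ
  exact ((analyticAt_fst.fun_comp h2).mul (analyticAt_Pder hg)).add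
    ((analyticAt_snd.fun_comp h2).mul (analyticAt_Dder hg))

lemma analyticAt_bb {φ : Vec2 → ℝ} {x : Vec2} (h : AnalyticAt ℝ φ x) (hQ : Dder φ x ≠ 0) :
    AnalyticAt ℝ (bb φ) x :=
  (analyticAt_fderiv_vv h hQ (analyticAt_Dder h)).div (analyticAt_Dder h) hQ

lemma fst_an {g : Vec2 → ℝ} {p : E3} (h : AnalyticAt ℝ g p.1) :
    AnalyticAt ℝ (fun p : E3 => g p.1) p :=
  AnalyticAt.fun_comp (f := Prod.fst) h analyticAt_fst

lemma analyticAt_Phi {φ : Vec2 → ℝ} {p : E3} (h : AnalyticAt ℝ φ p.1) :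
    AnalyticAt ℝ (Φmap φ) p :=
  (fst_an h).prod (analyticAt_snd.mul (fst_an (analyticAt_Dder h)))

lemma analyticAt_PsiM {φ : Vec2 → ℝ} {p : E3} (h : AnalyticAt ℝ φ p.1) :
    AnalyticAt ℝ (PsiM φ) p :=
  (analyticAt_Phi h).prod (analyticAt_fst.fun_comp analyticAt_fst)

lemma fderiv_fst_comp {g : Vec2 → ℝ} {p : E3} (h : AnalyticAt ℝ g p.1) :
    HasFDerivAt (fun p : E3 => g p.1) ((fderiv ℝ g p.1).comp (ContinuousLinearMap.fst ℝ Vec2 ℝ)) p :=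
  HasFDerivAt.comp (g := g) (f := Prod.fst) p h.differentiableAt.hasFDerivAt hasFDerivAt_fst

lemma fderiv_Phi {φ : Vec2 → ℝ} {p : E3} (h : AnalyticAt ℝ φ p.1) (w : E3) :
    fderiv ℝ (Φmap φ) p w = (fderiv ℝ φ p.1 w.1,
      p.2 * fderiv ℝ (Dder φ) p.1 w.1 + w.2 * Dder φ p.1) := by
  have h1 := (fderiv_fst_comp h).prodMk
    ((hasFDerivAt_snd (𝕜 := ℝ) (p := p)).mul (fderiv_fst_comp (analyticAt_Dder h)))
  have h2 : HasFDerivAt (Φmap φ) _ p := h1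
  rw [h2.fderiv]
  simp [mul_comm]

lemma fderiv_PsiM {φ : Vec2 → ℝ} {p : E3} (h : AnalyticAt ℝ φ p.1) (w : E3) :
    fderiv ℝ (PsiM φ) p w = (fderiv ℝ (Φmap φ) p w, w.1.1) := by
  have h1 : HasFDerivAt (PsiM φ) ((fderiv ℝ (Φmap φ) p).prod
      ((ContinuousLinearMap.fst ℝ ℝ ℝ).comp (ContinuousLinearMap.fst ℝ Vec2 ℝ))) p :=
    (analyticAt_Phi h).differentiableAt.hasFDerivAt.prodMk
      ((ContinuousLinearMap.fst ℝ ℝ ℝ).comp (ContinuousLinearMap.fst ℝ Vec2 ℝ)).hasFDerivAt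
  rw [h1.fderiv]; rfl

lemma fderiv_vv {φ : Vec2 → ℝ} {x : Vec2} (hQ : Dder φ x ≠ 0) : fderiv ℝ φ x (vv φ x) = 0 := by
  rw [fderiv_decomp]
  show 1 * Pder φ x + (-Pder φ x / Dder φ x) * Dder φ x = 0
  field_simp; ring

lemma fderiv_Phi_Ww {φ : Vec2 → ℝ} {p : E3} (h : AnalyticAt ℝ φ p.1) (hQ : Dder φ p.1 ≠ 0) :
    fderiv ℝ (Φmap φ) p (Ww φ p) = 0 := by
  rw [fderiv_Phi h]
  simp only [Ww, fderiv_vv hQ, bb]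
  ext
  · rfl
  · simp; field_simp; ring

lemma fderiv_PsiM_Ww {φ : Vec2 → ℝ} {p : E3} (h : AnalyticAt ℝ φ p.1) (hQ : Dder φ p.1 ≠ 0) :
    fderiv ℝ (PsiM φ) p (Ww φ p) = (0, 1) := by
  rw [fderiv_PsiM h, fderiv_Phi_Ww h hQ]; rfl

lemma PsiM_inj {φ : Vec2 → ℝ} {p : E3} (h : AnalyticAt ℝ φ p.1) (hQ : Dder φ p.1 ≠ 0) (w : E3)
    (hw : fderiv ℝ (PsiM φ) p w = 0) : w = 0 := by
  rw [fderiv_PsiM h, fderiv_Phi h] at hw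
  simp only [Prod.mk_eq_zero] at hw
  obtain ⟨⟨h1, h2⟩, h3⟩ := hw
  rw [fderiv_decomp, h3] at h1
  have h4 : w.1.2 = 0 := by
    have : w.1.2 * Dder φ p.1 = 0 := by
      rw [zero_mul, zero_add] at h1; exact h1
    exact (mul_eq_zero.1 this).resolve_right hQ
  have h5 : w.1 = 0 := Prod.ext h3 h4
  rw [h5] at h2
  have h6 : w.2 = 0 := by
    have : w.2 * Dder φ p.1 = 0 := by simpa using h2
    exact (mul_eq_zero.1 this).resolve_right hQ
  exact Prod.ext h5 h6

lemma Ww_indep {ψ : Fin 3 → Vec2 → ℝ} {p : E3} (hp : 0 < p.2) (hdet : (Amat ψ p.1).det ≠ 0)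
    (c : E3) (hc : c.1.1 • Ww (ψ 0) p + c.1.2 • Ww (ψ 1) p + c.2 • Ww (ψ 2) p = 0) : c = 0 := by
  by_contra hne
  apply hdet
  rw [← Matrix.exists_vecMul_eq_zero_iff]
  refine ⟨![c.1.1, c.1.2, c.2], ?_, ?_⟩
  · intro h
    apply hne
    have h0 := congrFun h 0
    have h1 := congrFun h 1
    have h2 := congrFun h 2
    simp at h0 h1 h2
    exact Prod.ext (Prod.ext h0 h1) h2
  · have h0 := congrArg (fun z : E3 => z.1.1) hc
    have h1 := congrArg (fun z : E3 => z.1.2) hc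
    have h2 := congrArg (fun z : E3 => z.2) hc
    simp [Ww, vv] at h0 h1 h2
    ext i
    fin_cases i
    · simp [Matrix.vecMul, dotProduct, Fin.sum_univ_three, Amat]; linarith
    · simp [Matrix.vecMul, dotProduct, Fin.sum_univ_three, Amat, vv]; linarith
    · simp [Matrix.vecMul, dotProduct, Fin.sum_univ_three, Amat]
      have h3 : p.2 * (c.1.1 * bb (ψ 0) p.1 + c.1.2 * bb (ψ 1) p.1 + c.2 * bb (ψ 2) p.1) = 0 := by
        linarith
      have h4 := (mul_eq_zero.1 h3).resolve_left hp.ne'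
      linarith

lemma exists_theta {B : Set Vec2} {ψ a : Fin 3 → Vec2 → ℝ}
    (hψ : ∀ j, ∀ x ∈ B, AnalyticAt ℝ (ψ j) x) (hQ : ∀ j, ∀ x ∈ B, Dder (ψ j) x ≠ 0)
    (ha : ∀ j, ∀ x ∈ B, AnalyticAt ℝ (a j) x) (ha0 : ∀ j, ∀ x ∈ B, a j x ≠ 0)
    (hdet : ∀ x ∈ B, (Amat ψ x).det ≠ 0) :
    ∃ (n : Vec2 → Vec2 →L[ℝ] ℝ) (m : Vec2 → ℝ), AnalyticOnNhd ℝ n B ∧ AnalyticOnNhd ℝ m B ∧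
      ∀ x ∈ B, ∀ (α : Vec2 →L[ℝ] ℝ) (γ c : ℝ),
        (∀ j, (α (vv (ψ j) x) - γ * bb (ψ j) x) * a j x + c * fderiv ℝ (a j) x (vv (ψ j) x) = 0) →
        α = c • n x ∧ γ = c * m x := by
  let r : Vec2 → Fin 3 → ℝ := fun x j => - fderiv ℝ (a j) x (vv (ψ j) x) / a j x
  let N : Vec2 → Fin 3 → ℝ := fun x => (Amat ψ x)⁻¹.mulVec (r x)
  have hr : ∀ j, ∀ x ∈ B, AnalyticAt ℝ (fun x => r x j) x := fun j x hx =>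
    (analyticAt_fderiv_vv (hψ j x hx) (hQ j x hx) (ha j x hx)).neg.div (ha j x hx) (ha0 j x hx)
  have hA : ∀ i j, ∀ x ∈ B, AnalyticAt ℝ (fun x => Amat ψ x i j) x := by
    intro i j x hx
    fin_cases j
    · exact analyticAt_const
    · exact analyticAt_snd.fun_comp (analyticAt_vv (hψ i x hx) (hQ i x hx))
    · exact (analyticAt_bb (hψ i x hx) (hQ i x hx)).neg
  have hdetan : ∀ M : Vec2 → Matrix (Fin 3) (Fin 3) ℝ, ∀ x,
      (∀ i j, AnalyticAt ℝ (fun x => M x i j) x) → AnalyticAt ℝ (fun x => (M x).det) x := by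
    intro M x hM
    simp only [Matrix.det_fin_three]
    have := hM 0 0; have := hM 0 1; have := hM 0 2
    have := hM 1 0; have := hM 1 1; have := hM 1 2
    have := hM 2 0; have := hM 2 1; have := hM 2 2
    fun_prop
  have hN : ∀ i, ∀ x ∈ B, AnalyticAt ℝ (fun x => N x i) x := by
    intro i x hx
    have : (fun x => N x i) = fun x => (Amat ψ x).det⁻¹ * ((Amat ψ x).updateCol i (r x)).det := by
      ext y
      simp only [N, Matrix.inv_def, Matrix.smul_mulVec, Ring.inverse_eq_inv']
      rw [← Matrix.cramer_eq_adjugate_mulVec]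
      simp [Matrix.cramer_apply]
    rw [this]
    refine ((hdetan _ x fun i j => hA i j x hx).inv (hdet x hx)).mul (hdetan _ x ?_)
    intro k j
    simp only [Matrix.updateCol_apply]
    split_ifs
    · exact hr k x hx
    · exact hA k j x hx
  refine ⟨fun x => N x 0 • ContinuousLinearMap.fst ℝ ℝ ℝ + N x 1 • ContinuousLinearMap.snd ℝ ℝ ℝ,
    fun x => N x 2, ?_, fun x hx => hN 2 x hx, ?_⟩
  · intro x hx
    exact ((hN 0 x hx).smul analyticAt_const).add ((hN 1 x hx).smul analyticAt_const)
  · intro x hx α γ c h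
    have h1 : (Amat ψ x).mulVec ![α (1, 0), α (0, 1), γ] = c • r x := by
      ext j
      have h2 := h j
      rw [fderiv_decomp α] at h2
      have h3 := ha0 j x hx
      have hv1 : (vv (ψ j) x).1 = 1 := rfl
      rw [hv1] at h2
      have h6 : r x j * a j x = - fderiv ℝ (a j) x (vv (ψ j) x) := div_mul_cancel₀ _ h3
      have h7 : (Amat ψ x).mulVec ![α (1, 0), α (0, 1), γ] j =
          1 * α (1, 0) + (vv (ψ j) x).2 * α (0, 1) + - bb (ψ j) x * γ := by
        simp only [Matrix.mulVec, dotProduct, Fin.sum_univ_three, Amat, Matrix.of_apply,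
          Matrix.cons_val]
      rw [h7, Pi.smul_apply, smul_eq_mul]
      apply mul_right_cancel₀ h3
      linear_combination h2 - c * h6
    have h4 : ![α (1, 0), α (0, 1), γ] = c • N x := by
      have h5 := congrArg (fun v => (Amat ψ x)⁻¹.mulVec v) h1
      simp only [Matrix.mulVec_mulVec, Matrix.mulVec_smul] at h5
      rw [Matrix.nonsing_inv_mul _ (isUnit_iff_ne_zero.2 (hdet x hx)), Matrix.one_mulVec] at h5
      exact h5
    have e0 := congrFun h4 0
    have e1 := congrFun h4 1
    have e2 := congrFun h4 2
    simp at e0 e1 e2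
    refine ⟨?_, e2⟩
    ext
    · simp [e0]
    · simp [e1]

end concrete


section solution

lemma local_solution {ψ a : Fin 3 → Vec2 → ℝ} {p₀ : E3}
    (hψ : ∀ j, AnalyticAt ℝ (ψ j) p₀.1) (hQ : ∀ j, Dder (ψ j) p₀.1 ≠ 0)
    (ha : ∀ j, AnalyticAt ℝ (a j) p₀.1) (ha0 : ∀ j, a j p₀.1 ≠ 0)
    (hdet : (Amat ψ p₀.1).det ≠ 0) (hs : 0 < p₀.2) {f : Fin 3 → Vec2 → ℝ} {g : E3 → ℝ}
    (h : ∀ᶠ p in nae p₀, ∀ j, f j (Φmap (ψ j) p) = g p * a j p.1) :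
    ∃ (G : E3 → ℝ) (f' : Fin 3 → Vec2 → ℝ), AnalyticAt ℝ G p₀ ∧
      (∀ j, AnalyticAt ℝ (f' j) (Φmap (ψ j) p₀)) ∧
      (∀ᶠ p in nae p₀, ∀ j, f j (Φmap (ψ j) p) = G p * a j p.1) ∧
      (∀ j, ∀ᶠ p in 𝓝 p₀, f' j (Φmap (ψ j) p) = G p * a j p.1) := by
  obtain ⟨G, hG, hgG⟩ := regularity (Ψ := fun j => PsiM (ψ j)) (a := fun j p => a j p.1)
    (w := fun j => Ww (ψ j) p₀) (fun j => analyticAt_PsiM (hψ j))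
    (fun j v => PsiM_inj (hψ j) (hQ j) v) (fun j => fderiv_PsiM_Ww (hψ j) (hQ j))
    (fun c => Ww_indep hs hdet c) (fun j => fst_an (ha j)) ha0 h
  have h1 : ∀ᶠ p in nae p₀, ∀ j, f j (Φmap (ψ j) p) = G p * a j p.1 := by
    filter_upwards [h, hgG] with p h1 h2 j
    rw [h1, h2]
  choose f' hf' _ hf'2 using fun j => descend (analyticAt_PsiM (hψ j))
    (fun v => PsiM_inj (hψ j) (hQ j) v) (hG.mul (fst_an (ha j)))
    (f := f j) (h1.mono fun p hp => hp j)
  exact ⟨G, f', hG, hf', h1, hf'2⟩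

def thet (n : Vec2 → Vec2 →L[ℝ] ℝ) (m : Vec2 → ℝ) (p : E3) : E3 →L[ℝ] ℝ :=
  (n p.1).comp (ContinuousLinearMap.fst ℝ Vec2 ℝ) + (m p.1 / p.2) • ContinuousLinearMap.snd ℝ Vec2 ℝ

lemma deriv_G {B : Set Vec2} (hB : IsOpen B) {ψ a : Fin 3 → Vec2 → ℝ}
    (hψ : ∀ j, ∀ x ∈ B, AnalyticAt ℝ (ψ j) x) (hQ : ∀ j, ∀ x ∈ B, Dder (ψ j) x ≠ 0)
    (ha : ∀ j, ∀ x ∈ B, AnalyticAt ℝ (a j) x)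
    {n : Vec2 → Vec2 →L[ℝ] ℝ} {m : Vec2 → ℝ}
    (hnm : ∀ x ∈ B, ∀ (α : Vec2 →L[ℝ] ℝ) (γ c : ℝ),
        (∀ j, (α (vv (ψ j) x) - γ * bb (ψ j) x) * a j x + c * fderiv ℝ (a j) x (vv (ψ j) x) = 0) →
        α = c • n x ∧ γ = c * m x)
    {p₀ : E3} (hp : p₀.1 ∈ B) (hs : 0 < p₀.2) {G : E3 → ℝ} {f' : Fin 3 → Vec2 → ℝ}
    (hG : AnalyticAt ℝ G p₀) (hf' : ∀ j, AnalyticAt ℝ (f' j) (Φmap (ψ j) p₀))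
    (h : ∀ j, ∀ᶠ p in 𝓝 p₀, f' j (Φmap (ψ j) p) = G p * a j p.1) :
    ∀ᶠ p in 𝓝 p₀, HasFDerivAt G (G p • thet n m p) p := by
  have h1 : ∀ᶠ p in 𝓝 p₀, ∀ j, AnalyticAt ℝ (f' j) (Φmap (ψ j) p) := by
    rw [eventually_all]
    intro j
    exact (analyticAt_Phi (hψ j _ hp)).continuousAt.eventually (hf' j).eventually_analyticAt
  have h2 : ∀ᶠ p in 𝓝 p₀, ∀ j, ∀ᶠ p in 𝓝 p, f' j (Φmap (ψ j) p) = G p * a j p.1 := by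
    rw [eventually_all]
    intro j
    exact (h j).eventually_nhds
  have h3 : ∀ᶠ p : E3 in 𝓝 p₀, p.1 ∈ B := continuousAt_fst.eventually (hB.mem_nhds hp)
  have h4 : ∀ᶠ p : E3 in 𝓝 p₀, 0 < p.2 := continuousAt_snd.eventually (lt_mem_nhds hs)
  filter_upwards [h1, h2, h3, h4, hG.eventually_analyticAt] with p h1 h2 h3 h4 h5
  have h6 := h5.differentiableAt.hasFDerivAt
  have h7 := hnm p.1 h3 ((fderiv ℝ G p).comp (ContinuousLinearMap.inl ℝ Vec2 ℝ))
    (p.2 * fderiv ℝ G p (0, 1)) (G p) (by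
      intro j
      have e1 : HasFDerivAt (fun p => f' j (Φmap (ψ j) p))
          ((fderiv ℝ (f' j) (Φmap (ψ j) p)).comp (fderiv ℝ (Φmap (ψ j)) p)) p :=
        (h1 j).differentiableAt.hasFDerivAt.comp p
          (analyticAt_Phi (hψ j _ h3)).differentiableAt.hasFDerivAt
      have e2 := h6.mul (fderiv_fst_comp (ha j _ h3))
      have e3 := (e1.congr_of_eventuallyEq (Filter.EventuallyEq.symm (h2 j))).unique e2
      have e4 := DFunLike.congr_fun e3 (Ww (ψ j) p)
      rw [ContinuousLinearMap.comp_apply, fderiv_Phi_Ww (hψ j _ h3) (hQ j _ h3)] at e4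
      have e5 : Ww (ψ j) p = (vv (ψ j) p.1, 0) + (-p.2 * bb (ψ j) p.1) • ((0, 1) : E3) := by
        ext <;> simp [Ww]
      have e6 : fderiv ℝ G p (Ww (ψ j) p) = fderiv ℝ G p (vv (ψ j) p.1, 0)
          + (-p.2 * bb (ψ j) p.1) * fderiv ℝ G p (0, 1) := by
        rw [e5, map_add, map_smul, smul_eq_mul]
      simp [e6] at e4
      simp
      have e7 : (Ww (ψ j) p).1 = vv (ψ j) p.1 := rfl
      rw [e7] at e4
      linear_combination -e4)
  have h8 : fderiv ℝ G p = G p • thet n m p := by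
    obtain ⟨e1, e2⟩ := h7
    refine ContinuousLinearMap.ext fun v => ?_
    have e3 : v = (v.1, 0) + v.2 • ((0, 1) : E3) := by ext <;> simp
    have e4 := DFunLike.congr_fun e1 v.1
    simp at e4
    have e5 : fderiv ℝ G p v = fderiv ℝ G p (v.1, 0) + v.2 * fderiv ℝ G p (0, 1) := by
      conv_lhs => rw [e3]
      rw [map_add, map_smul, smul_eq_mul]
    rw [e5, e4]
    have e6 : fderiv ℝ G p (0, 1) = G p * (m p.1 / p.2) := by
      field_simp
      linarith
    rw [e6]
    simp [thet]
    ring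
  rwa [h8] at h6

end solution

section symm

lemma thet_apply (n : Vec2 → Vec2 →L[ℝ] ℝ) (m : Vec2 → ℝ) (p w : E3) :
    thet n m p w = n p.1 w.1 + m p.1 / p.2 * w.2 := by
  simp [thet]

lemma analyticAt_thet {n : Vec2 → Vec2 →L[ℝ] ℝ} {m : Vec2 → ℝ} {p : E3}
    (hn : AnalyticAt ℝ n p.1) (hm : AnalyticAt ℝ m p.1) (hs : p.2 ≠ 0) :
    AnalyticAt ℝ (thet n m) p := by
  have h1 : AnalyticAt ℝ (fun p : E3 => n p.1) p :=
    AnalyticAt.fun_comp (f := Prod.fst) hn analyticAt_fst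
  have h2 : AnalyticAt ℝ (fun p : E3 => (n p.1).comp (ContinuousLinearMap.fst ℝ Vec2 ℝ)) p :=
    (((ContinuousLinearMap.compL ℝ E3 Vec2 ℝ).flip
      (ContinuousLinearMap.fst ℝ Vec2 ℝ)).analyticAt _).fun_comp h1
  exact h2.add (((fst_an hm).div analyticAt_snd hs).smul analyticAt_const)

lemma fderiv_thet {n : Vec2 → Vec2 →L[ℝ] ℝ} {m : Vec2 → ℝ} {p : E3}
    (hn : AnalyticAt ℝ n p.1) (hm : AnalyticAt ℝ m p.1) (hs : p.2 ≠ 0) (u : Vec2) (w : E3) :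
    fderiv ℝ (thet n m) p (u, 0) w = fderiv ℝ n p.1 u w.1 + fderiv ℝ m p.1 u / p.2 * w.2 := by
  have h1 := (analyticAt_thet hn hm hs).differentiableAt.hasFDerivAt
  have h2 : HasDerivAt (fun t : ℝ => thet n m (p + t • (u, 0)) w)
      (fderiv ℝ (thet n m) p (u, 0) w) 0 := by
    have := h1.hasLineDerivAt (u, 0)
    exact ((ContinuousLinearMap.apply ℝ ℝ w).hasFDerivAt.comp_hasDerivAt (0 : ℝ) this)
  have h3 : HasDerivAt (fun t : ℝ => n (p.1 + t • u) w.1) (fderiv ℝ n p.1 u w.1) 0 := by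
    have := hn.differentiableAt.hasFDerivAt.hasLineDerivAt u
    exact ((ContinuousLinearMap.apply ℝ ℝ w.1).hasFDerivAt.comp_hasDerivAt (0 : ℝ) this)
  have h4 : HasDerivAt (fun t : ℝ => m (p.1 + t • u)) (fderiv ℝ m p.1 u) 0 :=
    hm.differentiableAt.hasFDerivAt.hasLineDerivAt u
  have h5 := h3.add ((h4.div_const p.2).mul_const w.2)
  refine h2.unique (h5.congr_of_eventuallyEq (Eventually.of_forall fun t => ?_))
  simp [thet_apply]

lemma symm_of_G {n : Vec2 → Vec2 →L[ℝ] ℝ} {m : Vec2 → ℝ} {p₀ : E3}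
    (hn : AnalyticAt ℝ n p₀.1) (hm : AnalyticAt ℝ m p₀.1) (hs : p₀.2 ≠ 0) {G : E3 → ℝ}
    (h0 : G p₀ ≠ 0) (hG : ∀ᶠ p in 𝓝 p₀, HasFDerivAt G (G p • thet n m p) p) :
    ∀ᶠ x in 𝓝 p₀.1, fderiv ℝ m x = 0 ∧ ∀ u v, fderiv ℝ n x u v = fderiv ℝ n x v u := by
  have hc : ContinuousAt G p₀ := hG.self_of_nhds.continuousAt
  have h1 : ∀ᶠ p in 𝓝 p₀, HasFDerivAt (fun p => Real.log (G p)) (thet n m p) p := by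
    filter_upwards [hG, hc.eventually_ne h0] with p h1 h2
    have := h1.log h2
    rwa [smul_smul, inv_mul_cancel₀ h2, one_smul] at this
  have h2 : ∀ᶠ p in 𝓝 p₀, fderiv ℝ m p.1 = 0 ∧
      ∀ u v, fderiv ℝ n p.1 u v = fderiv ℝ n p.1 v u := by
    filter_upwards [h1.eventually_nhds,
      (continuousAt_fst (p := p₀)).eventually hn.eventually_analyticAt,
      (continuousAt_fst (p := p₀)).eventually hm.eventually_analyticAt,
      continuousAt_snd.eventually_ne hs] with p h2 hn hm hs
    have h3 := second_derivative_symmetric_of_eventually h2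
      (analyticAt_thet hn hm hs).differentiableAt.hasFDerivAt
    have h5 : ∀ u v, fderiv ℝ n p.1 u v = fderiv ℝ n p.1 v u := by
      intro u v
      have := h3 (u, 0) (v, 0)
      rw [fderiv_thet hn hm hs, fderiv_thet hn hm hs] at this
      simpa using this
    refine ⟨?_, h5⟩
    refine ContinuousLinearMap.ext fun u => ?_
    have h4 := h3 (u, 0) (0, 1)
    rw [fderiv_thet hn hm hs] at h4
    have h6 : fderiv ℝ (thet n m) p (0, 1) (u, 0) = 0 := by
      have h1 := (analyticAt_thet hn hm hs).differentiableAt.hasFDerivAt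
      have h2 : HasDerivAt (fun t : ℝ => thet n m (p + t • (0, 1)) (u, 0))
          (fderiv ℝ (thet n m) p (0, 1) (u, 0)) 0 := by
        have := h1.hasLineDerivAt (0, 1)
        exact ((ContinuousLinearMap.apply ℝ ℝ ((u, 0) : E3)).hasFDerivAt.comp_hasDerivAt
          (0 : ℝ) this)
      refine h2.unique ((hasDerivAt_const (0 : ℝ) (n p.1 u)).congr_of_eventuallyEq
        (Eventually.of_forall fun t => ?_))
      simp [thet_apply]
    rw [h6] at h4
    simpa [hs] using h4
  have h3 : ∀ᶠ x in 𝓝 p₀.1, ∀ᶠ s in 𝓝 p₀.2, fderiv ℝ m x = 0 ∧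
      ∀ u v, fderiv ℝ n x u v = fderiv ℝ n x v u := by
    rw [nhds_prod_eq] at h2
    exact h2.curry
  exact h3.mono fun x hx => hx.self_of_nhds

lemma global_symm {B : Set Vec2} (hB : IsOpen B) (hBc : Convex ℝ B)
    {n : Vec2 → Vec2 →L[ℝ] ℝ} {m : Vec2 → ℝ}
    (hn : AnalyticOnNhd ℝ n B) (hm : AnalyticOnNhd ℝ m B) {x₁ : Vec2} (hx₁ : x₁ ∈ B)
    (h : ∀ᶠ x in 𝓝 x₁, fderiv ℝ m x = 0 ∧ ∀ u v, fderiv ℝ n x u v = fderiv ℝ n x v u) :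
    (∃ σ : ℝ, ∀ x ∈ B, m x = σ) ∧ ∃ ℓ : Vec2 → ℝ, ∀ x ∈ B, HasFDerivAt ℓ (n x) x := by
  have hpre := hBc.isPreconnected
  constructor
  · refine ⟨m x₁, fun x hx => ?_⟩
    have h1 : EqOn (fderiv ℝ m) 0 B := hm.fderiv.eqOn_of_preconnected_of_eventuallyEq
      (fun _ _ => analyticAt_const) hpre hx₁ (h.mono fun x hx => hx.1)
    exact hBc.is_const_of_fderivWithin_eq_zero (𝕜 := ℝ)
      (fun y hy => (hm y hy).differentiableAt.differentiableWithinAt)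
      (fun y hy => by rw [fderivWithin_of_isOpen hB hy]; exact h1 hy) hx hx₁
  · have hs : ∀ u v, ∀ x ∈ B, fderiv ℝ n x u v = fderiv ℝ n x v u := by
      intro u v
      have han : ∀ u v : Vec2, AnalyticOnNhd ℝ (fun x => fderiv ℝ n x u v) B := by
        intro u v x hx
        have h1 : AnalyticAt ℝ (fun x => fderiv ℝ n x u) x :=
          ((ContinuousLinearMap.apply ℝ (Vec2 →L[ℝ] ℝ) u).analyticAt _).fun_comp (hn x hx).fderiv
        exact ((ContinuousLinearMap.apply ℝ ℝ v).analyticAt _).fun_comp h1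
      exact (han u v).eqOn_of_preconnected_of_eventuallyEq (han v u) hpre hx₁
        (h.mono fun x hx => hx.2 u v)
    obtain ⟨ℓ, hℓ⟩ := hBc.exists_forall_hasFDerivAt_of_fderiv_symmetric hB
      (fun y hy => (hn y hy).differentiableAt.differentiableWithinAt) (fun x hx u v => hs u v x hx)
    exact ⟨ℓ, hℓ⟩

end symm

section glob

def EE (σ : ℝ) (ℓ : Vec2 → ℝ) (p : E3) : ℝ := Real.exp (σ * Real.log p.2 + ℓ p.1)

lemma EE_ne (σ : ℝ) (ℓ : Vec2 → ℝ) (p : E3) : EE σ ℓ p ≠ 0 := (Real.exp_pos _).ne'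

lemma EE_id (σ : ℝ) (ℓ : Vec2 → ℝ) (p : E3) (D : ℝ) (hs : 0 < p.2) (hD : D ≠ 0) :
    EE σ ℓ p = |p.2 * D| ^ σ * (Real.exp (ℓ p.1) / |D| ^ σ) := by
  have h1 : 0 < |D| := abs_pos.2 hD
  have h2 : 0 < |D| ^ σ := Real.rpow_pos_of_pos h1 _
  rw [abs_mul, Real.mul_rpow (abs_nonneg _) (abs_nonneg _), abs_of_pos hs, EE, Real.exp_add,
    Real.rpow_def_of_pos hs, mul_comm σ]
  field_simp

lemma G_eq {B : Set Vec2} (hB : IsOpen B) {n : Vec2 → Vec2 →L[ℝ] ℝ} {m : Vec2 → ℝ} {σ : ℝ}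
    {ℓ : Vec2 → ℝ} (hm : ∀ x ∈ B, m x = σ) (hℓ : ∀ x ∈ B, HasFDerivAt ℓ (n x) x)
    {p₀ : E3} (hp : p₀.1 ∈ B) (hs : 0 < p₀.2) {G : E3 → ℝ}
    (hG : ∀ᶠ p in 𝓝 p₀, HasFDerivAt G (G p • thet n m p) p) :
    ∃ C, ∀ᶠ p in 𝓝 p₀, G p = C * EE σ ℓ p := by
  have h1 : ∀ᶠ p in 𝓝 p₀, HasFDerivAt (fun p => G p / EE σ ℓ p) (0 : E3 →L[ℝ] ℝ) p := by
    filter_upwards [hG, continuousAt_fst.eventually (hB.mem_nhds hp),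
      continuousAt_snd.eventually (lt_mem_nhds hs)] with p h1 h2 h3
    have e1 : HasFDerivAt (fun p : E3 => Real.log p.2)
        (p.2⁻¹ • ContinuousLinearMap.snd ℝ Vec2 ℝ) p :=
      HasFDerivAt.log hasFDerivAt_snd (ne_of_gt h3)
    have e2 : HasFDerivAt (fun p : E3 => ℓ p.1) ((n p.1).comp (ContinuousLinearMap.fst ℝ Vec2 ℝ)) p :=
      HasFDerivAt.comp (g := ℓ) (f := Prod.fst) p (hℓ p.1 h2) hasFDerivAt_fst
    have e3 := (((e1.const_mul σ).add e2).neg.exp)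
    have e4 := h1.mul e3
    have e5 : (fun p => G p / EE σ ℓ p) = (fun p => G p * Real.exp (-(σ * Real.log p.2 + ℓ p.1))) := by
      ext p
      rw [Real.exp_neg, EE]; rfl
    rw [e5]
    refine e4.congr_fderiv (ContinuousLinearMap.ext fun v => ?_)
    simp [thet_apply, hm p.1 h2]
    ring
  obtain ⟨ε, hε, hb⟩ := Metric.eventually_nhds_iff_ball.1 h1
  refine ⟨G p₀ / EE σ ℓ p₀, ?_⟩
  filter_upwards [Metric.ball_mem_nhds p₀ hε] with p hp
  have := (convex_ball p₀ ε).is_const_of_fderivWithin_eq_zero (𝕜 := ℝ)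
      (fun y hy => (hb y hy).differentiableAt.differentiableWithinAt)
      (fun y hy => by rw [fderivWithin_of_isOpen isOpen_ball hy]; exact (hb y hy).fderiv) hp
      (mem_ball_self hε)
  rw [← this, div_mul_cancel₀ _ (EE_ne _ _ _)]

/-- The data extracted from the hypotheses of the theorem. -/
structure Dat (B : Set Vec2) (ψ a : Fin 3 → Vec2 → ℝ) (σ : ℝ) (ℓ : Vec2 → ℝ) : Prop where
  hψ : ∀ j, ∀ x ∈ B, AnalyticAt ℝ (ψ j) x
  hQ : ∀ j, ∀ x ∈ B, Dder (ψ j) x ≠ 0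
  ha0 : ∀ j, ∀ x ∈ B, a j x ≠ 0
  hloc : ∀ p₀ : E3, p₀.1 ∈ B → 0 < p₀.2 → ∀ f : Fin 3 → Vec2 → ℝ,
    (∀ᶠ p in nae p₀, ∑ j, f j (Φmap (ψ j) p) • fderiv ℝ (ψ j) p.1 = 0) →
    ∃ (C : ℝ) (f' : Fin 3 → Vec2 → ℝ), (∀ j, AnalyticAt ℝ (f' j) (Φmap (ψ j) p₀)) ∧
      (∀ᶠ p in nae p₀, ∀ j, f j (Φmap (ψ j) p) = C * EE σ ℓ p * a j p.1) ∧
      ∀ j, ∀ᶠ p in 𝓝 p₀, f' j (Φmap (ψ j) p) = C * EE σ ℓ p * a j p.1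

lemma map_nhds_psi {ψ : Vec2 → ℝ} {p : E3} (h : AnalyticAt ℝ ψ p.1) (hQ : Dder ψ p.1 ≠ 0) :
    Filter.map (fun p : E3 => ψ p.1) (𝓝 p) = 𝓝 (ψ p.1) := by
  have h1 : HasStrictFDerivAt (fun p : E3 => ψ p.1)
      ((fderiv ℝ ψ p.1).comp (ContinuousLinearMap.fst ℝ Vec2 ℝ)) p :=
    HasStrictFDerivAt.comp (g := ψ) (f := Prod.fst) p h.hasStrictFDerivAt hasStrictFDerivAt_fst
  refine h1.map_nhds_eq_of_surj ?_
  rw [LinearMap.range_eq_top]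
  intro y
  refine ⟨((0, y / Dder ψ p.1), 0), ?_⟩
  show fderiv ℝ ψ p.1 (0, y / Dder ψ p.1) = y
  rw [fderiv_decomp]
  show 0 * _ + y / Dder ψ p.1 * Dder ψ p.1 = y
  field_simp; ring

lemma Dat.const_unique {B : Set Vec2} {ψ a : Fin 3 → Vec2 → ℝ} {σ : ℝ} {ℓ : Vec2 → ℝ}
    (d : Dat B ψ a σ ℓ) (hB : IsOpen B) {p : E3} (hp : p.1 ∈ B) {f : Fin 3 → Vec2 → ℝ} {C C' : ℝ}
    (h : ∀ᶠ p in nae p, ∀ j, f j (Φmap (ψ j) p) = C * EE σ ℓ p * a j p.1)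
    (h' : ∀ᶠ p in nae p, ∀ j, f j (Φmap (ψ j) p) = C' * EE σ ℓ p * a j p.1) : C = C' := by
  have h2 : ∀ᶠ q : E3 in nae p, q.1 ∈ B :=
    nae_le_nhds p (continuousAt_fst.eventually (hB.mem_nhds hp))
  obtain ⟨q, h3, h4, h5⟩ := (h.and (h'.and h2)).exists
  have h6 := (h3 0).symm.trans (h4 0)
  exact mul_right_cancel₀ (EE_ne σ ℓ q) (mul_right_cancel₀ (d.ha0 0 _ h5) h6)

lemma Dat.global {B : Set Vec2} {ψ a : Fin 3 → Vec2 → ℝ} {σ : ℝ} {ℓ : Vec2 → ℝ}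
    (d : Dat B ψ a σ ℓ) (hB : IsOpen B) {S : Set E3} (hSo : IsOpen S) (hS : IsConnected S)
    (hSB : S ⊆ {p : E3 | p.1 ∈ B ∧ 0 < p.2}) {f : Fin 3 → Vec2 → ℝ}
    (hf : ∀ p ∈ S, ∀ᶠ p in nae p, ∑ j, f j (Φmap (ψ j) p) • fderiv ℝ (ψ j) p.1 = 0) :
    ∃ (C : ℝ) (F : Fin 3 → ℝ → ℝ),
      (∀ j, AnalyticOnNhd ℝ (F j) ((fun p : E3 => ψ j p.1) '' S)) ∧
      (∀ p ∈ S, ∀ᶠ p in nae p, ∀ j, f j (Φmap (ψ j) p) = C * EE σ ℓ p * a j p.1) ∧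
      ∀ p ∈ S, ∀ j, C * EE σ ℓ p * a j p.1 = |p.2 * Dder (ψ j) p.1| ^ σ * F j (ψ j p.1) := by
  choose! C f' hf' h1 h2 using fun (p : E3) (hp : p ∈ S) =>
    d.hloc p (hSB hp).1 (hSB hp).2 f (hf p hp)
  obtain ⟨q, hq⟩ := hS.nonempty
  have hC : ∀ p ∈ S, C p = C q := by
    intro p hp
    refine hS.isPreconnected.induction₂ (fun x y => C x = C y) ?_ ?_ ?_ hp hq
    · intro x hx
      have e := eventually_nae_nae (h1 x hx)
      refine nhdsWithin_le_nhds ?_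
      filter_upwards [e, hSo.mem_nhds hx] with y hy hyS
      exact d.const_unique hB (hSB hyS).1 hy (h1 y hyS)
    · intro x y z _ _ _ e1 e2; exact e1.trans e2
    · intro x y _ _ e; exact e.symm
  have hF : ∀ j, ∃ F : ℝ → ℝ, AnalyticOnNhd ℝ F ((fun p : E3 => ψ j p.1) '' S) ∧
      ∀ p ∈ S, C q * (Real.exp (ℓ p.1) / |Dder (ψ j) p.1| ^ σ) * a j p.1 = F (ψ j p.1) := by
    intro j
    refine exists_global hSo hS.isPreconnected (φ := fun p : E3 => ψ j p.1)
      (h := fun p : E3 => C q * (Real.exp (ℓ p.1) / |Dder (ψ j) p.1| ^ σ) * a j p.1) ?_ ?_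
    · intro p hp
      exact map_nhds_psi (d.hψ j _ (hSB hp).1) (d.hQ j _ (hSB hp).1)
    · intro p hp
      have hQ := d.hQ j _ (hSB hp).1
      have hψ := d.hψ j _ (hSB hp).1
      have hs := (hSB hp).2
      set t := p.2 * Dder (ψ j) p.1 with ht
      have ht0 : t ≠ 0 := mul_ne_zero (ne_of_gt hs) hQ
      have ht1 : 0 < |t| ^ σ := Real.rpow_pos_of_pos (abs_pos.2 ht0) _
      refine ⟨fun y => f' p j (y, t) / |t| ^ σ, ?_, ?_⟩
      · have e1 : AnalyticAt ℝ (fun y : ℝ => f' p j (y, t)) (ψ j p.1) :=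
          AnalyticAt.fun_comp (f := fun y : ℝ => ((y, t) : Vec2)) (hf' p hp j)
            (analyticAt_id.prod analyticAt_const)
        exact e1.div_const
      · have hD : ContinuousAt (fun p : E3 => Dder (ψ j) p.1) p :=
          (fst_an (analyticAt_Dder hψ)).continuousAt
        have e2 : ContinuousAt (fun p' : E3 => ((p'.1, t / Dder (ψ j) p'.1) : E3)) p :=
          continuousAt_fst.prodMk (continuousAt_const.div hD hQ)
        have e3 : ((p.1, t / Dder (ψ j) p.1) : E3) = p := by
          ext <;> simp [ht, hQ]
        have e2' : Tendsto (fun p' : E3 => ((p'.1, t / Dder (ψ j) p'.1) : E3)) (𝓝 p) (𝓝 p) := by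
          have := e2.tendsto
          rwa [e3] at this
        filter_upwards [e2'.eventually (h2 p hp j), hD.eventually_ne hQ,
          e2'.eventually (hSo.mem_nhds hp)] with p' e4 e5 e6
        have e7 := (hSB e6).2
        rw [EE_id σ ℓ _ (Dder (ψ j) p'.1) e7 e5, hC p hp] at e4
        simp only [Φmap] at e4
        have e8 : t / Dder (ψ j) p'.1 * Dder (ψ j) p'.1 = t := div_mul_cancel₀ _ e5
        rw [e8] at e4
        rw [e4]
        field_simp
  choose F hF1 hF2 using hF
  refine ⟨C q, F, hF1, fun p hp => by rw [← hC p hp]; exact h1 p hp, fun p hp j => ?_⟩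
  rw [← hF2 j p hp, EE_id σ ℓ _ (Dder (ψ j) p.1) (hSB hp).2 (d.hQ j _ (hSB hp).1)]
  ring

end glob

section fin

lemma ae_of_nae {E : Type*} [TopologicalSpace E] [SecondCountableTopology E] [MeasureSpace E]
    [OpensMeasurableSpace E] {T : Set E}
    {P : E → Prop} (h : ∀ q ∈ T, ∀ᶠ q in nae q, P q) : ∀ᵐ q ∂(volume.restrict T), P q := by
  let U : Set E := {q | ∀ᶠ q in nae q, P q}
  have hU : IsOpen U := isOpen_iff_mem_nhds.2 fun q hq => eventually_nae_nae hq
  have hTU : T ⊆ U := h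
  refine ae_restrict_of_ae_restrict_of_subset hTU ?_
  rw [ae_restrict_iff' hU.measurableSet]
  refine measure_null_of_locally_null _ fun x hx => ?_
  have hxU : x ∈ U := by
    by_contra hn
    exact hx fun h => absurd h hn
  obtain ⟨V, hV, hxV, hP⟩ := eventually_nae.1 (show ∀ᶠ q in nae x, P q from hxU)
  refine ⟨V ∩ {x | x ∈ U → P x}ᶜ, Filter.inter_mem (mem_nhdsWithin_of_mem_nhds (hV.mem_nhds hxV)) self_mem_nhdsWithin, ?_⟩
  refine measure_mono_null ?_ hP
  rintro y ⟨hy1, hy2⟩ hy3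
  exact hy2 fun _ => hy3 hy1

lemma nae_of_ae {E : Type*} [TopologicalSpace E] [MeasureSpace E] {T : Set E}
    {P : E → Prop} (h : ∀ᵐ q ∂(volume.restrict T), P q) {q : E} (hq : T ∈ 𝓝 q) :
    ∀ᶠ q in nae q, P q := by
  obtain ⟨U, hUT, hU, hqU⟩ := _root_.mem_nhds_iff.1 hq
  refine eventually_nae.2 ⟨U, hU, hqU, ?_⟩
  filter_upwards [ae_imp_of_ae_restrict h] with x hx hxU
  exact hx (hUT hxU)

lemma Phi_image_nhds {ψ : Vec2 → ℝ} {p : E3} (h : AnalyticAt ℝ ψ p.1) (hQ : Dder ψ p.1 ≠ 0)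
    {S : Set E3} (hS : S ∈ 𝓝 p) : Φmap ψ '' S ∈ 𝓝 (Φmap ψ p) := by
  obtain ⟨g, hg, hg0, hΨg, -, -⟩ := ift (analyticAt_PsiM h) (fun v => PsiM_inj h hQ v)
  have h1 : ∀ᶠ y in 𝓝 (PsiM ψ p), y.1 ∈ Φmap ψ '' S := by
    have h2 : ∀ᶠ y in 𝓝 (PsiM ψ p), g y ∈ S :=
      hg.continuousAt.eventually (by rw [hg0]; exact hS)
    filter_upwards [h2, hΨg] with y e1 e2
    exact ⟨g y, e1, congrArg Prod.fst e2⟩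
  have h3 : ∀ᶠ y in Filter.map Prod.fst (𝓝 (PsiM ψ p)), y ∈ Φmap ψ '' S := h1
  rw [map_fst_nhds] at h3
  exact h3

lemma core {B : Set Vec2} (hB : IsOpen B) {ψ a : Fin 3 → Vec2 → ℝ}
    (hψ : ∀ j, ∀ x ∈ B, AnalyticAt ℝ (ψ j) x) (hQ : ∀ j, ∀ x ∈ B, Dder (ψ j) x ≠ 0)
    (ha : ∀ j, ∀ x ∈ B, AnalyticAt ℝ (a j) x) (ha0 : ∀ j, ∀ x ∈ B, a j x ≠ 0)
    (hdet : ∀ x ∈ B, (Amat ψ x).det ≠ 0)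
    (hker : ∀ x ∈ B, ∀ c : Fin 3 → ℝ, ∑ j, c j • fderiv ℝ (ψ j) x = 0 →
      ∀ j, c j = c 0 / a 0 x * a j x)
    {n : Vec2 → Vec2 →L[ℝ] ℝ} {m : Vec2 → ℝ}
    (hnm : ∀ x ∈ B, ∀ (α : Vec2 →L[ℝ] ℝ) (γ c : ℝ),
        (∀ j, (α (vv (ψ j) x) - γ * bb (ψ j) x) * a j x + c * fderiv ℝ (a j) x (vv (ψ j) x) = 0) →
        α = c • n x ∧ γ = c * m x)
    {p₀ : E3} (hp : p₀.1 ∈ B) (hs : 0 < p₀.2) {f : Fin 3 → Vec2 → ℝ}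
    (h : ∀ᶠ p in nae p₀, ∑ j, f j (Φmap (ψ j) p) • fderiv ℝ (ψ j) p.1 = 0) :
    ∃ (G : E3 → ℝ) (f' : Fin 3 → Vec2 → ℝ),
      (∀ j, AnalyticAt ℝ (f' j) (Φmap (ψ j) p₀)) ∧
      (∀ᶠ p in nae p₀, ∀ j, f j (Φmap (ψ j) p) = G p * a j p.1) ∧
      (∀ j, ∀ᶠ p in 𝓝 p₀, f' j (Φmap (ψ j) p) = G p * a j p.1) ∧
      ∀ᶠ p in 𝓝 p₀, HasFDerivAt G (G p • thet n m p) p := by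
  have h1 : ∀ᶠ p in nae p₀, ∀ j, f j (Φmap (ψ j) p) =
      (fun p : E3 => f 0 (Φmap (ψ 0) p) / a 0 p.1) p * a j p.1 := by
    have h2 : ∀ᶠ q : E3 in nae p₀, q.1 ∈ B :=
      nae_le_nhds p₀ (continuousAt_fst.eventually (hB.mem_nhds hp))
    filter_upwards [h, h2] with p h1 h2 j
    exact hker p.1 h2 (fun j => f j (Φmap (ψ j) p)) h1 j
  obtain ⟨G, f', hG, hf', e1, e2⟩ := local_solution (fun j => hψ j _ hp) (fun j => hQ j _ hp)
    (fun j => ha j _ hp) (fun j => ha0 j _ hp) (hdet _ hp) hs h1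
  exact ⟨G, f', hf', e1, e2, deriv_G hB hψ hQ ha hnm hp hs hG hf' e2⟩

lemma build_Dat {B : Set Vec2} (hB : IsOpen B) (hBc : Convex ℝ B) {ψ a : Fin 3 → Vec2 → ℝ}
    (hψ : ∀ j, ∀ x ∈ B, AnalyticAt ℝ (ψ j) x) (hQ : ∀ j, ∀ x ∈ B, Dder (ψ j) x ≠ 0)
    (ha : ∀ j, ∀ x ∈ B, AnalyticAt ℝ (a j) x) (ha0 : ∀ j, ∀ x ∈ B, a j x ≠ 0)
    (hdet : ∀ x ∈ B, (Amat ψ x).det ≠ 0)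
    (hker : ∀ x ∈ B, ∀ c : Fin 3 → ℝ, ∑ j, c j • fderiv ℝ (ψ j) x = 0 →
      ∀ j, c j = c 0 / a 0 x * a j x)
    {S : Set E3} (hSB : S ⊆ {p : E3 | p.1 ∈ B ∧ 0 < p.2}) {f : Fin 3 → Vec2 → ℝ}
    (hf : ∀ p ∈ S, ∀ᶠ p in nae p, ∑ j, f j (Φmap (ψ j) p) • fderiv ℝ (ψ j) p.1 = 0)
    (hnz : ¬ ∀ᵐ p ∂(volume.restrict S), ∀ j, f j (Φmap (ψ j) p) = 0) :
    ∃ σ ℓ, Dat B ψ a σ ℓ := by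
  obtain ⟨n, m, hn, hm, hnm⟩ := exists_theta hψ hQ ha ha0 hdet
  have hex : ∃ (p : E3) (G : E3 → ℝ), p.1 ∈ B ∧ 0 < p.2 ∧ G p ≠ 0 ∧
      ∀ᶠ p in 𝓝 p, HasFDerivAt G (G p • thet n m p) p := by
    by_contra hcon
    apply hnz
    refine ae_of_nae fun p hp => ?_
    obtain ⟨hp1, hp2⟩ := hSB hp
    obtain ⟨G, f', -, e1, -, e3⟩ := core hB hψ hQ ha ha0 hdet hker hnm hp1 hp2 (hf p hp)
    have e4 : ∀ᶠ q in 𝓝 p, G q = 0 := by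
      filter_upwards [e3.eventually_nhds, continuousAt_fst.eventually (hB.mem_nhds hp1),
        continuousAt_snd.eventually (lt_mem_nhds hp2)] with q h1 h2 h3
      by_contra h4
      exact hcon ⟨q, G, h2, h3, h4, h1⟩
    filter_upwards [e1, nae_le_nhds p e4] with q h1 h2 j
    have h2 : G q = 0 := h2
    rw [h1, h2, zero_mul]
  obtain ⟨p, G, hp1, hp2, hG0, hG⟩ := hex
  obtain ⟨⟨σ, hσ⟩, ⟨ℓ, hℓ⟩⟩ := global_symm hB hBc hn hm hp1
    (symm_of_G (hn _ hp1) (hm _ hp1) (ne_of_gt hp2) hG0 hG)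
  refine ⟨σ, ℓ, hψ, hQ, ha0, fun p₀ h1 h2 f h3 => ?_⟩
  obtain ⟨G, f', e0, e1, e2, e3⟩ := core hB hψ hQ ha ha0 hdet hker hnm h1 h2 h3
  obtain ⟨C, hC⟩ := G_eq hB hσ hℓ h1 h2 e3
  refine ⟨C, f', e0, ?_, fun j => ?_⟩
  · filter_upwards [e1, nae_le_nhds p₀ hC] with q h1 h2 j
    have h2 : G q = C * EE σ ℓ q := h2
    rw [h1, h2]
  · filter_upwards [e2 j, hC] with q h1 h2
    rw [h1, h2]

lemma Dat.exponent_unique {B : Set Vec2} {ψ a : Fin 3 → Vec2 → ℝ} {σ : ℝ} {ℓ : Vec2 → ℝ}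
    (d : Dat B ψ a σ ℓ) (hB : IsOpen B) {S : Set E3} (hSo : IsOpen S) (hS : IsConnected S)
    (hSB : S ⊆ {p : E3 | p.1 ∈ B ∧ 0 < p.2}) {f : Fin 3 → Vec2 → ℝ}
    (hf : ∀ p ∈ S, ∀ᶠ p in nae p, ∑ j, f j (Φmap (ψ j) p) • fderiv ℝ (ψ j) p.1 = 0)
    (hnz : ¬ ∀ᵐ p ∂(volume.restrict S), ∀ j, f j (Φmap (ψ j) p) = 0)
    {τ : ℝ} {F' : Fin 3 → ℝ → ℝ}
    (hF' : ∀ j, AnalyticOnNhd ℝ (F' j) ((fun p : E3 => ψ j p.1) '' S))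
    (h : ∀ j, ∀ᵐ q ∂(volume.restrict (Φmap (ψ j) '' S)), f j q = |q.2| ^ τ * F' j q.1) :
    τ = σ := by
  obtain ⟨C, F, hF, h1, h2⟩ := d.global hB hSo hS hSB hf
  have hC : C ≠ 0 := by
    rintro rfl
    apply hnz
    refine ae_of_nae fun p hp => ?_
    filter_upwards [h1 p hp] with q hq j
    rw [hq]; ring
  obtain ⟨p, hp⟩ := hS.nonempty
  obtain ⟨hpB, hps⟩ := hSB hp
  have hψ := d.hψ 0 _ hpB
  have hQ := d.hQ 0 _ hpB
  have e1 : ∀ᶠ q in nae (Φmap (ψ 0) p), f 0 q = |q.2| ^ τ * F' 0 q.1 :=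
    nae_of_ae (h 0) (Phi_image_nhds hψ hQ (hSo.mem_nhds hp))
  have e2 : ∀ᶠ q in nae p, f 0 (Φmap (ψ 0) q) =
      |q.2 * Dder (ψ 0) q.1| ^ τ * F' 0 (ψ 0 q.1) :=
    (tendsto_Psi (analyticAt_PsiM hψ) (fun v => PsiM_inj hψ hQ v)).eventually e1
  have e3 : ∀ᶠ q : E3 in nae p, |q.2 * Dder (ψ 0) q.1| ^ σ * F 0 (ψ 0 q.1) =
      |q.2 * Dder (ψ 0) q.1| ^ τ * F' 0 (ψ 0 q.1) := by
    filter_upwards [e2, h1 p hp, nae_le_nhds p (hSo.mem_nhds hp)] with q h3 h4 h5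
    rw [← h2 q h5 0, ← h4 0, h3]
  have hcont : ∀ (ρ : ℝ) (K : Fin 3 → ℝ → ℝ),
      (∀ j, AnalyticOnNhd ℝ (K j) ((fun p : E3 => ψ j p.1) '' S)) →
      ∀ᶠ q : E3 in 𝓝 p, ContinuousAt (fun q : E3 => |q.2 * Dder (ψ 0) q.1| ^ ρ * K 0 (ψ 0 q.1)) q := by
    intro ρ K hK
    filter_upwards [hSo.mem_nhds hp] with q hq
    obtain ⟨hqB, hqs⟩ := hSB hq
    have c1 : ContinuousAt (fun q : E3 => K 0 (ψ 0 q.1)) q :=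
      ContinuousAt.comp (g := K 0) (f := fun q : E3 => ψ 0 q.1)
        (hK 0 _ ⟨q, hq, rfl⟩).continuousAt (fst_an (d.hψ 0 _ hqB)).continuousAt
    have c2 : ContinuousAt (fun q : E3 => Dder (ψ 0) q.1) q :=
      (fst_an (analyticAt_Dder (d.hψ 0 _ hqB))).continuousAt
    refine ContinuousAt.mul ?_ c1
    refine ContinuousAt.rpow_const (continuousAt_snd.mul c2).abs (Or.inl ?_)
    exact abs_ne_zero.2 (mul_ne_zero (ne_of_gt hqs) (d.hQ 0 _ hqB))
  have e4 := nae_eq_of_cont e3 (hcont σ F hF) (hcont τ F' hF')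
  have e5 : ∀ᶠ s in 𝓝 p.2, |s * Dder (ψ 0) p.1| ^ σ * F 0 (ψ 0 p.1) =
      |s * Dder (ψ 0) p.1| ^ τ * F' 0 (ψ 0 p.1) := by
    have : ContinuousAt (fun s : ℝ => ((p.1, s) : E3)) p.2 := by fun_prop
    exact this.eventually e4
  have hF0 : F 0 (ψ 0 p.1) ≠ 0 := by
    intro h0
    have := h2 p hp 0
    rw [h0, mul_zero] at this
    exact mul_ne_zero (mul_ne_zero hC (EE_ne σ ℓ p)) (d.ha0 0 _ hpB) this
  have hlog : ∀ s : ℝ, 0 < s → |s * Dder (ψ 0) p.1| ^ σ * F 0 (ψ 0 p.1) =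
      |s * Dder (ψ 0) p.1| ^ τ * F' 0 (ψ 0 p.1) →
      (σ - τ) * Real.log s = Real.log (F' 0 (ψ 0 p.1)) - Real.log (F 0 (ψ 0 p.1)) -
        (σ - τ) * Real.log |Dder (ψ 0) p.1| := by
    intro s hs he
    have u0 : 0 < |s * Dder (ψ 0) p.1| := abs_pos.2 (mul_ne_zero hs.ne' hQ)
    have hF0' : F' 0 (ψ 0 p.1) ≠ 0 := by
      intro h0
      rw [h0, mul_zero] at he
      exact mul_ne_zero (Real.rpow_pos_of_pos u0 _).ne' hF0 he
    have hl := congrArg Real.log he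
    rw [Real.log_mul (Real.rpow_pos_of_pos u0 _).ne' hF0,
      Real.log_mul (Real.rpow_pos_of_pos u0 _).ne' hF0', Real.log_rpow u0, Real.log_rpow u0,
      abs_mul, abs_of_pos hs, Real.log_mul hs.ne' (abs_pos.2 hQ).ne'] at hl
    linear_combination hl
  obtain ⟨ε, hε, hb⟩ := Metric.eventually_nhds_iff.1 e5
  have e6 := hlog p.2 hps (hb (by simpa using hε))
  have e7 := hlog (p.2 + ε / 2) (by positivity) (hb (by
    rw [Real.dist_eq, add_sub_cancel_left, abs_of_pos (by positivity)]; linarith))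
  have e8 : Real.log p.2 < Real.log (p.2 + ε / 2) := Real.log_lt_log hps (by linarith)
  have e9 : (σ - τ) * (Real.log (p.2 + ε / 2) - Real.log p.2) = 0 := by
    linear_combination e7 - e6
  have := (mul_eq_zero.1 e9).resolve_right (sub_ne_zero.2 (ne_of_gt e8))
  linarith

lemma Dat.property {B : Set Vec2} {ψ a : Fin 3 → Vec2 → ℝ} {σ : ℝ} {ℓ : Vec2 → ℝ}
    (d : Dat B ψ a σ ℓ) (hB : IsOpen B) {S : Set E3} (hSo : IsOpen S) (hS : IsConnected S)
    (hSB : S ⊆ {p : E3 | p.1 ∈ B ∧ 0 < p.2}) {f : Fin 3 → Vec2 → ℝ}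
    (hf : ∀ p ∈ S, ∀ᶠ p in nae p, ∑ j, f j (Φmap (ψ j) p) • fderiv ℝ (ψ j) p.1 = 0) :
    ∃ F : Fin 3 → ℝ → ℝ, (∀ j, AnalyticOnNhd ℝ (F j) ((fun p : E3 => ψ j p.1) '' S)) ∧
      ∀ j, ∀ᵐ q ∂(volume.restrict (Φmap (ψ j) '' S)), f j q = |q.2| ^ σ * F j q.1 := by
  obtain ⟨C, F, hF, h1, h2⟩ := d.global hB hSo hS hSB hf
  refine ⟨F, hF, fun j => ae_of_nae ?_⟩
  rintro _ ⟨p, hp, rfl⟩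
  have hψ := d.hψ j _ (hSB hp).1
  have hQ := d.hQ j _ (hSB hp).1
  refine transfer_Psi (analyticAt_PsiM hψ) (fun v => PsiM_inj hψ hQ v) ?_
  filter_upwards [h1 p hp, nae_le_nhds p (hSo.mem_nhds hp)] with q h3 h4
  show f j (Φmap (ψ j) q) = |q.2 * Dder (ψ j) q.1| ^ σ * F j (ψ j q.1)
  rw [h3 j, h2 q h4 j]

end fin

section setup

lemma Amat_det {B : Set Vec2} (hB : IsOpen B) {ψ : Fin 3 → Vec2 → ℝ} {x : Vec2} (hx : x ∈ B)
    (hψ : ∀ j, AnalyticAt ℝ (ψ j) x) (hQ : ∀ j, Dder (ψ j) x ≠ 0) {v : Vec2 → Vec2}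
    (hv : AnalyticAt ℝ v x) (hv1 : ∀ y ∈ B, (v y).1 = 0) (hv2 : (v x).2 ≠ 0) {W : Fin 3 → E3}
    (hW : ∀ j, fderiv ℝ (fun q : E3 => ((ψ j q.1, q.2 * fderiv ℝ (ψ j) q.1 (v q.1)) : Vec2))
      (x, 1) (W j) = 0)
    (hspan : ∀ L : E3 →ₗ[ℝ] ℝ, (∀ j, L (W j) = 0) → L = 0) : (Amat ψ x).det ≠ 0 := by
  intro hdet
  obtain ⟨y, hy0, hy⟩ := Matrix.exists_mulVec_eq_zero_iff.2 hdet
  set h : Vec2 → ℝ := fun y => (v y).2 with hh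
  have hhan : AnalyticAt ℝ h x := analyticAt_snd.fun_comp hv
  have hhx : h x ≠ 0 := hv2
  have hw : ∀ j, fderiv ℝ (ψ j) x (W j).1 = 0 ∧
      h x * fderiv ℝ (Dder (ψ j)) x (W j).1 + Dder (ψ j) x * fderiv ℝ h x (W j).1
        + (W j).2 * (h x * Dder (ψ j) x) = 0 := by
    intro j
    have e1 : (fun q : E3 => ((ψ j q.1, q.2 * fderiv ℝ (ψ j) q.1 (v q.1)) : Vec2)) =ᶠ[𝓝 ((x, 1) : E3)]
        fun q => (ψ j q.1, q.2 * (h q.1 * Dder (ψ j) q.1)) := by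
      filter_upwards [(continuousAt_fst (p := ((x, 1) : E3))).eventually (hB.mem_nhds hx)] with q hq
      rw [fderiv_decomp _ (v q.1), hv1 _ hq, zero_mul, zero_add]
      rfl
    have hx' : AnalyticAt ℝ (ψ j) ((x, 1) : E3).1 := hψ j
    have hh' : AnalyticAt ℝ h ((x, 1) : E3).1 := hhan
    have e2 := (fderiv_fst_comp hx').prodMk ((hasFDerivAt_snd (𝕜 := ℝ) (p := ((x, 1) : E3))).mul
      ((fderiv_fst_comp hh').mul (fderiv_fst_comp (analyticAt_Dder hx'))))
    have e3 := hW j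
    rw [e1.fderiv_eq] at e3
    have e4 := e2.fderiv
    have e5 := (DFunLike.congr_fun e4 (W j)).symm.trans e3
    have e6 := congrArg Prod.fst e5
    have e7 := congrArg Prod.snd e5
    simp at e6 e7
    refine ⟨e6, ?_⟩
    linear_combination e7
  have hw1 : ∀ j, (W j).1 = (W j).1.1 • vv (ψ j) x := by
    intro j
    have e1 := (hw j).1
    rw [fderiv_decomp] at e1
    have e2 : (W j).1.1 * Pder (ψ j) x + (W j).1.2 * Dder (ψ j) x = 0 := e1
    ext
    · simp [vv]
    · simp only [vv, Prod.smul_mk, smul_eq_mul]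
      have := hQ j
      field_simp
      linarith
  let L : E3 →ₗ[ℝ] ℝ :=
    ((y 0 • ((ContinuousLinearMap.fst ℝ ℝ ℝ).comp (ContinuousLinearMap.fst ℝ Vec2 ℝ)) +
      y 1 • ((ContinuousLinearMap.snd ℝ ℝ ℝ).comp (ContinuousLinearMap.fst ℝ Vec2 ℝ)) +
      y 2 • (ContinuousLinearMap.snd ℝ Vec2 ℝ +
        (h x)⁻¹ • (fderiv ℝ h x).comp (ContinuousLinearMap.fst ℝ Vec2 ℝ)) : E3 →L[ℝ] ℝ) : E3 →ₗ[ℝ] ℝ)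
  have hLa : ∀ w : E3, L w = y 0 * w.1.1 + y 1 * w.1.2 + y 2 * (w.2 + (h x)⁻¹ * fderiv ℝ h x w.1) := by
    intro w; rfl
  have hL : L = 0 := by
    refine hspan L fun j => ?_
    rw [hLa]
    have e1 := congrFun hy j
    simp only [Matrix.mulVec, dotProduct, Fin.sum_univ_three, Amat, Matrix.of_apply,
          Matrix.cons_val, Pi.zero_apply] at e1
    have e2 := (hw j).2
    have e3 := hQ j
    have e4 : (W j).1.2 = (W j).1.1 * (vv (ψ j) x).2 := by
      conv_lhs => rw [hw1 j]
      rfl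
    have e5 : fderiv ℝ (Dder (ψ j)) x (W j).1 = (W j).1.1 * (bb (ψ j) x * Dder (ψ j) x) := by
      rw [hw1 j, map_smul, bb, div_mul_cancel₀ _ e3]
      simp [vv]
    have e6 : (W j).2 + (h x)⁻¹ * fderiv ℝ h x (W j).1 = - (W j).1.1 * bb (ψ j) x := by
      rw [e5] at e2
      apply mul_right_cancel₀ (mul_ne_zero hhx e3)
      have e7 : (h x)⁻¹ * h x = 1 := inv_mul_cancel₀ hhx
      linear_combination e2 + fderiv ℝ h x (W j).1 * Dder (ψ j) x * e7
    rw [e6, e4]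
    linear_combination (W j).1.1 * e1
  have z2 : y 2 = 0 := by
    have := hLa (0, 1)
    rw [hL] at this
    simpa using this.symm
  have z0 : y 0 = 0 := by
    have := hLa ((1, 0), 0)
    rw [hL] at this
    simpa [z2] using this.symm
  have z1 : y 1 = 0 := by
    have := hLa ((0, 1), 0)
    rw [hL] at this
    simpa [z2] using this.symm
  apply hy0
  ext i
  fin_cases i
  · exact z0
  · exact z1
  · exact z2

lemma clm_ext2 {L M : Vec2 →L[ℝ] ℝ} (h1 : L (1, 0) = M (1, 0)) (h2 : L (0, 1) = M (0, 1)) :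
    L = M := by
  refine ContinuousLinearMap.ext fun u => ?_
  rw [fderiv_decomp L, fderiv_decomp M, h1, h2]

def aa (ψ : Fin 3 → Vec2 → ℝ) : Fin 3 → Vec2 → ℝ :=
  ![fun x => Pder (ψ 1) x * Dder (ψ 2) x - Pder (ψ 2) x * Dder (ψ 1) x,
    fun x => Pder (ψ 2) x * Dder (ψ 0) x - Pder (ψ 0) x * Dder (ψ 2) x,
    fun x => Pder (ψ 0) x * Dder (ψ 1) x - Pder (ψ 1) x * Dder (ψ 0) x]

lemma aa_an {ψ : Fin 3 → Vec2 → ℝ} {x : Vec2} (hψ : ∀ j, AnalyticAt ℝ (ψ j) x) (j : Fin 3) :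
    AnalyticAt ℝ (aa ψ j) x := by
  have h : ∀ i k, AnalyticAt ℝ
      (fun x => Pder (ψ i) x * Dder (ψ k) x - Pder (ψ k) x * Dder (ψ i) x) x := fun i k =>
    ((analyticAt_Pder (hψ i)).mul (analyticAt_Dder (hψ k))).sub
      ((analyticAt_Pder (hψ k)).mul (analyticAt_Dder (hψ i)))
  fin_cases j
  · exact h 1 2
  · exact h 2 0
  · exact h 0 1

lemma aa_ne {ψ : Fin 3 → Vec2 → ℝ} {x : Vec2} (hQ : ∀ j, Dder (ψ j) x ≠ 0)
    (ht : ∀ i k, i ≠ k → LinearIndependent ℝ ![fderiv ℝ (ψ i) x, fderiv ℝ (ψ k) x]) (j : Fin 3) :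
    aa ψ j x ≠ 0 := by
  have h : ∀ i k, i ≠ k → Pder (ψ i) x * Dder (ψ k) x - Pder (ψ k) x * Dder (ψ i) x ≠ 0 := by
    intro i k hik h0
    have e := (LinearIndependent.pair_iff.1 (ht i k hik) (Dder (ψ k) x) (-Dder (ψ i) x) (by
      apply clm_ext2
      · show Dder (ψ k) x * Pder (ψ i) x + -Dder (ψ i) x * Pder (ψ k) x = 0
        linear_combination h0
      · show Dder (ψ k) x * Dder (ψ i) x + -Dder (ψ i) x * Dder (ψ k) x = 0
        ring)).1
    exact hQ k e
  fin_cases j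
  · exact h 1 2 (by decide)
  · exact h 2 0 (by decide)
  · exact h 0 1 (by decide)

lemma aa_ker {ψ : Fin 3 → Vec2 → ℝ} {x : Vec2} (h0 : aa ψ 0 x ≠ 0) (c : Fin 3 → ℝ)
    (hc : ∑ j, c j • fderiv ℝ (ψ j) x = 0) (j : Fin 3) : c j = c 0 / aa ψ 0 x * aa ψ j x := by
  have e1 : c 0 * Pder (ψ 0) x + c 1 * Pder (ψ 1) x + c 2 * Pder (ψ 2) x = 0 := by
    have := DFunLike.congr_fun hc ((1, 0) : Vec2)
    rw [Fin.sum_univ_three] at this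
    exact this
  have e2 : c 0 * Dder (ψ 0) x + c 1 * Dder (ψ 1) x + c 2 * Dder (ψ 2) x = 0 := by
    have := DFunLike.congr_fun hc ((0, 1) : Vec2)
    rw [Fin.sum_univ_three] at this
    exact this
  have key : c j * aa ψ 0 x = c 0 * aa ψ j x := by
    fin_cases j
    · rfl
    · show c 1 * (Pder (ψ 1) x * Dder (ψ 2) x - Pder (ψ 2) x * Dder (ψ 1) x) =
        c 0 * (Pder (ψ 2) x * Dder (ψ 0) x - Pder (ψ 0) x * Dder (ψ 2) x)
      linear_combination Dder (ψ 2) x * e1 - Pder (ψ 2) x * e2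
    · show c 2 * (Pder (ψ 1) x * Dder (ψ 2) x - Pder (ψ 2) x * Dder (ψ 1) x) =
        c 0 * (Pder (ψ 0) x * Dder (ψ 1) x - Pder (ψ 1) x * Dder (ψ 0) x)
      linear_combination -Dder (ψ 1) x * e1 + Pder (ψ 1) x * e2
  field_simp
  exact key

end setup

/-- there is a unique homogeneity exponent σ, and every nonvanishing
measurable solution on a connected open subset of B×ℝ⁺ has the form |t|^σ Fⱼ(y)
with Fⱼ real analytic. -/
theorem stmt12
    -- `B` is a nonempty open ball of finite radius, `Bt` a connected open neighborhood of its closure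
    (c₀ : Vec2) (r₀ : ℝ) (hr₀ : 0 < r₀)
    (B Bt : Set Vec2) (hB : B = Metric.ball c₀ r₀)
    (hBt_open : IsOpen Bt) (hBt_conn : IsConnected Bt) (hBBt : closure B ⊆ Bt)
    -- the φⱼ are real analytic submersions on `Bt`
    (φ : Fin 4 → Vec2 → ℝ)
    (hφ_an : ∀ j, AnalyticOnNhd ℝ (φ j) Bt)
    (hφ_sub : ∀ j, ∀ x ∈ Bt, fderiv ℝ (φ j) x ≠ 0)
    -- transversality hypothesis
    (htrans : ∀ x ∈ B, ∀ j k : Fin 4, j ≠ k →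
      LinearIndependent ℝ ![fderiv ℝ (φ j) x, fderiv ℝ (φ k) x])
    -- Vⱼ : nowhere vanishing real analytic vector fields with Vⱼ φⱼ ≡ 0
    (V : Fin 4 → Vec2 → Vec2)
    (hV_an : ∀ j, AnalyticOnNhd ℝ (V j) Bt)
    (hV_ne : ∀ j, ∀ x ∈ Bt, V j x ≠ 0)
    (hV_ker : ∀ j, ∀ x ∈ Bt, fderiv ℝ (φ j) x (V j x) = 0)
    -- auxiliary hypothesis 2
    (W : Fin 4 → Fin 4 → (Vec2 × ℝ) → (Vec2 × ℝ))
    (hW_an : ∀ j k, AnalyticOnNhd ℝ (W j k) (Bt ×ˢ (univ : Set ℝ)))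
    (hW_ne : ∀ j k, ∀ p ∈ Bt ×ˢ (univ : Set ℝ), W j k p ≠ 0)
    (hW_ker : ∀ j k, ∀ p ∈ Bt ×ˢ (univ : Set ℝ),
      fderiv ℝ (fun q : Vec2 × ℝ => ((φ j q.1, q.2 * fderiv ℝ (φ j) q.1 (V k q.1)) : Vec2))
        p (W j k p) = 0)
    (haux2 : ∀ k : Fin 4, ∀ p : Vec2 × ℝ, p.1 ∈ Bt → p.2 ≠ 0 →
      LinearIndependent ℝ (fun j : {j : Fin 4 // j ≠ k} => W j.1 k p))
    -- coordinates are chosen so that φ₄(x₁,x₂) = x₁ on B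
    (hφ4 : ∀ x ∈ B, φ 3 x = x.1)
    -- the functional equation admits a nontrivial measurable solution somewhere
    (hex : ∃ Ω : Set (Vec2 × ℝ), IsOpen Ω ∧ IsConnected Ω ∧
      Ω ⊆ {p : Vec2 × ℝ | p.1 ∈ B ∧ 0 < p.2} ∧
      ∃ f : Fin 3 → Vec2 → ℝ, (∀ j, Measurable (f j)) ∧
        (∀ᵐ p ∂(volume.restrict Ω),
          ∑ j : Fin 3, f j (Φmap (φ j.castSucc) p) • fderiv ℝ (φ j.castSucc) p.1 = 0) ∧
        ¬ (∀ᵐ p ∂(volume.restrict Ω), ∀ j : Fin 3, f j (Φmap (φ j.castSucc) p) = 0)) :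
    ∃! σ : ℝ, ∀ S : Set (Vec2 × ℝ), IsOpen S → IsConnected S →
      S ⊆ {p : Vec2 × ℝ | p.1 ∈ B ∧ 0 < p.2} →
      ∀ f : Fin 3 → Vec2 → ℝ, (∀ j, Measurable (f j)) →
      (∀ᵐ p ∂(volume.restrict S),
        ∑ j : Fin 3, f j (Φmap (φ j.castSucc) p) • fderiv ℝ (φ j.castSucc) p.1 = 0) →
      ¬ (∀ᵐ p ∂(volume.restrict S), ∀ j : Fin 3, f j (Φmap (φ j.castSucc) p) = 0) →
      ∃ F : Fin 3 → ℝ → ℝ,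
        (∀ j : Fin 3, AnalyticOnNhd ℝ (F j) ((fun p : Vec2 × ℝ => φ j.castSucc p.1) '' S)) ∧
        ∀ j : Fin 3, ∀ᵐ q ∂(volume.restrict (Φmap (φ j.castSucc) '' S)),
          f j q = |q.2| ^ σ * F j q.1 := by
  have hBo : IsOpen B := by rw [hB]; exact isOpen_ball
  have hBc : Convex ℝ B := by rw [hB]; exact convex_ball _ _
  have hBs : ∀ x ∈ B, x ∈ Bt := fun x hx => hBBt (subset_closure hx)
  have hψ : ∀ j : Fin 3, ∀ x ∈ B, AnalyticAt ℝ (φ j.castSucc) x :=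
    fun j x hx => hφ_an _ x (hBs x hx)
  have h3 : ∀ x ∈ B, fderiv ℝ (φ 3) x = ContinuousLinearMap.fst ℝ ℝ ℝ := by
    intro x hx
    have e1 : φ 3 =ᶠ[𝓝 x] Prod.fst := by
      filter_upwards [hBo.mem_nhds hx] with y hy
      exact hφ4 y hy
    rw [e1.fderiv_eq]
    exact fderiv_fst
  have hQ : ∀ j : Fin 3, ∀ x ∈ B, Dder (φ j.castSucc) x ≠ 0 := by
    intro j x hx h0
    have hj : j.castSucc ≠ (3 : Fin 4) := (Fin.castSucc_lt_last j).ne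
    have e := htrans x hx _ _ hj
    rw [h3 x hx] at e
    have e2 := (LinearIndependent.pair_iff.1 e 1 (-Pder (φ j.castSucc) x) (by
      apply clm_ext2
      · show 1 * Pder (φ j.castSucc) x + -Pder (φ j.castSucc) x * 1 = 0
        ring
      · show 1 * Dder (φ j.castSucc) x + -Pder (φ j.castSucc) x * 0 = 0
        rw [h0]; ring)).1
    exact one_ne_zero e2
  have ht : ∀ x ∈ B, ∀ i k : Fin 3, i ≠ k →
      LinearIndependent ℝ ![fderiv ℝ (φ i.castSucc) x, fderiv ℝ (φ k.castSucc) x] := by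
    intro x hx i k hik
    exact htrans x hx _ _ (fun h => hik (Fin.castSucc_injective _ h))
  have hV1 : ∀ y ∈ B, (V 3 y).1 = 0 := by
    intro y hy
    have := hV_ker 3 y (hBs y hy)
    rw [h3 y hy] at this
    exact this
  have hdet : ∀ x ∈ B, (Amat (fun j : Fin 3 => φ j.castSucc) x).det ≠ 0 := by
    intro x hx
    refine Amat_det hBo hx (fun j => hψ j x hx) (fun j => hQ j x hx) (hV_an 3 x (hBs x hx)) hV1 ?_
      (W := fun j => W j.castSucc 3 (x, 1)) ?_ ?_
    · intro h0
      exact hV_ne 3 x (hBs x hx) (Prod.ext (hV1 x hx) h0)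
    · intro j
      exact hW_ker _ 3 (x, 1) ⟨hBs x hx, mem_univ _⟩
    · intro L hL
      have hind := haux2 3 (x, 1) (hBs x hx) one_ne_zero
      have hsp := hind.span_eq_top_of_card_eq_finrank' (by
        have : Fintype.card {j : Fin 4 // j ≠ 3} = 3 := by decide
        rw [this]; simp)
      refine LinearMap.ext_on_range hsp fun j => ?_
      obtain ⟨i, hi⟩ := Fin.exists_castSucc_eq.2 (show j.1 ≠ Fin.last 3 from j.2)
      have := hL i
      rw [hi] at this
      exact this
  obtain ⟨Ω, hΩo, hΩc, hΩB, f, hfm, hfe, hfn⟩ := hex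
  have hfe' : ∀ p ∈ Ω, ∀ᶠ p in nae p,
      ∑ j : Fin 3, f j (Φmap (φ j.castSucc) p) • fderiv ℝ (φ j.castSucc) p.1 = 0 :=
    fun p hp => nae_of_ae hfe (hΩo.mem_nhds hp)
  obtain ⟨σ, ℓ, d⟩ := build_Dat hBo hBc (ψ := fun j : Fin 3 => φ j.castSucc)
    (a := aa fun j : Fin 3 => φ j.castSucc) hψ hQ
    (fun j x hx => aa_an (fun j => hψ j x hx) j)
    (fun j x hx => aa_ne (fun j => hQ j x hx) (ht x hx) j) hdet
    (fun x hx c hc j => aa_ker (aa_ne (fun j => hQ j x hx) (ht x hx) 0) c hc j) hΩB hfe' hfn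
  refine ⟨σ, ?_, ?_⟩
  · intro S hSo hSc hSB g _ hge _
    exact d.property hBo hSo hSc hSB fun p hp => nae_of_ae hge (hSo.mem_nhds hp)
  · intro τ hτ
    obtain ⟨F', hF', hF'2⟩ := hτ Ω hΩo hΩc hΩB f hfm hfe hfn
    exact d.exponent_unique hBo hΩo hΩc hΩB hfe' hfn hF' hF'2
end
end
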